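/- arXiv:1507.04465 — 2 statements merged into one kernel-verified Lean document; each statement's English description precedes it below -/
import Mathlib

section
/- There is an absolute constant c > 0 such that for every even integer n > 2, the proportion of permutations π in S_n that are contained in some transitive subgroup of S_n not containing the alternating group A_n is at least c · n^{-δ} (log n)^{-3/2}, where δ = 1 - (1 + log log 2)/log 2. -/
open scoped BigOperators

noncomputable section

/-- `δ = 1 - (1 + log log 2)/log 2`. -/
def delta : ℝ := 1 - (1 + Real.log (Real.log 2)) / Real.log 2

/-- A subgroup of `S_n` is transitive if it acts transitively on `{1,…,n}`. -/
def IsTransitiveSubgroup {n : ℕ} (G : Subgroup (Equiv.Perm (Fin n))) : Prop :=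
  ∀ x y : Fin n, ∃ g ∈ G, g x = y

/-- The proportion of permutations of `{1,…,n}` lying in some transitive subgroup
not containing the alternating group. -/
def transProp (n : ℕ) : ℝ :=
  (Nat.card {π : Equiv.Perm (Fin n) //
      ∃ G : Subgroup (Equiv.Perm (Fin n)), π ∈ G ∧ IsTransitiveSubgroup G ∧
        ¬ (alternatingGroup (Fin n) ≤ G)} : ℝ) /
    (Nat.card (Equiv.Perm (Fin n)) : ℝ)

namespace TransitiveProportion

open Finset

section CycleLemma

variable {E : Type*} [Fintype E] [DecidableEq E]

/-- The functions from `E` to `{0, …, l - 1}`. -/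
abbrev slotFns (E : Type*) [Fintype E] [DecidableEq E] (l : ℕ) : Finset (E → ℕ) :=
  Fintype.piFinset fun _ => range l

lemma card_slotFns (l : ℕ) : #(slotFns E l) = l ^ Fintype.card E := by
  simp [slotFns]

/-- The number of elements sent to slots before `j`. -/
def below (f : E → ℕ) (j : ℕ) : ℕ := #{e | f e < j}

/-- Rotation of the cyclically ordered slots `{0, …, l - 1}` which moves `p` to `0`. -/
def rot (l p a : ℕ) : ℕ := if p ≤ a then a - p else a + l - p

lemma below_rot {f : E → ℕ} {l p j : ℕ} (hf : f ∈ slotFns E l) (hj : p + j ≤ l) :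
    below (rot l p ∘ f) j + below f p = below f (p + j) := by
  have hf : ∀ e, f e < l := by simpa [slotFns] using hf
  unfold below
  rw [← card_union_of_disjoint]
  · congr 1
    ext e
    have := hf e
    simp only [mem_union, mem_filter_univ]
    simp only [Function.comp_apply, rot]
    split_ifs <;> omega
  · rw [disjoint_filter]
    intro e _
    have := hf e
    simp only [Function.comp_apply, rot]
    split_ifs <;> omega

lemma below_rot_wrap {f : E → ℕ} {l p j : ℕ} (hf : f ∈ slotFns E l) (hp : p ≤ l) (hj : j ≤ l)
    (hpj : l ≤ p + j) :
    below (rot l p ∘ f) j + below f p = Fintype.card E + below f (p + j - l) := by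
  have hf : ∀ e, f e < l := by simpa [slotFns] using hf
  unfold below
  rw [← card_union_add_card_inter, ← filter_or, ← filter_and]
  congr 1
  · rw [← card_univ]
    congr 1
    ext e
    have := hf e
    simp only [mem_filter_univ, mem_univ, iff_true]
    simp only [Function.comp_apply, rot]
    split_ifs <;> omega
  · congr 1
    ext e
    have := hf e
    simp only [mem_filter_univ]
    simp only [Function.comp_apply, rot]
    split_ifs <;> omega

lemma card_filter_rot (good : (E → ℕ) → Prop) [DecidablePred good] {l p : ℕ} (hp : p < l) :
    #{f ∈ slotFns E l | good (rot l p ∘ f)} = #{f ∈ slotFns E l | good f} := by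
  refine card_nbij' (fun f => rot l p ∘ f) (fun f => rot l (l - p) ∘ f) ?_ ?_ ?_ ?_
  · intro f hf
    simp only [coe_filter, Fintype.mem_piFinset, mem_range, Set.mem_ofPred_eq] at hf ⊢
    refine ⟨fun e => ?_, hf.2⟩
    have := hf.1 e
    simp only [Function.comp_apply, rot]
    split_ifs <;> omega
  · intro f hf
    simp only [coe_filter, Fintype.mem_piFinset, mem_range, Set.mem_ofPred_eq] at hf ⊢
    refine ⟨fun e => ?_, ?_⟩
    · have := hf.1 e
      simp only [Function.comp_apply, rot]
      split_ifs <;> omega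
    · convert hf.2 using 1
      funext e
      have := hf.1 e
      simp only [Function.comp_apply, rot]
      split_ifs <;> omega
  all_goals
    intro f hf
    simp only [coe_filter, Fintype.mem_piFinset, mem_range, Set.mem_ofPred_eq] at hf
    funext e
    have := hf.1 e
    simp only [Function.comp_apply, rot]
    split_ifs <;> omega

lemma card_mul_card_filter (good : (E → ℕ) → Prop) [DecidablePred good] (l : ℕ) :
    l * #{f ∈ slotFns E l | good f} =
      ∑ f ∈ slotFns E l, #{p ∈ range l | good (rot l p ∘ f)} := by
  have : ∑ p ∈ range l, #{f ∈ slotFns E l | good (rot l p ∘ f)} =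
      l * #{f ∈ slotFns E l | good f} := by
    rw [sum_congr rfl fun p hp => card_filter_rot good (mem_range.1 hp)]
    simp
  rw [← this]
  simp only [card_filter]
  rw [sum_comm]

lemma card_le_of_injOn_int_window (s : Finset ℕ) (T : ℕ → ℤ) (D : ℕ)
    (h : ∀ p ∈ s, ∀ q ∈ s, p < q → T p ≠ T q ∧ T q < T p + D ∧ T p < T q + D)
    (hD : s.Nonempty → 0 < D) : #s ≤ D := by
  rcases s.eq_empty_or_nonempty with rfl | hs
  · simp
  have hD := hD hs
  obtain ⟨m, hm, hmin⟩ := exists_min_image s T hs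
  have hinj : Set.InjOn T s := by
    intro p hp q hq hpq
    rcases lt_trichotomy p q with hlt | rfl | hlt
    · exact absurd hpq (h p hp q hq hlt).1
    · rfl
    · exact absurd hpq.symm (h q hq p hp hlt).1
  have hsub : s.image T ⊆ Ico (T m) (T m + D) := by
    intro t ht
    obtain ⟨p, hp, rfl⟩ := mem_image.1 ht
    rw [mem_Ico]
    refine ⟨hmin p hp, ?_⟩
    rcases lt_trichotomy p m with hlt | rfl | hlt
    · exact (h p hp m hm hlt).2.2
    · omega
    · exact (h m hm p hp hlt).2.1
  calc #s = #(s.image T) := (card_image_of_injOn hinj).symm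
    _ ≤ _ := card_le_card hsub
    _ = D := by simp

/-- Every initial segment of slots receives more elements than it has slots. -/
def Overfull (l : ℕ) (f : E → ℕ) : Prop := ∀ j, 1 ≤ j → j ≤ l → j < below f j

/-- Every nonempty final segment of slots receives fewer elements than it has slots. -/
def TailSparse (l : ℕ) (f : E → ℕ) : Prop :=
  ∀ j, j < l → j + Fintype.card E < below f j + l

open Classical in
lemma card_overfull_le (l : ℕ) :
    l * #{f ∈ slotFns E l | Overfull l f} ≤
      (Fintype.card E - l) * l ^ Fintype.card E := by
  rw [card_mul_card_filter, ← card_slotFns (E := E) l, mul_comm, ← smul_eq_mul]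
  refine sum_le_card_nsmul _ _ _ fun f hf => ?_
  refine card_le_of_injOn_int_window _ (fun p => (below f p : ℤ) - p) _ ?_ ?_
  · intro p hp q hq hpq
    simp only [mem_filter, mem_range] at hp hq
    have h1 := hp.2 (q - p) (by omega) (by omega)
    have h2 := hq.2 (l - q + p) (by omega) (by omega)
    have e1 := below_rot (p := p) (j := q - p) hf (by omega)
    have e2 := below_rot_wrap (p := q) (j := l - q + p) hf (by omega) (by omega) (by omega)
    rw [show p + (q - p) = q by omega] at e1
    rw [show q + (l - q + p) - l = p by omega] at e2
    have h3 := hp.2 l (by omega) le_rfl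
    have e3 := below_rot_wrap (p := p) (j := l) hf (by omega) (by omega) (by omega)
    rw [show p + l - l = p by omega] at e3
    omega
  · rintro ⟨p, hp⟩
    simp only [mem_filter, mem_range] at hp
    have h3 := hp.2 l (by omega) le_rfl
    have e3 := below_rot_wrap (p := p) (j := l) hf (by omega) (by omega) (by omega)
    rw [show p + l - l = p by omega] at e3
    omega

open Classical in
lemma card_tailSparse_le (l : ℕ) :
    l * #{f ∈ slotFns E l | TailSparse l f} ≤
      (l - Fintype.card E) * l ^ Fintype.card E := by
  rw [card_mul_card_filter, ← card_slotFns (E := E) l, mul_comm, ← smul_eq_mul]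
  refine sum_le_card_nsmul _ _ _ fun f hf => ?_
  refine card_le_of_injOn_int_window _ (fun p => (below f p : ℤ) - p) _ ?_ ?_
  · intro p hp q hq hpq
    simp only [mem_filter, mem_range] at hp hq
    have h1 := hp.2 (q - p) (by omega)
    have h2 := hq.2 (l - q + p) (by omega)
    have e1 := below_rot (p := p) (j := q - p) hf (by omega)
    have e2 := below_rot_wrap (p := q) (j := l - q + p) hf (by omega) (by omega) (by omega)
    rw [show p + (q - p) = q by omega] at e1
    rw [show q + (l - q + p) - l = p by omega] at e2
    have h3 := hp.2 0 (by omega)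
    have e3 : below (rot l p ∘ f) 0 = 0 := by simp [below]
    omega
  · rintro ⟨p, hp⟩
    simp only [mem_filter, mem_range] at hp
    have h3 := hp.2 0 (by omega)
    have e3 : below (rot l p ∘ f) 0 = 0 := by simp [below]
    omega

open Classical in
lemma le_card_overfull {l : ℕ} (hl : 0 < l) (hE : Fintype.card E = l + 1) :
    l ^ l ≤ #{f ∈ slotFns E l | Overfull l f} := by
  have key : l ^ (l + 1) ≤ l * #{f ∈ slotFns E l | Overfull l f} := by
    rw [card_mul_card_filter, ← hE, ← card_slotFns (E := E) l, card_eq_sum_ones]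
    refine sum_le_sum fun f hf => ?_
    have hne : (range l).Nonempty := ⟨0, by simpa using hl⟩
    obtain ⟨m, hm, hmin⟩ := exists_min_image (range l) (fun p => (below f p : ℤ) - p) hne
    set s : Finset ℕ := {p ∈ range l | ((below f p : ℤ) - p) = (below f m : ℤ) - m} with hs
    have hsne : s.Nonempty := ⟨m, by simp [hs, mem_range.1 hm]⟩
    obtain ⟨p, hp, hmax⟩ := exists_max_image s id hsne
    refine card_pos.2 ⟨p, ?_⟩
    simp only [hs, mem_filter, mem_range] at hp
    have hmin' : ∀ q, q < l → (below f p : ℤ) - p ≤ below f q - q := fun q hq => by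
      have := hmin q (mem_range.2 hq)
      omega
    have hmax' : ∀ q, q < l → p < q → (below f p : ℤ) - p < below f q - q := fun q hq hpq => by
      refine lt_of_le_of_ne (hmin' q hq) fun h => ?_
      have := hmax q (by simp [hs, hq]; omega)
      simp at this
      omega
    simp only [mem_filter, mem_range]
    refine ⟨hp.1, fun j hj1 hjl => ?_⟩
    rcases lt_or_ge (p + j) l with h | h
    · have e1 := below_rot (p := p) (j := j) hf h.le
      have := hmax' (p + j) h (by omega)
      omega
    · have e1 := below_rot_wrap (p := p) (j := j) hf hp.1.le hjl h
      have := hmin' (p + j - l) (by omega)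
      omega
  rw [pow_succ, mul_comm] at key
  exact Nat.le_of_mul_le_mul_left key hl

end CycleLemma

section Splitting

lemma card_filter_subtype {E : Type*} (A : Finset E) (P : E → Prop) [DecidablePred P] :
    #{e : {x // x ∈ A} | P e} = #{e ∈ A | P e} := by
  rw [← card_map (Function.Embedding.subtype _)]
  congr 1
  ext e
  simp [and_comm]

variable {E : Type*} [Fintype E] [DecidableEq E]

open Classical in
lemma card_overfull_apply_eq_le {K : ℕ} (hE : Fintype.card E = K + 1) (e : E) (v : ℕ) :
    (K + 1) * #{f ∈ slotFns E K | Overfull K f ∧ f e = v} ≤ (K + 1) ^ K := by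
  set A : Finset E := {e}ᶜ with hA
  have hcard : Fintype.card {x // x ∈ A} = K := by
    rw [Fintype.card_coe, hA, card_compl, card_singleton, hE]; rfl
  have h1 := card_tailSparse_le (E := {x // x ∈ A}) (K + 1)
  rw [hcard, Nat.add_sub_cancel_left, one_mul] at h1
  refine le_trans (Nat.mul_le_mul_left _ ?_) h1
  refine card_le_card_of_injOn (fun f x => f x) ?_ ?_
  · intro f hf
    simp only [coe_filter, Fintype.mem_piFinset, mem_range, Set.mem_ofPred_eq] at hf ⊢
    refine ⟨fun x => (hf.1 x).trans (Nat.lt_succ_self K), fun j hj => ?_⟩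
    rw [hcard]
    have h2 : below f j ≤ below (fun x : {x // x ∈ A} => f x) j + 1 := by
      unfold below
      rw [card_filter_subtype A (fun x => f x < j)]
      have : ({x | f x < j} : Finset E) ⊆ insert e {x ∈ A | f x < j} := by
        intro x
        simp only [mem_univ, true_and, mem_insert, mem_filter, hA, mem_compl, mem_singleton]
        tauto
      exact (card_le_card this).trans (card_insert_le _ _)
    rcases Nat.eq_zero_or_pos j with rfl | h0
    · omega
    · have := hf.2.1 j h0 (by omega)
      omega
  · intro f hf g hg hfg
    simp only [coe_filter, Fintype.mem_piFinset, mem_range, Set.mem_ofPred_eq] at hf hg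
    funext x
    by_cases hx : x = e
    · rw [hx, hf.2.2, hg.2.2]
    · exact congrFun hfg ⟨x, by simp [hA, hx]⟩

open Classical in
lemma card_overfull_tail_eq_le {K v s h : ℕ} (hE : Fintype.card E = K + 1) (hK : s + h + v = K)
    (A : Finset E) (hs : #A = s) :
    #{f ∈ slotFns E K | Overfull K f ∧ ({e | v ≤ f e} : Finset E) = A} ≤
      #{g ∈ slotFns {x // x ∈ Aᶜ} v | Overfull v g} *
        #{g ∈ slotFns {x // x ∈ A} (s + h + 1) | TailSparse (s + h + 1) g} := by
  rw [← card_product]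
  refine card_le_card_of_injOn (fun f => (fun x => f x, fun x => f x - v)) ?_ ?_
  · intro f hf
    simp only [coe_filter, Fintype.mem_piFinset, mem_range, Set.mem_ofPred_eq] at hf
    obtain ⟨hf1, hf2, hf3⟩ := hf
    have hmem : ∀ x, x ∈ A ↔ v ≤ f x := fun x => by rw [← hf3]; simp
    simp only [coe_product, Set.mem_prod, coe_filter, Fintype.mem_piFinset, mem_range,
      Set.mem_ofPred_eq]
    refine ⟨⟨fun x => ?_, fun j hj1 hj2 => ?_⟩, fun x => ?_, fun j hj => ?_⟩
    · have := x.2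
      rw [mem_compl, hmem] at this
      omega
    · have := hf2 j hj1 (by omega)
      convert this using 1
      unfold below
      rw [card_filter_subtype Aᶜ (fun x => f x < j)]
      congr 1
      ext x
      simp only [mem_filter, mem_compl, hmem, mem_univ, true_and]
      omega
    · have := hf1 x
      omega
    · have hb : below f (v + j) = #Aᶜ + below (fun x : {x // x ∈ A} => f x - v) j := by
        unfold below
        rw [card_filter_subtype A (fun x => f x - v < j), ← card_union_of_disjoint]
        · congr 1
          ext x
          simp only [mem_filter, mem_univ, true_and, mem_union, mem_compl, hmem]
          omega
        · refine disjoint_left.2 fun x hx hx' => ?_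
          rw [mem_compl] at hx
          exact hx (mem_filter.1 hx').1
      rw [card_compl, hE, hs] at hb
      rw [Fintype.card_coe, hs]
      rcases Nat.eq_zero_or_pos (v + j) with h0 | h0
      · omega
      · have := hf2 (v + j) h0 (by omega)
        omega
  · intro f hf g hg hfg
    simp only [coe_filter, Fintype.mem_piFinset, mem_range, Set.mem_ofPred_eq] at hf hg
    have hmemf : ∀ x, x ∈ A ↔ v ≤ f x := fun x => by rw [← hf.2.2]; simp
    have hmemg : ∀ x, x ∈ A ↔ v ≤ g x := fun x => by rw [← hg.2.2]; simp
    rw [Prod.mk.injEq] at hfg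
    funext x
    by_cases hx : x ∈ A
    · have h1 := congrFun hfg.2 ⟨x, hx⟩
      have h2 := (hmemf x).1 hx
      have h3 := (hmemg x).1 hx
      dsimp only at h1
      omega
    · exact congrFun hfg.1 ⟨x, by simpa using hx⟩

/-- The number of elements in slots `v` and later. -/
def tailCard (f : E → ℕ) (v : ℕ) : ℕ := #{e | v ≤ f e}

open Classical in
lemma card_overfull_tailCard_eq_le {K v s h : ℕ} (hE : Fintype.card E = K + 1)
    (hK : s + h + v = K) (hv : 0 < v) :
    (s + h + 1) * #{f ∈ slotFns E K | Overfull K f ∧ tailCard f v = s} ≤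
      (K + 1).choose s * (h + 1) ^ 2 * v ^ (v + h) * (s + h + 1) ^ s := by
  have hA : ∀ A ∈ powersetCard s (univ : Finset E), (s + h + 1) *
      #{f ∈ slotFns E K | Overfull K f ∧ ({e | v ≤ f e} : Finset E) = A} ≤
        (h + 1) ^ 2 * v ^ (v + h) * (s + h + 1) ^ s := by
    intro A hA
    have hs : #A = s := (mem_powersetCard.1 hA).2
    have h1 := card_overfull_le (E := {x // x ∈ Aᶜ}) v
    have h2 := card_tailSparse_le (E := {x // x ∈ A}) (s + h + 1)
    rw [Fintype.card_coe, card_compl, hE, hs, show K + 1 - s - v = h + 1 by omega,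
      show K + 1 - s = v + h + 1 by omega, pow_succ, ← mul_assoc, mul_comm _ v] at h1
    rw [Fintype.card_coe, hs, show s + h + 1 - s = h + 1 by omega] at h2
    have h1 := Nat.le_of_mul_le_mul_left h1 hv
    calc _ ≤ (s + h + 1) * (_ * _) :=
          Nat.mul_le_mul_left _ (card_overfull_tail_eq_le hE hK A hs)
      _ = _ * ((s + h + 1) * _) := by ring
      _ ≤ _ := Nat.mul_le_mul h1 h2
      _ = _ := by ring
  have hsub : ({f ∈ slotFns E K | Overfull K f ∧ tailCard f v = s} : Finset (E → ℕ)) ⊆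
      (powersetCard s (univ : Finset E)).biUnion fun A =>
        {f ∈ slotFns E K | Overfull K f ∧ ({e | v ≤ f e} : Finset E) = A} := by
    intro f hf
    rw [mem_filter] at hf
    rw [mem_biUnion]
    exact ⟨({e | v ≤ f e} : Finset E), mem_powersetCard.2 ⟨subset_univ _, hf.2.2⟩,
      mem_filter.2 ⟨hf.1, hf.2.1, rfl⟩⟩
  calc _ ≤ (s + h + 1) * ∑ A ∈ powersetCard s (univ : Finset E),
          #{f ∈ slotFns E K | Overfull K f ∧ ({e | v ≤ f e} : Finset E) = A} :=
        Nat.mul_le_mul_left _ ((card_le_card hsub).trans card_biUnion_le)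
    _ ≤ #(powersetCard s (univ : Finset E)) • ((h + 1) ^ 2 * v ^ (v + h) * (s + h + 1) ^ s) := by
        rw [mul_sum]
        exact sum_le_card_nsmul _ _ _ hA
    _ = _ := by
        rw [card_powersetCard, card_univ, hE, smul_eq_mul]
        ring

end Splitting

section FactorialBounds

lemma exp_mul_factorial_le {n : ℕ} (hn : 0 < n) :
    Real.exp n * (n.factorial : ℝ) ≤ Real.exp 1 * √n * (n : ℝ) ^ n := by
  obtain ⟨k, rfl⟩ := Nat.exists_eq_succ_of_ne_zero hn.ne'
  have h := Stirling.stirlingSeq'_antitone (Nat.zero_le k)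
  simp only [Function.comp_apply, Nat.succ_eq_add_one, zero_add, Stirling.stirlingSeq_one] at h ⊢
  unfold Stirling.stirlingSeq at h
  set n := k + 1
  have hn' : (0 : ℝ) < n := by positivity
  have h2 : (0 : ℝ) < √2 := by positivity
  rw [div_le_div_iff₀ (by positivity) h2, Real.sqrt_mul (by norm_num), div_pow,
    ← Real.exp_nat_mul, mul_one] at h
  have he : 0 < Real.exp (n : ℝ) := Real.exp_pos _
  have h3 : (n.factorial : ℝ) * √2 * Real.exp n ≤
      (Real.exp 1 * √n * (n : ℝ) ^ n) * √2 := by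
    calc _ ≤ Real.exp 1 * (√2 * √n * ((n : ℝ) ^ n / Real.exp n)) * Real.exp n := by gcongr
      _ = _ := by field_simp
  refine le_of_mul_le_mul_right ?_ h2
  linarith

lemma pow_self_mul_sqrt_le (s : ℕ) :
    (s : ℝ) ^ s * √(s + 1) ≤ Real.exp s * s.factorial := by
  rcases Nat.eq_zero_or_pos s with rfl | hs
  · simp
  have h := Stirling.le_factorial_stirling s
  have hs' : (1 : ℝ) ≤ s := by exact_mod_cast hs
  rw [div_pow, ← Real.exp_nat_mul, mul_one] at h
  have he : 0 < Real.exp (s : ℝ) := Real.exp_pos _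
  have h1 : √((s : ℝ) + 1) ≤ √(2 * Real.pi * s) := by
    apply Real.sqrt_le_sqrt
    nlinarith [Real.pi_gt_three]
  calc (s : ℝ) ^ s * √(s + 1) ≤ (s : ℝ) ^ s * √(2 * Real.pi * s) := by gcongr
    _ = Real.exp s * (√(2 * Real.pi * s) * ((s : ℝ) ^ s / Real.exp s)) := by field_simp
    _ ≤ _ := by gcongr

lemma add_pow_le_pow_mul_exp (s : ℕ) {t : ℝ} (ht : 0 ≤ t) :
    ((s : ℝ) + t) ^ s ≤ (s : ℝ) ^ s * Real.exp t := by
  rcases Nat.eq_zero_or_pos s with rfl | hs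
  · simpa using ht
  have hs' : (0 : ℝ) < s := by exact_mod_cast hs
  have h1 : (s : ℝ) + t ≤ s * Real.exp (t / s) := by
    have := Real.add_one_le_exp (t / s)
    calc (s : ℝ) + t = s * (t / s + 1) := by field_simp; ring
      _ ≤ _ := by gcongr
  calc _ ≤ (s * Real.exp (t / s)) ^ s := by gcongr
    _ = _ := by
      rw [mul_pow, ← Real.exp_nat_mul]
      congr 2
      field_simp

lemma sub_pow_le_pow_mul_exp {N : ℕ} {t : ℝ} (htN : t ≤ N) :
    ((N : ℝ) - t) ^ N ≤ (N : ℝ) ^ N * Real.exp (-t) := by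
  rcases Nat.eq_zero_or_pos N with rfl | hs
  · simpa using htN
  have hs' : (0 : ℝ) < N := by exact_mod_cast hs
  have h1 : (N : ℝ) - t = N * (1 - t / N) := by field_simp
  rw [h1, mul_pow]
  gcongr
  exact Real.one_sub_div_pow_le_exp_neg htN

/-- The function `s ↦ (s + 1) ^ (-3/2)`. -/
def threeHalves (s : ℕ) : ℝ := 1 / ((s + 1) * √(s + 1))

lemma threeHalves_pos (s : ℕ) : 0 < threeHalves s := by
  unfold threeHalves; positivity

lemma pow_self_div_factorial_le (s : ℕ) :
    (s : ℝ) ^ s / (s.factorial * (s + 1)) ≤ Real.exp s * threeHalves s := by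
  unfold threeHalves
  have := pow_self_mul_sqrt_le s
  rw [mul_one_div, div_le_div_iff₀ (by positivity) (by positivity)]
  calc _ = ((s : ℝ) ^ s * √(s + 1)) * (s + 1) := by ring
    _ ≤ (Real.exp s * s.factorial) * (s + 1) := by gcongr
    _ = _ := by ring

lemma summable_threeHalves : Summable threeHalves := by
  have h : Summable fun n : ℕ => 1 / (n : ℝ) ^ (3 / 2 : ℝ) :=
    Real.summable_one_div_nat_rpow.2 (by norm_num)
  refine ((summable_nat_add_iff 1).2 h).congr fun n => ?_
  unfold threeHalves
  have h0 : (0 : ℝ) < (n : ℝ) + 1 := by positivity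
  rw [show (3 / 2 : ℝ) = 1 + 1 / 2 by norm_num]
  push_cast
  rw [Real.rpow_add h0, Real.rpow_one, ← Real.sqrt_eq_rpow]

lemma threeHalves_le_of_le_two_mul {s K : ℕ} (h : K ≤ 2 * s) :
    threeHalves s ≤ 4 * threeHalves K := by
  unfold threeHalves
  have h' : (K : ℝ) ≤ 2 * s := by exact_mod_cast h
  have h1 : √((K : ℝ) + 1) ≤ 2 * √((s : ℝ) + 1) := by
    rw [show (2 : ℝ) = √4 by rw [show (4 : ℝ) = 2 ^ 2 by norm_num]; simp,
      ← Real.sqrt_mul (by norm_num)]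
    apply Real.sqrt_le_sqrt
    linarith
  rw [mul_one_div, div_le_div_iff₀ (by positivity) (by positivity), one_mul]
  calc ((K : ℝ) + 1) * √(K + 1) ≤ (2 * (s + 1)) * (2 * √(s + 1)) := by
        gcongr; linarith
    _ = _ := by ring

lemma sum_threeHalves_convolution_le (K : ℕ) :
    ∑ s ∈ range (K + 1), threeHalves s * threeHalves (K - s) ≤
      8 * threeHalves K * ∑' s, threeHalves s := by
  have h1 : ∀ s ∈ range (K + 1), threeHalves s * threeHalves (K - s) ≤
      4 * threeHalves K * threeHalves s + 4 * threeHalves K * threeHalves (K - s) := by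
    intro s hs
    have p1 := threeHalves_pos s
    have p2 := threeHalves_pos (K - s)
    have p3 := threeHalves_pos K
    rcases le_total K (2 * s) with h | h
    · have := threeHalves_le_of_le_two_mul h
      nlinarith
    · have := threeHalves_le_of_le_two_mul (s := K - s) (K := K) (by omega)
      nlinarith
  have h2 : ∑ s ∈ range (K + 1), threeHalves s ≤ ∑' s, threeHalves s :=
    summable_threeHalves.sum_le_tsum _ fun _ _ => (threeHalves_pos _).le
  have h3 : ∑ s ∈ range (K + 1), threeHalves (K - s) = ∑ s ∈ range (K + 1), threeHalves s := by
    simpa using sum_range_reflect threeHalves (K + 1)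
  have p3 := threeHalves_pos K
  calc _ ≤ _ := sum_le_sum h1
    _ = 8 * threeHalves K * ∑ s ∈ range (K + 1), threeHalves s := by
      rw [sum_add_distrib, ← mul_sum, ← mul_sum, h3]; ring
    _ ≤ _ := by gcongr

lemma succ_pow_le (K : ℕ) : ((K : ℝ) + 1) ^ K ≤ Real.exp 1 * (K : ℝ) ^ K := by
  have := add_pow_le_pow_mul_exp K (zero_le_one (α := ℝ))
  linarith

lemma factorial_mul_exp_mul_threeHalves_le (K : ℕ) :
    ((K + 1).factorial : ℝ) * Real.exp (K + 1) * threeHalves K ≤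
      Real.exp 1 * Real.exp 1 * (K : ℝ) ^ K := by
  have h1 := exp_mul_factorial_le (Nat.succ_pos K)
  rw [Nat.succ_eq_add_one] at h1
  push_cast at h1
  have h2 := succ_pow_le K
  have h3 : 0 < √((K : ℝ) + 1) := by positivity
  calc _ = (Real.exp (K + 1) * ((K + 1).factorial : ℝ)) * threeHalves K := by ring
    _ ≤ (Real.exp 1 * √(K + 1) * ((K : ℝ) + 1) ^ (K + 1)) * threeHalves K := by
        have := threeHalves_pos K; gcongr
    _ = Real.exp 1 * ((K : ℝ) + 1) ^ K := by
        unfold threeHalves; rw [pow_succ]; field_simp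
    _ ≤ _ := by rw [mul_assoc]; gcongr

lemma splitting_bound {s N h : ℕ} (hN : h ≤ N) :
    ((s + N + 1).choose s : ℝ) * (h + 1) ^ 2 * ((N : ℝ) - h) ^ N * ((s : ℝ) + (h + 1)) ^ s /
        (s + h + 1) ≤
      (s + N + 1).factorial * Real.exp (s + N + 1) * (h + 1) ^ 2 *
        (threeHalves s * threeHalves N) := by
  have hc : ((s + N + 1).choose s : ℝ) =
      (s + N + 1).factorial / (s.factorial * (N + 1).factorial) := by
    rw [Nat.choose_eq_factorial_div_factorial (by omega),
      Nat.cast_div (Nat.factorial_mul_factorial_dvd_factorial (by omega)) (by positivity),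
      show s + N + 1 - s = N + 1 by omega]
    push_cast
    rfl
  have h1 := sub_pow_le_pow_mul_exp (N := N) (t := h) (by exact_mod_cast hN)
  have h2 := add_pow_le_pow_mul_exp s (t := (h : ℝ) + 1) (by positivity)
  have h3 := pow_self_div_factorial_le s
  have h4 := pow_self_div_factorial_le N
  have hNh : (0 : ℝ) ≤ (N : ℝ) - h := by
    have : (h : ℝ) ≤ N := by exact_mod_cast hN
    linarith
  have p1 := threeHalves_pos s
  rw [hc, Nat.factorial_succ N]
  push_cast
  calc _ ≤ ((s + N + 1).factorial / (s.factorial * ((N + 1) * N.factorial)) : ℝ) * (h + 1) ^ 2 *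
        ((N : ℝ) ^ N * Real.exp (-h)) * ((s : ℝ) ^ s * Real.exp (h + 1)) / (s + 1) := by
        gcongr
        linarith
    _ = (s + N + 1).factorial * (h + 1) ^ 2 * (Real.exp (-h) * Real.exp (h + 1)) *
        (((s : ℝ) ^ s / (s.factorial * (s + 1))) * ((N : ℝ) ^ N / (N.factorial * (N + 1)))) := by
        field_simp
    _ ≤ (s + N + 1).factorial * (h + 1) ^ 2 * (Real.exp (-h) * Real.exp (h + 1)) *
        ((Real.exp s * threeHalves s) * (Real.exp N * threeHalves N)) := by gcongr
    _ = _ := by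
        rw [← Real.exp_add, show (-(h : ℝ) + (h + 1)) = 1 by ring, Real.exp_add, Real.exp_add]
        ring

end FactorialBounds

section Selection

lemma below_add_tailCard {E : Type*} [Fintype E] (f : E → ℕ) (v : ℕ) :
    below f v + tailCard f v = Fintype.card E := by
  unfold below tailCard
  have : univ.filter (fun e => v ≤ f e) = univ.filter (fun e => ¬ f e < v) := by
    ext e
    simp
  rw [this, card_filter_add_card_filter_not, card_univ]

variable {E : Type*} [Fintype E] [DecidableEq E]

omit [DecidableEq E] in
lemma Overfull.tailCard_le {K v : ℕ} (hE : Fintype.card E = K + 1) {f : E → ℕ}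
    (hf : Overfull K f) (hv : 0 < v) (hvK : v ≤ K) : tailCard f v ≤ K - v := by
  have h1 := hf v hv hvK
  have h2 := below_add_tailCard f v
  omega

/-- A measure of how crowded the slots are, read from the last slot backwards. -/
def crowding (K : ℕ) (f : E → ℕ) : ℝ := ∑ v ∈ range K, (2 : ℝ) ^ tailCard f v / 2 ^ (K - v)

/-- The total mass of the elements, an element in slot `v` having mass `2 ^ (-v)`. -/
def mass (f : E → ℕ) : ℝ := ∑ e, (1 / 2 : ℝ) ^ f e

/-- The function `h ↦ (h + 1) ^ 2 / 2 ^ h`. -/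
def quadGeom (h : ℕ) : ℝ := ((h : ℝ) + 1) ^ 2 * (1 / 2) ^ h

lemma quadGeom_nonneg (h : ℕ) : 0 ≤ quadGeom h := by unfold quadGeom; positivity

lemma summable_quadGeom : Summable quadGeom := by
  have h := summable_pow_mul_geometric_of_norm_lt_one 2 (r := (1 / 2 : ℝ)) (by norm_num)
  have h' := ((summable_nat_add_iff 1).2 h).mul_left 2
  refine h'.congr fun n => ?_
  unfold quadGeom
  push_cast
  rw [pow_succ]
  ring

open Classical in
lemma card_overfull_tailCard_eq_le_real {K v s h : ℕ} (hE : Fintype.card E = K + 1)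
    (hK : s + h + v = K) (hv : 0 < v) :
    (#{f ∈ slotFns E K | Overfull K f ∧ tailCard f v = s} : ℝ) ≤
      (K + 1).factorial * Real.exp (K + 1) * (h + 1) ^ 2 *
        (threeHalves s * threeHalves (K - s)) := by
  have h1 := card_overfull_tailCard_eq_le hE hK hv
  have h2 := splitting_bound (s := s) (N := v + h) (h := h) (by omega)
  have hsN : s + (v + h) = K := by omega
  have hsN' : (s : ℝ) + ((v + h : ℕ) : ℝ) = K := by exact_mod_cast hsN
  rw [hsN, add_assoc (s : ℝ), ← add_assoc _ _ (1 : ℝ), hsN'] at h2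
  rw [show K - s = v + h by omega]
  refine le_trans ?_ h2
  rw [le_div_iff₀ (by positivity)]
  have h1' : (((s + h + 1) * #{f ∈ slotFns E K | Overfull K f ∧ tailCard f v = s} : ℕ) : ℝ) ≤
    (((K + 1).choose s * (h + 1) ^ 2 * v ^ (v + h) * (s + h + 1) ^ s : ℕ) : ℝ) := by
    exact_mod_cast h1
  push_cast at h1' ⊢
  rw [add_sub_cancel_right]
  linarith

lemma sum_quadGeom_shift_le (K s : ℕ) :
    ∑ v ∈ Ico 1 K with v + s ≤ K, quadGeom (K - v - s) ≤ ∑' h, quadGeom h := by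
  rw [← sum_image (f := quadGeom) (g := fun v => K - v - s)]
  · exact summable_quadGeom.sum_le_tsum _ fun _ _ => quadGeom_nonneg _
  · intro a ha b hb hab
    simp only [coe_filter, mem_Ico, Set.mem_ofPred_eq] at ha hb hab
    omega

open Classical in
lemma sum_two_pow_tailCard_le {K : ℕ} (hE : Fintype.card E = K + 1) :
    ∑ f ∈ slotFns E K with Overfull K f, ∑ v ∈ Ico 1 K, (2 : ℝ) ^ tailCard f v / 2 ^ (K - v) ≤
      8 * (∑' s, threeHalves s) * (∑' h, quadGeom h) *
        (Real.exp 1 * Real.exp 1 * (K : ℝ) ^ K) := by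
  set B : ℝ := (K + 1).factorial * Real.exp (K + 1) with hB
  have hv : ∀ v ∈ Ico 1 K, ∑ f ∈ slotFns E K with Overfull K f,
      (2 : ℝ) ^ tailCard f v / 2 ^ (K - v) ≤
      ∑ s ∈ range (K - v + 1), B * (threeHalves s * threeHalves (K - s)) *
        quadGeom (K - v - s) := by
    intro v hv
    rw [mem_Ico] at hv
    rw [← sum_fiberwise_of_maps_to (g := fun f => tailCard f v) (t := range (K - v + 1))
      (fun f hf => by
        have := (mem_filter.1 hf).2.tailCard_le hE hv.1 hv.2.le
        rw [mem_range]
        omega)]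
    refine sum_le_sum fun s hs => ?_
    rw [mem_range] at hs
    rw [filter_filter]
    have h1 := card_overfull_tailCard_eq_le_real hE (h := K - v - s)
      (show s + (K - v - s) + v = K by omega) hv.1
    have h2 : ∀ f ∈ (slotFns E K).filter (fun f => Overfull K f ∧ tailCard f v = s),
        (2 : ℝ) ^ tailCard f v / 2 ^ (K - v) = (1 / 2) ^ (K - v - s) := by
      intro f hf
      rw [(mem_filter.1 hf).2.2, show K - v = s + (K - v - s) by omega,
        show s + (K - v - s) - s = K - v - s by omega, pow_add, div_pow, one_pow]
      field_simp
    rw [sum_congr rfl h2, sum_const, nsmul_eq_mul]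
    calc _ ≤ _ * (1 / 2 : ℝ) ^ (K - v - s) := mul_le_mul_of_nonneg_right h1 (by positivity)
      _ = _ := by unfold quadGeom; rw [hB]; ring
  rw [sum_comm]
  refine (sum_le_sum hv).trans ?_
  rw [sum_comm' (t' := range (K + 1)) (s' := fun s => {v ∈ Ico 1 K | v + s ≤ K})
    (fun v s => by simp only [mem_Ico, mem_range, mem_filter]; omega)]
  have hB0 : 0 ≤ B := by positivity
  have hQ : 0 ≤ ∑' h, quadGeom h := tsum_nonneg quadGeom_nonneg
  calc _ ≤ ∑ s ∈ range (K + 1), B * (threeHalves s * threeHalves (K - s)) *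
        ∑' h, quadGeom h := by
        refine sum_le_sum fun s _ => ?_
        rw [← mul_sum]
        have p1 := threeHalves_pos s
        have p2 := threeHalves_pos (K - s)
        exact mul_le_mul_of_nonneg_left (sum_quadGeom_shift_le K s) (by positivity)
    _ = B * (∑ s ∈ range (K + 1), threeHalves s * threeHalves (K - s)) * ∑' h, quadGeom h := by
        rw [← sum_mul, mul_sum]
    _ ≤ B * (8 * threeHalves K * ∑' s, threeHalves s) * ∑' h, quadGeom h := by
        gcongr
        exact sum_threeHalves_convolution_le K
    _ = 8 * (∑' s, threeHalves s) * (∑' h, quadGeom h) * (B * threeHalves K) := by ring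
    _ ≤ _ := by
        have hT : 0 ≤ ∑' s, threeHalves s := tsum_nonneg fun s => (threeHalves_pos s).le
        have := factorial_mul_exp_mul_threeHalves_le K
        gcongr

open Classical in
lemma sum_crowding_le : ∃ C : ℝ, 0 < C ∧ ∀ {E : Type} [Fintype E] [DecidableEq E] (K : ℕ), 0 < K →
    Fintype.card E = K + 1 → ∑ f ∈ slotFns E K with Overfull K f, crowding K f ≤
      C * #{f ∈ slotFns E K | Overfull K f} := by
  set C₀ : ℝ := 8 * (∑' s, threeHalves s) * (∑' h, quadGeom h) * (Real.exp 1 * Real.exp 1)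
  have hC₀ : 0 ≤ C₀ := by
    have h1 : 0 ≤ ∑' h, quadGeom h := tsum_nonneg quadGeom_nonneg
    have h2 : 0 ≤ ∑' s, threeHalves s := tsum_nonneg fun s => (threeHalves_pos s).le
    positivity
  refine ⟨2 + C₀, by positivity, fun {E} _ _ K hK hE => ?_⟩
  have h1 := sum_two_pow_tailCard_le hE
  have h2 : (K : ℝ) ^ K ≤ #{f ∈ slotFns E K | Overfull K f} := by
    exact_mod_cast le_card_overfull hK hE
  have h3 : ∀ f ∈ (slotFns E K).filter (fun f => Overfull K f),
      crowding K f = 2 + ∑ v ∈ Ico 1 K, (2 : ℝ) ^ tailCard f v / 2 ^ (K - v) := by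
    intro f _
    unfold crowding
    rw [range_eq_Ico, sum_eq_sum_Ico_succ_bot hK]
    congr 1
    have : tailCard f 0 = K + 1 := by simp [tailCard, hE]
    rw [this, Nat.sub_zero, pow_succ]
    field_simp
  rw [sum_congr rfl h3, sum_add_distrib, sum_const, nsmul_eq_mul]
  calc _ ≤ _ + C₀ * (K : ℝ) ^ K := by gcongr; exact h1.trans_eq (by ring)
    _ ≤ _ + C₀ * #{f ∈ slotFns E K | Overfull K f} := by gcongr
    _ = _ := by ring

open Classical in
lemma sum_mass_le {K : ℕ} (hK : 0 < K) (hE : Fintype.card E = K + 1) :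
    ∑ f ∈ slotFns E K with Overfull K f, mass f ≤
      2 * Real.exp 1 * #{f ∈ slotFns E K | Overfull K f} := by
  have h2 : (K : ℝ) ^ K ≤ #{f ∈ slotFns E K | Overfull K f} := by
    exact_mod_cast le_card_overfull hK hE
  have h0 : (0 : ℝ) < (K : ℝ) + 1 := by positivity
  have he : ∀ e : E, ∑ f ∈ slotFns E K with Overfull K f, (1 / 2 : ℝ) ^ f e ≤
      2 * (((K : ℝ) + 1) ^ K / (K + 1)) := by
    intro e
    rw [← sum_fiberwise_of_maps_to (g := fun f => f e) (t := range K)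
      (fun f hf => by
        have := (mem_filter.1 hf).1
        rw [Fintype.mem_piFinset] at this
        exact this e)]
    have hv : ∀ v ∈ range K, ∑ f ∈ ((slotFns E K).filter fun f => Overfull K f) with f e = v,
        (1 / 2 : ℝ) ^ f e ≤ (1 / 2) ^ v * (((K : ℝ) + 1) ^ K / (K + 1)) := by
      intro v _
      rw [filter_filter]
      rw [sum_congr rfl fun f hf => by rw [(mem_filter.1 hf).2.2], sum_const, nsmul_eq_mul,
        mul_comm]
      gcongr
      rw [le_div_iff₀ h0, mul_comm]
      exact_mod_cast card_overfull_apply_eq_le hE e v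
    refine (sum_le_sum hv).trans ?_
    rw [← sum_mul]
    gcongr
    refine le_trans ?_ tsum_geometric_two.le
    exact summable_geometric_two.sum_le_tsum _ fun _ _ => by positivity
  unfold mass
  rw [sum_comm]
  calc _ ≤ ∑ e : E, 2 * (((K : ℝ) + 1) ^ K / (K + 1)) := sum_le_sum fun e _ => he e
    _ = 2 * ((K : ℝ) + 1) ^ K := by
        rw [sum_const, card_univ, hE, nsmul_eq_mul]
        push_cast
        field_simp
    _ ≤ 2 * (Real.exp 1 * (K : ℝ) ^ K) := by gcongr; exact succ_pow_le K
    _ ≤ _ := by rw [mul_assoc]; gcongr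

lemma card_filter_lt_le_of_sum_le {ι : Type*} (s : Finset ι) (g : ι → ℝ) (hg : ∀ i ∈ s, 0 ≤ g i)
    {C : ℝ} (hC : 0 < C) (h : ∑ i ∈ s, g i ≤ C * #s) :
    4 * (#{i ∈ s | 4 * C < g i} : ℝ) ≤ #s := by
  have h1 : (#{i ∈ s | 4 * C < g i} : ℝ) * (4 * C) ≤ ∑ i ∈ s, g i := by
    rw [← nsmul_eq_mul]
    refine (card_nsmul_le_sum _ g _ fun i hi => (mem_filter.1 hi).2.le).trans ?_
    exact sum_le_sum_of_subset_of_nonneg (filter_subset _ _) fun i hi _ => hg i hi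
  have h2 : C * (4 * (#{i ∈ s | 4 * C < g i} : ℝ)) ≤ C * #s := by linarith
  exact le_of_mul_le_mul_left h2 hC

/-- Many slot assignments are neither crowded nor heavy. -/
lemma exists_slot_assignments : ∃ C : ℝ, 0 < C ∧ ∀ K : ℕ, 0 < K →
    ∃ F ⊆ slotFns (Fin (K + 1)) K, (K : ℝ) ^ K ≤ 2 * #F ∧
      ∀ f ∈ F, crowding K f ≤ C ∧ mass f ≤ C := by
  classical
  obtain ⟨C₁, hC₁, h₁⟩ := sum_crowding_le
  refine ⟨max (4 * C₁) (4 * (2 * Real.exp 1)), by positivity, fun K hK => ?_⟩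
  have hE : Fintype.card (Fin (K + 1)) = K + 1 := Fintype.card_fin _
  set G : Finset (Fin (K + 1) → ℕ) := {f ∈ slotFns (Fin (K + 1)) K | Overfull K f} with hG
  have hGcard : (K : ℝ) ^ K ≤ #G := by exact_mod_cast le_card_overfull hK hE
  have b1 := card_filter_lt_le_of_sum_le G (crowding K)
    (fun f _ => by unfold crowding; positivity) hC₁ (h₁ K hK hE)
  have b2 := card_filter_lt_le_of_sum_le G mass
    (fun f _ => by unfold mass; positivity) (by positivity) (sum_mass_le hK hE)
  set B₁ := G.filter fun f => 4 * C₁ < crowding K f with hB₁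
  set B₂ := G.filter fun f => 4 * (2 * Real.exp 1) < mass f with hB₂
  refine ⟨G \ (B₁ ∪ B₂), sdiff_subset.trans (filter_subset _ _), ?_, ?_⟩
  · have h1 : #G ≤ #(G \ (B₁ ∪ B₂)) + (#B₁ + #B₂) := by
      have := card_le_card_sdiff_add_card (s := G) (t := B₁ ∪ B₂)
      have := card_union_le B₁ B₂
      omega
    have h2 : (#G : ℝ) ≤ #(G \ (B₁ ∪ B₂)) + (#B₁ + #B₂) := by exact_mod_cast h1
    linarith
  · intro f hf
    rw [mem_sdiff, mem_union] at hf
    exact ⟨le_max_of_le_left (not_lt.1 fun h => hf.2 (Or.inl (mem_filter.2 ⟨hf.1, h⟩))),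
      le_max_of_le_right (not_lt.1 fun h => hf.2 (Or.inr (mem_filter.2 ⟨hf.1, h⟩)))⟩

end Selection

section SubsetSums

lemma log_sub_log_le_sum_Ico {N M : ℕ} (hN : 0 < N) (h : N ≤ M) :
    Real.log M - Real.log N ≤ ∑ a ∈ Ico N M, 1 / (a : ℝ) := by
  induction M, h using Nat.le_induction with
  | base => simp
  | succ M hM ih =>
    rw [sum_Ico_succ_top hM]
    have hM0 : (0 : ℝ) < M := by exact_mod_cast hN.trans_le hM
    have h1 := Real.log_le_sub_one_of_pos (x := ((M + 1 : ℕ) : ℝ) / M) (by positivity)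
    rw [Real.log_div (by positivity) hM0.ne'] at h1
    have h2 : ((M + 1 : ℕ) : ℝ) / M - 1 = 1 / M := by
      push_cast
      field_simp
      ring
    linarith

/-- The dyadic block `[2 ^ k, 2 ^ (k + 1))`. -/
def block (k : ℕ) : Finset ℕ := Ico (2 ^ k) (2 ^ (k + 1))

lemma log_two_le_sum_block (k : ℕ) : Real.log 2 ≤ ∑ a ∈ block k, 1 / (a : ℝ) := by
  have h := log_sub_log_le_sum_Ico (N := 2 ^ k) (M := 2 ^ (k + 1)) (by positivity)
    (Nat.pow_le_pow_right (by norm_num) (Nat.le_succ k))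
  push_cast at h
  rw [← Real.log_div (by positivity) (by positivity), pow_succ,
    mul_div_cancel_left₀ _ (by positivity)] at h
  exact h

variable {E : Type*} [Fintype E] [DecidableEq E]

/-- The sums of the subfamilies of `x`. -/
def subsetSums (x : E → ℕ) : Finset ℕ := (univ : Finset (Finset E)).image fun A => ∑ e ∈ A, x e

/-- The weight of a family `x` of natural numbers. -/
def weight (x : E → ℕ) : ℝ := ∏ e, 1 / (x e : ℝ)

omit [DecidableEq E] in
lemma weight_nonneg (x : E → ℕ) : 0 ≤ weight x := prod_nonneg fun _ _ => by positivity

/-- The families with `x e` in the dyadic block of index `k e`. -/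
def blockFamilies (k : E → ℕ) : Finset (E → ℕ) := Fintype.piFinset fun e => block (k e)

lemma sum_weight_blockFamilies (k : E → ℕ) :
    ∑ x ∈ blockFamilies k, weight x = ∏ e, ∑ a ∈ block (k e), 1 / (a : ℝ) := by
  rw [prod_univ_sum]
  rfl

/-- The number of pairs of subfamilies of `x` with equal sums. -/
def collisions (x : E → ℕ) : ℕ :=
  #{P : Finset E × Finset E | ∑ e ∈ P.1, x e = ∑ e ∈ P.2, x e}

omit [DecidableEq E] in
lemma two_mul_sub_le_card_subsetSums (x : E → ℕ) (t : ℝ) :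
    2 * t * 2 ^ Fintype.card E - t ^ 2 * collisions x ≤ #(subsetSums x) := by
  set c : ℕ → ℕ := fun n => #{A : Finset E | ∑ e ∈ A, x e = n}
  have h1 : ∑ n ∈ subsetSums x, (c n : ℝ) = 2 ^ Fintype.card E := by
    have := card_eq_sum_card_image (fun A : Finset E => ∑ e ∈ A, x e) univ
    rw [card_univ, Fintype.card_finset] at this
    exact_mod_cast this.symm
  have h2 : (collisions x : ℝ) = ∑ n ∈ subsetSums x, (c n : ℝ) ^ 2 := by
    have h : collisions x = ∑ A : Finset E, c (∑ e ∈ A, x e) := by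
      unfold collisions
      rw [card_filter, ← univ_product_univ, sum_product]
      refine sum_congr rfl fun A _ => ?_
      rw [← card_filter]
      simp only [c, eq_comm]
    rw [h, sum_comp c (fun A : Finset E => ∑ e ∈ A, x e)]
    push_cast
    refine sum_congr rfl fun n _ => ?_
    simp only [c, smul_eq_mul, Nat.cast_mul, sq]
  have h3 : (#(subsetSums x) : ℝ) = ∑ n ∈ subsetSums x, 1 := by simp
  rw [h2, h3, ← h1, mul_sum, mul_sum, ← sum_sub_distrib]
  refine sum_le_sum fun n _ => ?_
  nlinarith [sq_nonneg (1 - t * (c n : ℝ))]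

omit [Fintype E] in
lemma eq_of_sum_eq_sum {A B : Finset E} {e : E} (heA : e ∈ A) (heB : e ∉ B) {x y : E → ℕ}
    (hxy : ∀ e', e' ≠ e → x e' = y e') (hx : ∑ i ∈ A, x i = ∑ i ∈ B, x i)
    (hy : ∑ i ∈ A, y i = ∑ i ∈ B, y i) : x e = y e := by
  have h1 : ∑ i ∈ B, x i = ∑ i ∈ B, y i :=
    sum_congr rfl fun i hi => hxy i fun h => heB (h ▸ hi)
  have h2 : ∑ i ∈ A.erase e, x i = ∑ i ∈ A.erase e, y i :=
    sum_congr rfl fun i hi => hxy i (ne_of_mem_erase hi)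
  rw [← add_sum_erase A x heA] at hx
  rw [← add_sum_erase A y heA] at hy
  omega

lemma sum_weight_collision_le (k : E → ℕ) {A B : Finset E} {e : E} (he : e ∈ symmDiff A B) :
    ∑ x ∈ blockFamilies k with ∑ i ∈ A, x i = ∑ i ∈ B, x i, weight x ≤
      2 * (1 / 2) ^ k e * ∑ x ∈ blockFamilies k, weight x := by
  set W' : ℝ := ∏ i : {i // i ≠ e}, ∑ a ∈ block (k i), 1 / (a : ℝ) with hW'
  have hW'0 : 0 ≤ W' := prod_nonneg fun _ _ => sum_nonneg fun _ _ => by positivity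
  have h1 : W' ≤ 2 * ∑ x ∈ blockFamilies k, weight x := by
    rw [sum_weight_blockFamilies, Fintype.prod_eq_mul_prod_subtype_ne _ e, ← hW']
    have := log_two_le_sum_block (k e)
    have h2 := Real.log_two_gt_d9
    nlinarith
  have h2 : ∑ x ∈ blockFamilies k with ∑ i ∈ A, x i = ∑ i ∈ B, x i, weight x ≤
      (1 / 2) ^ k e * W' := by
    have hterm : ∀ x ∈ (blockFamilies k).filter (fun x => ∑ i ∈ A, x i = ∑ i ∈ B, x i),
        weight x ≤ (1 / 2) ^ k e * weight (fun i : {i // i ≠ e} => x i) := by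
      intro x hx
      have hxe := Fintype.mem_piFinset.1 (mem_filter.1 hx).1 e
      rw [block, mem_Ico] at hxe
      have hxe' : (2 : ℝ) ^ k e ≤ x e := by exact_mod_cast hxe.1
      unfold weight
      rw [Fintype.prod_eq_mul_prod_subtype_ne _ e]
      refine mul_le_mul_of_nonneg_right ?_ (prod_nonneg fun _ _ => by positivity)
      rw [one_div_pow]
      exact one_div_le_one_div_of_le (by positivity) hxe'
    refine (sum_le_sum hterm).trans ?_
    rw [← mul_sum]
    gcongr
    rw [← sum_image (f := fun y : {i // i ≠ e} → ℕ => weight y)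
      (g := fun (x : E → ℕ) (i : {i // i ≠ e}) => x i), hW',
      ← sum_weight_blockFamilies (fun i : {i // i ≠ e} => k i)]
    · refine sum_le_sum_of_subset_of_nonneg ?_ fun y _ _ => weight_nonneg y
      intro y hy
      obtain ⟨x, hx, rfl⟩ := mem_image.1 hy
      have := Fintype.mem_piFinset.1 (mem_filter.1 hx).1
      exact Fintype.mem_piFinset.2 fun i => this i
    · intro x hx y hy hxy
      have hx := (mem_filter.1 hx).2
      have hy := (mem_filter.1 hy).2
      have hne : ∀ i, i ≠ e → x i = y i := fun i hi => congrFun hxy ⟨i, hi⟩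
      funext i
      by_cases hi : i = e
      · subst hi
        rcases mem_symmDiff.1 he with h | h
        · exact eq_of_sum_eq_sum h.1 h.2 hne hx hy
        · exact eq_of_sum_eq_sum h.1 h.2 hne hx.symm hy.symm
      · exact hne i hi
  calc _ ≤ (1 / 2) ^ k e * W' := h2
    _ ≤ (1 / 2) ^ k e * (2 * ∑ x ∈ blockFamilies k, weight x) := by gcongr
    _ = _ := by ring

lemma card_symmDiff_subset (T : Finset E) :
    #{P : Finset E × Finset E | symmDiff P.1 P.2 ⊆ T} = 2 ^ Fintype.card E * 2 ^ #T := by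
  rw [← card_powerset T, ← Fintype.card_finset, ← card_univ, ← card_product]
  refine card_nbij' (fun P => (P.1, symmDiff P.1 P.2)) (fun P => (P.1, symmDiff P.1 P.2))
    ?_ ?_ ?_ ?_
  · intro P hP
    rw [mem_coe, mem_filter_univ] at hP
    rw [mem_coe, mem_product, mem_powerset]
    exact ⟨mem_univ _, hP⟩
  · intro P hP
    rw [mem_coe, mem_product, mem_powerset] at hP
    rw [mem_coe, mem_filter_univ, symmDiff_symmDiff_cancel_left]
    exact hP.2
  · intro P _
    simp
  · intro P _
    simp

lemma sum_weight_mul_collisions_le {K : ℕ} {f : E → ℕ} (hf : f ∈ slotFns E K) :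
    ∑ x ∈ blockFamilies (fun e => K - f e), weight x * collisions x ≤
      2 ^ Fintype.card E * (1 + 2 * crowding K f) *
        ∑ x ∈ blockFamilies (fun e => K - f e), weight x := by
  set k : E → ℕ := fun e => K - f e with hk
  set W : ℝ := ∑ x ∈ blockFamilies k, weight x with hW
  have hW0 : 0 ≤ W := sum_nonneg fun x _ => weight_nonneg x
  have hf' : ∀ e, f e < K := by simpa [slotFns] using hf
  have hpair : ∀ P : Finset E × Finset E,
      ∑ x ∈ blockFamilies k with ∑ i ∈ P.1, x i = ∑ i ∈ P.2, x i, weight x ≤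
        (if P.1 = P.2 then W else 0) +
          ∑ v ∈ range K, if symmDiff P.1 P.2 ⊆ ({e | v ≤ f e} : Finset E) then
            2 * (1 / 2) ^ (K - v) * W else 0 := by
    intro P
    have hnn : ∀ v ∈ range K, 0 ≤ if symmDiff P.1 P.2 ⊆ ({e | v ≤ f e} : Finset E) then
        2 * (1 / 2) ^ (K - v) * W else 0 := fun v _ => by split_ifs <;> positivity
    by_cases hP : P.1 = P.2
    · rw [if_pos hP]
      have h1 : ∑ x ∈ blockFamilies k with ∑ i ∈ P.1, x i = ∑ i ∈ P.2, x i, weight x ≤ W :=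
        sum_le_sum_of_subset_of_nonneg (filter_subset _ _) fun x _ _ => weight_nonneg x
      linarith [sum_nonneg hnn]
    · rw [if_neg hP, zero_add]
      have hne : (symmDiff P.1 P.2).Nonempty := by
        rw [nonempty_iff_ne_empty]
        exact fun h => hP (symmDiff_eq_bot.1 h)
      obtain ⟨e, he, hmin⟩ := exists_min_image _ f hne
      refine (sum_weight_collision_le k he).trans ?_
      refine le_trans ?_ (single_le_sum hnn (mem_range.2 (hf' e)))
      have hsub : symmDiff P.1 P.2 ⊆ ({i | f e ≤ f i} : Finset E) :=
        fun i hi => (mem_filter_univ _).2 (hmin i hi)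
      rw [if_pos hsub]
  have hswap : ∑ x ∈ blockFamilies k, weight x * collisions x =
      ∑ P : Finset E × Finset E,
        ∑ x ∈ blockFamilies k with ∑ i ∈ P.1, x i = ∑ i ∈ P.2, x i, weight x := by
    simp only [sum_filter]
    rw [sum_comm]
    refine sum_congr rfl fun x _ => ?_
    rw [← sum_filter, sum_const, nsmul_eq_mul, mul_comm]
    rfl
  have hdiag : #{P : Finset E × Finset E | P.1 = P.2} = 2 ^ Fintype.card E := by
    have := card_symmDiff_subset (∅ : Finset E)
    rw [card_empty, pow_zero, mul_one] at this
    rw [← this]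
    congr 1
    ext P
    rw [mem_filter_univ, mem_filter_univ, subset_empty]
    exact symmDiff_eq_bot.symm
  rw [hswap]
  refine (sum_le_sum fun P _ => hpair P).trans ?_
  rw [sum_add_distrib, ← sum_filter, sum_const, hdiag, sum_comm]
  have hv : ∀ v ∈ range K, (∑ P : Finset E × Finset E,
      if symmDiff P.1 P.2 ⊆ ({e | v ≤ f e} : Finset E) then
        2 * (1 / 2) ^ (K - v) * W else 0) =
      2 ^ Fintype.card E * 2 * W * ((2 : ℝ) ^ tailCard f v / 2 ^ (K - v)) := by
    intro v _
    rw [← sum_filter, sum_const, card_symmDiff_subset, nsmul_eq_mul]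
    push_cast
    rw [one_div_pow]
    unfold tailCard
    ring
  rw [sum_congr rfl hv, ← mul_sum, nsmul_eq_mul]
  unfold crowding
  push_cast
  apply le_of_eq
  ring

lemma le_sum_weight_mul_card_subsetSums {K : ℕ} {f : E → ℕ} (hf : f ∈ slotFns E K) {C : ℝ}
    (hC : crowding K f ≤ C) :
    (2 * Real.log 2) ^ Fintype.card E / (1 + 2 * C) ≤
      ∑ x ∈ blockFamilies (fun e => K - f e), weight x * #(subsetSums x) := by
  have hcr : 0 ≤ crowding K f := by unfold crowding; positivity
  set W : ℝ := ∑ x ∈ blockFamilies (fun e => K - f e), weight x with hW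
  have hWlog : Real.log 2 ^ Fintype.card E ≤ W := by
    rw [hW, sum_weight_blockFamilies, ← card_univ, ← prod_const]
    exact prod_le_prod (fun _ _ => Real.log_nonneg one_le_two) fun e _ => log_two_le_sum_block _
  have h1 := sum_weight_mul_collisions_le hf
  set t : ℝ := 1 / (1 + 2 * C) with ht
  have hpos : 0 < 1 + 2 * C := by linarith
  have h2 : ∑ x ∈ blockFamilies (fun e => K - f e),
      weight x * (2 * t * 2 ^ Fintype.card E - t ^ 2 * collisions x) ≤
      ∑ x ∈ blockFamilies (fun e => K - f e), weight x * #(subsetSums x) :=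
    sum_le_sum fun x _ =>
      mul_le_mul_of_nonneg_left (two_mul_sub_le_card_subsetSums x t) (weight_nonneg x)
  have hW0 : 0 ≤ W := sum_nonneg fun x _ => weight_nonneg x
  have h3 : ∑ x ∈ blockFamilies (fun e => K - f e),
      weight x * (2 * t * 2 ^ Fintype.card E - t ^ 2 * collisions x) =
      2 * t * 2 ^ Fintype.card E * W -
        t ^ 2 * ∑ x ∈ blockFamilies (fun e => K - f e), weight x * collisions x := by
    rw [hW, mul_sum, mul_sum, ← sum_sub_distrib]
    exact sum_congr rfl fun x _ => by ring
  have h4 : t ^ 2 * ∑ x ∈ blockFamilies (fun e => K - f e), weight x * collisions x ≤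
      t * 2 ^ Fintype.card E * W := by
    calc _ ≤ t ^ 2 * (2 ^ Fintype.card E * (1 + 2 * C) * W) := by
          gcongr
          refine h1.trans ?_
          gcongr
      _ = _ := by rw [ht]; field_simp
  calc _ = t * 2 ^ Fintype.card E * Real.log 2 ^ Fintype.card E := by
        rw [mul_pow, ht]; ring
    _ ≤ t * 2 ^ Fintype.card E * W := by gcongr
    _ ≤ _ := by linarith

end SubsetSums

section CycleTypes

lemma exists_le_map_eq_of_le_map {β γ : Type*} {g : β → γ} {T : Multiset β} {M : Multiset γ}
    (h : M ≤ T.map g) : ∃ T' ≤ T, T'.map g = M := by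
  obtain ⟨N, hN⟩ := Multiset.le_iff_exists_add.1 h
  have hrel : Multiset.Rel (fun a b => a = g b) (M + N) T := by
    rw [← hN, Multiset.rel_map_left]
    exact Multiset.rel_refl_of_refl_on fun _ _ => rfl
  obtain ⟨T₁, T₂, h₁, -, rfl⟩ := Multiset.rel_add_left.1 hrel
  refine ⟨T₁, Multiset.le_add_right _ _, ?_⟩
  rw [← Multiset.rel_map_right, Multiset.rel_eq] at h₁
  exact h₁.symm

variable {ι : Type*} [Fintype ι] [DecidableEq ι]

/-- The multiset of values of a family. -/
def values (x : ι → ℕ) : Multiset ℕ := univ.val.map x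

omit [DecidableEq ι] in
lemma count_values (x : ι → ℕ) (a : ℕ) : (values x).count a = #{i | x i = a} := by
  rw [values, Multiset.count_map]
  simp only [eq_comm]
  rfl

omit [DecidableEq ι] in
lemma exists_comp_perm_of_values_eq {x y : ι → ℕ} (h : values y = values x) :
    ∃ σ : Equiv.Perm ι, y = x ∘ σ := by
  have hcard : ∀ a, Fintype.card {i // y i = a} = Fintype.card {i // x i = a} := by
    intro a
    rw [Fintype.card_subtype, Fintype.card_subtype, ← count_values, ← count_values, h]
  refine ⟨(Equiv.sigmaFiberEquiv y).symm.trans ((Equiv.sigmaCongrRight fun a =>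
    Fintype.equivOfCardEq (hcard a)).trans (Equiv.sigmaFiberEquiv x)), ?_⟩
  funext i
  exact ((Fintype.equivOfCardEq (hcard (y i))) ⟨i, rfl⟩).2.symm

/-- The product of the factorials of the multiplicities. -/
def countFactorials (M : Multiset ℕ) : ℕ := ∏ a ∈ M.toFinset, (M.count a).factorial

lemma card_perm_comp_eq (x : ι → ℕ) :
    #{σ : Equiv.Perm ι | x ∘ σ = x} = countFactorials (values x) := by
  rw [← Fintype.card_subtype, DomMulAct.stabilizer_card', countFactorials]
  refine prod_congr ?_ fun a _ => ?_
  · rfl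
  · rw [count_values, Fintype.card_subtype]

lemma card_mul_countFactorials_le {S : Multiset ℕ} {𝒴 : Finset (ι → ℕ)}
    (h : ∀ y ∈ 𝒴, values y = S) :
    #𝒴 * countFactorials S ≤ (Fintype.card ι).factorial := by
  rcases 𝒴.eq_empty_or_nonempty with rfl | ⟨x, hx⟩
  · simp
  have hfib : ∀ y ∈ 𝒴, #{σ : Equiv.Perm ι | x ∘ σ = y} = countFactorials S := by
    intro y hy
    obtain ⟨τ, rfl⟩ := exists_comp_perm_of_values_eq ((h y hy).trans (h x hx).symm)
    rw [← h x hx, ← card_perm_comp_eq]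
    refine card_bij' (fun σ _ => σ * τ⁻¹) (fun σ _ => σ * τ) ?_ ?_ ?_ ?_
    · intro σ hσ
      rw [mem_filter_univ] at hσ ⊢
      rw [Equiv.Perm.coe_mul, ← Function.comp_assoc, hσ, Function.comp_assoc, ← Equiv.Perm.coe_mul,
        mul_inv_cancel]
      rfl
    · intro σ hσ
      rw [mem_filter_univ] at hσ ⊢
      rw [Equiv.Perm.coe_mul, ← Function.comp_assoc, hσ]
    · simp
    · simp
  rw [← Fintype.card_perm, ← card_univ, ← smul_eq_mul, ← sum_const, ← sum_congr rfl hfib]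
  rw [← card_biUnion]
  · exact card_le_card (subset_univ _)
  · intro y _ z _ hyz
    refine disjoint_left.2 fun σ h1 h2 => hyz ?_
    rw [mem_filter_univ] at h1 h2
    exact h1.symm.trans h2

/-- A permutation preserves a set containing half of the points. -/
def HasInvariantHalf {α : Type*} [Fintype α] (π : Equiv.Perm α) : Prop :=
  ∃ s : Finset α, 2 * #s = Fintype.card α ∧ ∀ a, π a ∈ s ↔ a ∈ s

lemma hasInvariantHalf_of_le_cycleType {α : Type*} [Fintype α] [DecidableEq α]
    {π : Equiv.Perm α} {M : Multiset ℕ} (hM : M ≤ π.cycleType)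
    (hsum : 2 * M.sum = Fintype.card α) : HasInvariantHalf π := by
  rw [Equiv.Perm.cycleType_def] at hM
  obtain ⟨T, hT, rfl⟩ := exists_le_map_eq_of_le_map hM
  set T' : Finset (Equiv.Perm α) := ⟨T, Multiset.nodup_of_le hT π.cycleFactorsFinset.2⟩
  have hT' : T' ⊆ π.cycleFactorsFinset := fun c hc => Multiset.mem_of_le hT hc
  refine ⟨T'.biUnion Equiv.Perm.support, ?_, fun a => ?_⟩
  · rw [← hsum, card_biUnion]
    · rfl
    · intro c hc d hd hcd
      exact Equiv.Perm.disjoint_iff_disjoint_support.1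
        (π.cycleFactorsFinset_pairwise_disjoint (hT' hc) (hT' hd) hcd)
  · simp only [mem_biUnion]
    refine exists_congr fun c => and_congr_right fun hc => ?_
    have := Equiv.Perm.zpow_apply_mem_support_of_mem_cycleFactorsFinset_iff (g := π)
      (x := a) (m := 1) (c := ⟨c, hT' hc⟩)
    rwa [zpow_one] at this

/-- The values of `x` together with two large parts which balance a subfamily of sum `t` and its
complement. -/
def balancedType (m : ℕ) (x : ι → ℕ) (t : ℕ) : Multiset ℕ :=
  values x + {m - t, m - (∑ i, x i - t)}

omit [DecidableEq ι] in
lemma sum_values (x : ι → ℕ) : (values x).sum = ∑ i, x i := rfl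

omit [DecidableEq ι] in
lemma le_sum_of_mem_subsetSums {x : ι → ℕ} {t : ℕ} (ht : t ∈ subsetSums x) : t ≤ ∑ i, x i := by
  obtain ⟨A, -, rfl⟩ := mem_image.1 ht
  exact sum_le_sum_of_subset (subset_univ A)

omit [DecidableEq ι] in
lemma sum_balancedType {m : ℕ} {x : ι → ℕ} {t : ℕ} (ht : t ∈ subsetSums x)
    (hm : ∑ i, x i ≤ m) : (balancedType m x t).sum = 2 * m := by
  have := le_sum_of_mem_subsetSums ht
  rw [balancedType, Multiset.sum_add, sum_values, Multiset.insert_eq_cons, Multiset.sum_cons,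
    Multiset.sum_singleton]
  omega

omit [DecidableEq ι] in
lemma hasInvariantHalf_of_cycleType_eq {α : Type*} [Fintype α] [DecidableEq α] {m : ℕ}
    (hα : Fintype.card α = 2 * m) {x : ι → ℕ} {t : ℕ} (ht : t ∈ subsetSums x)
    (hm : ∑ i, x i ≤ m) {π : Equiv.Perm α} (hπ : π.cycleType = balancedType m x t) :
    HasInvariantHalf π := by
  have htm := (le_sum_of_mem_subsetSums ht).trans hm
  obtain ⟨A, -, rfl⟩ := mem_image.1 ht
  refine hasInvariantHalf_of_le_cycleType (M := A.val.map x + {m - ∑ i ∈ A, x i}) ?_ ?_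
  · rw [hπ, balancedType]
    refine add_le_add (Multiset.map_le_map (val_le_iff.2 (subset_univ A))) ?_
    rw [Multiset.insert_eq_cons, Multiset.singleton_le]
    exact Multiset.mem_cons_self _ _
  · rw [Multiset.sum_add, Multiset.sum_singleton, hα]
    congr 1
    exact Nat.add_sub_cancel' htm

lemma countFactorials_add {S T : Multiset ℕ} (h : Disjoint S T) :
    countFactorials (S + T) = countFactorials S * countFactorials T := by
  unfold countFactorials
  rw [Multiset.toFinset_add, prod_union (Multiset.disjoint_toFinset.2 h)]
  congr 1
  · refine prod_congr rfl fun a ha => ?_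
    rw [Multiset.count_add, Multiset.count_eq_zero_of_notMem
      (Multiset.disjoint_left.1 h (Multiset.mem_toFinset.1 ha)), add_zero]
  · refine prod_congr rfl fun a ha => ?_
    rw [Multiset.count_add, Multiset.count_eq_zero_of_notMem
      (Multiset.disjoint_right.1 h (Multiset.mem_toFinset.1 ha)), zero_add]

lemma countFactorials_pair_le (a b : ℕ) : countFactorials {a, b} ≤ 2 := by
  unfold countFactorials
  by_cases h : a = b
  · subst h
    simp [Multiset.insert_eq_cons]
  · simp [Multiset.insert_eq_cons, h, Ne.symm h, prod_pair h]

/-- The values of `x` are at least two and less than `m / 2`, and add up to at most `m / 2`. -/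
structure IsSmallFamily (m : ℕ) (x : ι → ℕ) : Prop where
  two_le : ∀ i, 2 ≤ x i
  two_mul_lt : ∀ i, 2 * x i < m
  two_mul_sum_le : 2 * ∑ i, x i ≤ m

omit [DecidableEq ι] in
lemma mem_values {x : ι → ℕ} {a : ℕ} : a ∈ values x ↔ ∃ i, x i = a := by
  simp [values]

omit [DecidableEq ι] in
lemma factorial_le_card_cycleType_eq {α : Type*} [Fintype α] [DecidableEq α] {m : ℕ}
    (hm4 : 4 ≤ m) (hα : Fintype.card α = 2 * m) {x : ι → ℕ} (hx : IsSmallFamily m x) {t : ℕ}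
    (ht : t ∈ subsetSums x) :
    ((2 * m).factorial : ℝ) * weight x ≤
      2 * (m : ℝ) ^ 2 * (countFactorials (values x) *
        #{π : Equiv.Perm α | π.cycleType = balancedType m x t}) := by
  have htm := le_sum_of_mem_subsetSums ht
  have hs := hx.two_mul_sum_le
  have hsum := sum_balancedType ht (by omega : ∑ i, x i ≤ m)
  have key := Equiv.Perm.card_of_cycleType_mul_eq (α := α) (balancedType m x t)
  rw [if_pos, hα, hsum, Nat.sub_self, Nat.factorial_zero, one_mul] at key
  swap
  · refine ⟨by rw [hsum, hα], fun a ha => ?_⟩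
    rcases Multiset.mem_add.1 ha with h | h
    · obtain ⟨i, rfl⟩ := mem_values.1 h
      exact hx.two_le i
    · rw [Multiset.insert_eq_cons, Multiset.mem_cons, Multiset.mem_singleton] at h
      omega
  have hdisj : Disjoint (values x) ({m - t, m - (∑ i, x i - t)} : Multiset ℕ) := by
    refine Multiset.disjoint_left.2 fun {a} ha h => ?_
    obtain ⟨i, rfl⟩ := mem_values.1 ha
    have := hx.two_mul_lt i
    rw [Multiset.insert_eq_cons, Multiset.mem_cons, Multiset.mem_singleton] at h
    omega
  have hcf : countFactorials (balancedType m x t) ≤ countFactorials (values x) * 2 := by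
    rw [balancedType, countFactorials_add hdisj]
    exact Nat.mul_le_mul_left _ (countFactorials_pair_le _ _)
  have hprod : (balancedType m x t).prod ≤ (∏ i, x i) * m ^ 2 := by
    rw [balancedType, Multiset.prod_add, Multiset.insert_eq_cons, Multiset.prod_cons,
      Multiset.prod_singleton, sq]
    exact Nat.mul_le_mul_left _ (Nat.mul_le_mul (Nat.sub_le _ _) (Nat.sub_le _ _))
  set N := #{π : Equiv.Perm α | π.cycleType = balancedType m x t}
  have hle : (2 * m).factorial ≤ N * ((∏ i, x i) * m ^ 2 * (countFactorials (values x) * 2)) := by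
    rw [← key]
    exact Nat.mul_le_mul_left _ (Nat.mul_le_mul hprod hcf)
  have hle' : ((2 * m).factorial : ℝ) ≤
      N * ((∏ i, (x i : ℝ)) * m ^ 2 * (countFactorials (values x) * 2)) := by
    exact_mod_cast hle
  have hpos : 0 < ∏ i, (x i : ℝ) := prod_pos fun i _ => by
    have := hx.two_le i
    positivity
  have hw : weight x = 1 / ∏ i, (x i : ℝ) := by
    rw [weight, prod_div_distrib, prod_const_one]
  rw [hw, mul_one_div, div_le_iff₀ hpos]
  linarith

omit [DecidableEq ι] in
lemma values_eq_of_balancedType_eq {m : ℕ} {x y : ι → ℕ} (hx : IsSmallFamily m x)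
    (hy : IsSmallFamily m y) {t u : ℕ} (ht : t ∈ subsetSums x) (hu : u ∈ subsetSums y)
    (h : balancedType m x t = balancedType m y u) :
    values x = values y ∧ (t = u ∨ t = ∑ i, y i - u) := by
  have hfilter : ∀ {z : ι → ℕ} {v : ℕ}, IsSmallFamily m z → v ∈ subsetSums z →
      (balancedType m z v).filter (fun a => 2 * a < m) = values z := by
    intro z v hz hv
    have hvm := le_sum_of_mem_subsetSums hv
    have hs := hz.two_mul_sum_le
    rw [balancedType, Multiset.filter_add, Multiset.filter_eq_self.2, Multiset.filter_eq_nil.2,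
      add_zero]
    · intro a ha
      rw [Multiset.insert_eq_cons, Multiset.mem_cons, Multiset.mem_singleton] at ha
      omega
    · intro a ha
      obtain ⟨i, rfl⟩ := mem_values.1 ha
      exact hz.two_mul_lt i
  have hv : values x = values y := by rw [← hfilter hx ht, h, hfilter hy hu]
  refine ⟨hv, ?_⟩
  have hsum : ∑ i, x i = ∑ i, y i := by rw [← sum_values, hv, sum_values]
  rw [balancedType, balancedType, hv] at h
  have hmem : m - t ∈ ({m - u, m - (∑ i, y i - u)} : Multiset ℕ) := by
    rw [← add_left_cancel h, Multiset.insert_eq_cons]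
    exact Multiset.mem_cons_self _ _
  rw [Multiset.insert_eq_cons, Multiset.mem_cons, Multiset.mem_singleton] at hmem
  have h1 := le_sum_of_mem_subsetSums ht
  have h2 := le_sum_of_mem_subsetSums hu
  have h3 := hy.two_mul_sum_le
  omega

lemma sum_weight_mul_card_le_card_hasInvariantHalf {α : Type*} [Fintype α] [DecidableEq α] {m : ℕ}
    (hm4 : 4 ≤ m) (hα : Fintype.card α = 2 * m) {𝒳 : Finset (ι → ℕ)}
    (h𝒳 : ∀ x ∈ 𝒳, IsSmallFamily m x) :
    ((2 * m).factorial : ℝ) * ∑ x ∈ 𝒳, weight x * #(subsetSums x) ≤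
      4 * (m : ℝ) ^ 2 * (Fintype.card ι).factorial *
        Nat.card {π : Equiv.Perm α // HasInvariantHalf π} := by
  classical
  set 𝒟 : Finset (Σ _ : ι → ℕ, ℕ) := 𝒳.sigma subsetSums with h𝒟
  have hmem : ∀ p ∈ 𝒟, IsSmallFamily m p.1 ∧ p.2 ∈ subsetSums p.1 := fun p hp =>
    ⟨h𝒳 _ (mem_sigma.1 hp).1, (mem_sigma.1 hp).2⟩
  have hfib : ∀ π : Equiv.Perm α,
      ∑ p ∈ 𝒟 with π.cycleType = balancedType m p.1 p.2, countFactorials (values p.1) ≤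
        if HasInvariantHalf π then 2 * (Fintype.card ι).factorial else 0 := by
    intro π
    set 𝒬 := 𝒟.filter (fun p => π.cycleType = balancedType m p.1 p.2) with h𝒬
    rcases 𝒬.eq_empty_or_nonempty with h | ⟨q, hq⟩
    · rw [h, sum_empty]
      exact Nat.zero_le _
    obtain ⟨hq1, hq2⟩ := mem_filter.1 hq
    obtain ⟨hqs, hqt⟩ := hmem q hq1
    rw [if_pos (hasInvariantHalf_of_cycleType_eq hα hqt
      (by have := hqs.two_mul_sum_le; omega) hq2)]
    have hQ : ∀ p ∈ 𝒬, values p.1 = values q.1 ∧ (p.2 = q.2 ∨ p.2 = ∑ i, q.1 i - q.2) := by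
      intro p hp
      obtain ⟨hp1, hp2⟩ := mem_filter.1 hp
      exact values_eq_of_balancedType_eq (hmem p hp1).1 hqs (hmem p hp1).2 hqt (hp2.symm.trans hq2)
    have hcard : #𝒬 ≤ #(𝒬.image Sigma.fst) * 2 := by
      rw [mul_comm]
      refine card_le_mul_card_image (f := Sigma.fst) 𝒬 2 fun x _ => ?_
      calc _ ≤ #(({q.2, ∑ i, q.1 i - q.2} : Finset ℕ)) := by
            refine card_le_card_of_injOn (fun p => p.2) ?_ ?_
            · intro p hp
              have := (hQ p (mem_filter.1 hp).1).2
              simpa using this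
            · rintro ⟨a, b⟩ h1 ⟨c, d⟩ h2 h
              have h1 : a = x := (mem_filter.1 h1).2
              have h2 : c = x := (mem_filter.1 h2).2
              have h : b = d := h
              subst h1 h2 h
              rfl
        _ ≤ 2 := card_le_two
    calc _ = #𝒬 * countFactorials (values q.1) := by
          rw [sum_congr rfl fun p hp => by rw [(hQ p hp).1], sum_const, smul_eq_mul]
      _ ≤ #(𝒬.image Sigma.fst) * 2 * countFactorials (values q.1) := Nat.mul_le_mul_right _ hcard
      _ = 2 * (#(𝒬.image Sigma.fst) * countFactorials (values q.1)) := by ring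
      _ ≤ _ := by
        refine Nat.mul_le_mul_left _ (card_mul_countFactorials_le fun y hy => ?_)
        obtain ⟨p, hp, rfl⟩ := mem_image.1 hy
        exact (hQ p hp).1
  have hcount : ∑ p ∈ 𝒟, countFactorials (values p.1) *
      #{π : Equiv.Perm α | π.cycleType = balancedType m p.1 p.2} ≤
      2 * (Fintype.card ι).factorial * #{π : Equiv.Perm α | HasInvariantHalf π} := by
    calc _ = ∑ π : Equiv.Perm α,
          ∑ p ∈ 𝒟 with π.cycleType = balancedType m p.1 p.2, countFactorials (values p.1) := by
          simp only [sum_filter]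
          rw [sum_comm]
          refine sum_congr rfl fun p _ => ?_
          rw [← sum_filter, sum_const, smul_eq_mul, mul_comm]
      _ ≤ ∑ π : Equiv.Perm α, if HasInvariantHalf π then 2 * (Fintype.card ι).factorial else 0 :=
          sum_le_sum fun π _ => hfib π
      _ = _ := by rw [← sum_filter, sum_const, smul_eq_mul, mul_comm]
  have hcount' : ∑ p ∈ 𝒟, (countFactorials (values p.1) : ℝ) *
      #{π : Equiv.Perm α | π.cycleType = balancedType m p.1 p.2} ≤
      2 * (Fintype.card ι).factorial * #{π : Equiv.Perm α | HasInvariantHalf π} := by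
    exact_mod_cast hcount
  have hsum : ((2 * m).factorial : ℝ) * ∑ x ∈ 𝒳, weight x * #(subsetSums x) =
      ∑ p ∈ 𝒟, ((2 * m).factorial : ℝ) * weight p.1 := by
    rw [h𝒟, sum_sigma, mul_sum]
    refine sum_congr rfl fun x _ => ?_
    dsimp only
    rw [sum_const, nsmul_eq_mul]
    ring
  rw [hsum, Nat.card_eq_fintype_card, Fintype.card_subtype]
  calc _ ≤ ∑ p ∈ 𝒟, 2 * (m : ℝ) ^ 2 * (countFactorials (values p.1) *
        #{π : Equiv.Perm α | π.cycleType = balancedType m p.1 p.2}) :=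
        sum_le_sum fun p hp =>
          factorial_le_card_cycleType_eq hm4 hα (hmem p hp).1 (hmem p hp).2
    _ ≤ 2 * (m : ℝ) ^ 2 *
        (2 * (Fintype.card ι).factorial * #{π : Equiv.Perm α | HasInvariantHalf π}) := by
        rw [← mul_sum]
        gcongr
    _ = _ := by ring

end CycleTypes

section HalfStabilizer

variable {α : Type*} [DecidableEq α]

/-- The permutations preserving the partition into `s` and its complement. -/
def halfStabilizer (s : Finset α) : Subgroup (Equiv.Perm α) where
  carrier := {g | (∀ a, g a ∈ s ↔ a ∈ s) ∨ ∀ a, g a ∈ s ↔ a ∉ s}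
  mul_mem' := by
    rintro g h (hg | hg) (hh | hh)
    · exact Or.inl fun a => by rw [Equiv.Perm.mul_apply, hg, hh]
    · exact Or.inr fun a => by rw [Equiv.Perm.mul_apply, hg, hh]
    · exact Or.inr fun a => by rw [Equiv.Perm.mul_apply, hg, hh]
    · exact Or.inl fun a => by rw [Equiv.Perm.mul_apply, hg, hh, not_not]
  one_mem' := Or.inl fun _ => Iff.rfl
  inv_mem' := by
    rintro g (hg | hg)
    · refine Or.inl fun a => ?_
      rw [← hg, show g (g⁻¹ a) = a from g.apply_symm_apply a]
    · refine Or.inr fun a => ?_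
      rw [← not_iff_not, ← hg, show g (g⁻¹ a) = a from g.apply_symm_apply a, not_not]

omit [DecidableEq α] in
lemma mem_halfStabilizer {s : Finset α} {g : Equiv.Perm α} :
    g ∈ halfStabilizer s ↔ (∀ a, g a ∈ s ↔ a ∈ s) ∨ ∀ a, g a ∈ s ↔ a ∉ s := Iff.rfl

lemma swap_mem_halfStabilizer {s : Finset α} {a b : α} (h : a ∈ s ↔ b ∈ s) :
    Equiv.swap a b ∈ halfStabilizer s := by
  refine Or.inl fun c => ?_
  rw [Equiv.swap_apply_def]
  split_ifs with h1 h2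
  · rw [h1, h]
  · rw [h2, h]
  · rfl

lemma exists_mem_halfStabilizer_apply_eq [Fintype α] {s : Finset α}
    (hs : 2 * #s = Fintype.card α) (a b : α) : ∃ g ∈ halfStabilizer s, g a = b := by
  by_cases hab : a ∈ s ↔ b ∈ s
  · exact ⟨_, swap_mem_halfStabilizer hab, Equiv.swap_apply_left a b⟩
  have hcard : Fintype.card {a // a ∈ s} = Fintype.card {a // a ∉ s} := by
    rw [Fintype.card_subtype_compl, Fintype.card_coe]
    omega
  set e := Fintype.equivOfCardEq hcard
  have hg : ∀ a, e.extendSubtype a ∈ s ↔ a ∉ s := by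
    intro a
    by_cases ha : a ∈ s
    · exact iff_of_false (e.extendSubtype_mem a ha) (not_not.2 ha)
    · exact iff_of_true (not_not.1 (e.extendSubtype_not_mem a ha)) ha
  refine ⟨Equiv.swap (e.extendSubtype a) b * e.extendSubtype,
    mul_mem (swap_mem_halfStabilizer ?_) (Or.inr hg), ?_⟩
  · rw [hg]
    tauto
  · exact Equiv.swap_apply_left _ _

lemma not_alternatingGroup_le_halfStabilizer [Fintype α] {s : Finset α} {a b c : α} (ha : a ∈ s)
    (hb : b ∈ s) (hab : a ≠ b) (hc : c ∉ s) : ¬ alternatingGroup α ≤ halfStabilizer s := by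
  intro h
  have hac : a ≠ c := fun h => hc (h ▸ ha)
  have hbc : b ≠ c := fun h => hc (h ▸ hb)
  have hmem := h (Equiv.Perm.isThreeCycle_swap_mul_swap_same hab hac hbc).mem_alternatingGroup
  rcases mem_halfStabilizer.1 hmem with h | h
  · have := h a
    rw [Equiv.Perm.mul_apply, Equiv.swap_apply_left,
      Equiv.swap_apply_of_ne_of_ne hac.symm hbc.symm] at this
    exact hc (this.2 ha)
  · have := h b
    rw [Equiv.Perm.mul_apply, Equiv.swap_apply_of_ne_of_ne hab.symm hbc,
      Equiv.swap_apply_right] at this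
    exact this.1 ha hb

lemma exists_transitive_of_hasInvariantHalf {n : ℕ} (hn : 2 < n) {π : Equiv.Perm (Fin n)}
    (hπ : HasInvariantHalf π) :
    ∃ G : Subgroup (Equiv.Perm (Fin n)), π ∈ G ∧ IsTransitiveSubgroup G ∧
      ¬ (alternatingGroup (Fin n) ≤ G) := by
  obtain ⟨s, hs, hinv⟩ := hπ
  have hs' := hs
  rw [Fintype.card_fin] at hs'
  refine ⟨halfStabilizer s, Or.inl hinv, exists_mem_halfStabilizer_apply_eq hs, ?_⟩
  obtain ⟨a, ha, b, hb, hab⟩ := one_lt_card.1 (by omega : 1 < #s)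
  obtain ⟨c, hc⟩ : ∃ c, c ∉ s := by
    by_contra! h
    have := card_univ (α := Fin n)
    rw [← eq_univ_iff_forall.2 h, Fintype.card_fin] at this
    omega
  exact not_alternatingGroup_le_halfStabilizer ha hb hab hc

lemma card_hasInvariantHalf_div_le_transProp {n : ℕ} (hn : 2 < n) :
    (Nat.card {π : Equiv.Perm (Fin n) // HasInvariantHalf π} : ℝ) / n.factorial ≤ transProp n := by
  have hcard : Nat.card (Equiv.Perm (Fin n)) = n.factorial := by
    rw [Nat.card_eq_fintype_card, Fintype.card_perm, Fintype.card_fin]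
  rw [transProp, hcard]
  gcongr
  exact Nat.card_le_card_of_injective
    (fun π : {π : Equiv.Perm (Fin n) // HasInvariantHalf π} =>
      (⟨π.1, exists_transitive_of_hasInvariantHalf hn π.2⟩ : {π : Equiv.Perm (Fin n) //
        ∃ G : Subgroup (Equiv.Perm (Fin n)), π ∈ G ∧ IsTransitiveSubgroup G ∧
          ¬ (alternatingGroup (Fin n) ≤ G)}))
    fun π σ h => Subtype.ext (congrArg (fun τ => τ.1) h)

lemma transProp_pos {n : ℕ} (hn : 2 < n) (hn2 : Even n) : 0 < transProp n := by
  refine lt_of_lt_of_le ?_ (card_hasInvariantHalf_div_le_transProp hn)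
  obtain ⟨m, rfl⟩ := hn2
  obtain ⟨s, hs⟩ := exists_subset_card_eq (s := (univ : Finset (Fin (m + m)))) (n := m) (by simp)
  have : Nonempty {π : Equiv.Perm (Fin (m + m)) // HasInvariantHalf π} :=
    ⟨⟨1, s, by rw [hs.2, Fintype.card_fin, two_mul], fun _ => Iff.rfl⟩⟩
  have h := Nat.card_pos (α := {π : Equiv.Perm (Fin (m + m)) // HasInvariantHalf π})
  positivity

end HalfStabilizer

section Assembly

lemma log_eq_of_mem_block {k a : ℕ} (h : a ∈ block k) : Nat.log 2 a = k := by
  rw [block, mem_Ico] at h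
  exact Nat.log_eq_of_pow_le_of_lt_pow h.1 h.2

lemma isSmallFamily_of_mem_blockFamilies {E : Type*} [Fintype E] [DecidableEq E] {K m D : ℕ}
    {f x : E → ℕ} (hf : f ∈ slotFns E K) (hx : x ∈ blockFamilies fun e => K - f e)
    (hD : 4 * mass f ≤ D) (hD4 : 4 ≤ D) (hm : D * 2 ^ K ≤ m) : IsSmallFamily m x := by
  have hfK : ∀ e, f e < K := fun e => mem_range.1 (Fintype.mem_piFinset.1 hf e)
  have hxe : ∀ e, 2 ^ (K - f e) ≤ x e ∧ x e < 2 ^ (K - f e + 1) := fun e =>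
    mem_Ico.1 (Fintype.mem_piFinset.1 hx e)
  refine ⟨fun e => ?_, fun e => ?_, ?_⟩
  · have h1 : 2 ^ 1 ≤ 2 ^ (K - f e) :=
      Nat.pow_le_pow_right (by norm_num) (by have := hfK e; omega)
    have := (hxe e).1
    omega
  · have h1 : 2 ^ (K - f e + 1) ≤ 2 ^ (K + 1) :=
      Nat.pow_le_pow_right (by norm_num) (by omega)
    have h2 := (hxe e).2
    have h3 : 4 * 2 ^ K ≤ m := (Nat.mul_le_mul_right _ hD4).trans hm
    rw [pow_succ 2 K] at h1
    omega
  · have h1 : ∀ e, (x e : ℝ) ≤ 2 ^ (K + 1) * (1 / 2) ^ f e := by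
      intro e
      have h2 : (x e : ℝ) ≤ 2 ^ (K - f e + 1) := by exact_mod_cast (hxe e).2.le
      have h3 : (2 : ℝ) ^ (K + 1) = 2 ^ (K - f e + 1) * 2 ^ f e := by
        rw [← pow_add]
        congr 1
        have := hfK e
        omega
      rwa [h3, mul_assoc, ← mul_pow, mul_one_div_cancel two_ne_zero, one_pow, mul_one]
    have h2 : ∑ e, (x e : ℝ) ≤ 2 ^ (K + 1) * mass f := by
      rw [mass, mul_sum]
      exact sum_le_sum fun e _ => h1 e
    have h3 : 2 * ∑ e, (x e : ℝ) ≤ D * 2 ^ K := by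
      calc _ ≤ 2 * (2 ^ (K + 1) * mass f) := by gcongr
        _ = 4 * mass f * 2 ^ K := by ring
        _ ≤ _ := by gcongr
    refine le_trans ?_ hm
    exact_mod_cast h3

lemma sum_weight_biUnion_ge {E : Type*} [Fintype E] [DecidableEq E] {K : ℕ} {C : ℝ}
    {F : Finset (E → ℕ)} (hF : F ⊆ slotFns E K) (hC : ∀ f ∈ F, crowding K f ≤ C) :
    #F * ((2 * Real.log 2) ^ Fintype.card E / (1 + 2 * C)) ≤
      ∑ x ∈ F.biUnion fun f => blockFamilies fun e => K - f e, weight x * #(subsetSums x) := by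
  rw [sum_biUnion, ← nsmul_eq_mul, ← sum_const]
  · exact sum_le_sum fun f hf => le_sum_weight_mul_card_subsetSums (hF hf) (hC f hf)
  · intro f hf g hg hfg
    refine disjoint_left.2 fun x hxf hxg => hfg (funext fun e => ?_)
    have h1 : Nat.log 2 (x e) = K - f e := log_eq_of_mem_block (Fintype.mem_piFinset.1 hxf e)
    have h2 : Nat.log 2 (x e) = K - g e := log_eq_of_mem_block (Fintype.mem_piFinset.1 hxg e)
    have h3 := mem_range.1 (Fintype.mem_piFinset.1 (hF hf) e)
    have h4 := mem_range.1 (Fintype.mem_piFinset.1 (hF hg) e)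
    omega

lemma exists_le_transProp_two_mul : ∃ c : ℝ, 0 < c ∧ ∃ D : ℕ, 4 ≤ D ∧ ∀ K m : ℕ, 0 < K →
    D * 2 ^ K ≤ m →
      c * ((2 * Real.exp 1 * Real.log 2) ^ K / ((m : ℝ) ^ 2 * (K * √K))) ≤ transProp (2 * m) := by
  obtain ⟨C, hC, H⟩ := exists_slot_assignments
  obtain ⟨D, hD⟩ := exists_nat_ge (max 4 (4 * C))
  have hD4 : 4 ≤ D := by exact_mod_cast (le_max_left _ _).trans hD
  have hlog := Real.log_pos one_lt_two
  refine ⟨2 * Real.log 2 / (16 * Real.exp 1 * (1 + 2 * C)), by positivity, D, hD4,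
    fun K m hK hm => ?_⟩
  obtain ⟨F, hF, hcard, hFC⟩ := H K hK
  have hm4 : 4 ≤ m := hD4.trans ((Nat.le_mul_of_pos_right D (by positivity)).trans hm)
  have h1 := sum_weight_biUnion_ge hF fun f hf => (hFC f hf).1
  have h2 := sum_weight_mul_card_le_card_hasInvariantHalf hm4 (Fintype.card_fin (2 * m))
    (𝒳 := F.biUnion fun f => blockFamilies fun e => K - f e) (by
      intro x hx
      obtain ⟨f, hf, hx⟩ := mem_biUnion.1 hx
      refine isSmallFamily_of_mem_blockFamilies (hF hf) hx ?_ hD4 hm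
      have := (hFC f hf).2
      have := (le_max_right _ _).trans hD
      linarith)
  have h3 := card_hasInvariantHalf_div_le_transProp (n := 2 * m) (by omega)
  rw [Fintype.card_fin] at h1 h2
  set N : ℝ := (Nat.card {π : Equiv.Perm (Fin (2 * m)) // HasInvariantHalf π} : ℝ)
  set S : ℝ := ∑ x ∈ F.biUnion fun f => blockFamilies fun e => K - f e, weight x * #(subsetSums x)
  have hmpos : (0 : ℝ) < m := by exact_mod_cast (by omega : 0 < m)
  have hKpos : (0 : ℝ) < K := by exact_mod_cast hK
  have hK1 : (1 : ℝ) ≤ K := by exact_mod_cast hK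
  have h4 : S / (4 * (m : ℝ) ^ 2 * (K + 1).factorial) ≤ N / (2 * m).factorial := by
    rw [div_le_div_iff₀ (by positivity) (by positivity)]
    linarith
  have h5 : (K : ℝ) ^ K / 2 * ((2 * Real.log 2) ^ (K + 1) / (1 + 2 * C)) ≤ S := by
    refine le_trans ?_ h1
    gcongr
    linarith
  have h6 : Real.exp 1 ^ K / (2 * Real.exp 1 * (K * √K)) ≤ (K : ℝ) ^ K / (K + 1).factorial := by
    have h := exp_mul_factorial_le hK
    rw [div_le_div_iff₀ (by positivity) (by positivity), Nat.factorial_succ]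
    have he : Real.exp K = Real.exp 1 ^ K := by rw [← Real.exp_nat_mul, mul_one]
    rw [he] at h
    push_cast
    calc _ = (K + 1) * (Real.exp 1 ^ K * (K.factorial : ℝ)) := by ring
      _ ≤ (2 * K) * (Real.exp 1 * √K * (K : ℝ) ^ K) := by
        gcongr
        linarith
      _ = _ := by ring
  calc _ = Real.exp 1 ^ K / (2 * Real.exp 1 * (K * √K)) *
        ((2 * Real.log 2) ^ (K + 1) / (8 * (1 + 2 * C) * (m : ℝ) ^ 2)) := by
        rw [pow_succ (2 * Real.log 2), mul_right_comm 2 (Real.exp 1), mul_pow (2 * Real.log 2)]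
        have : (0 : ℝ) < √K := Real.sqrt_pos.2 hKpos
        field_simp
        norm_num
    _ ≤ (K : ℝ) ^ K / (K + 1).factorial *
        ((2 * Real.log 2) ^ (K + 1) / (8 * (1 + 2 * C) * (m : ℝ) ^ 2)) := by gcongr
    _ = (K : ℝ) ^ K / 2 * ((2 * Real.log 2) ^ (K + 1) / (1 + 2 * C)) /
        (4 * (m : ℝ) ^ 2 * (K + 1).factorial) := by
        field_simp
        norm_num
    _ ≤ S / (4 * (m : ℝ) ^ 2 * (K + 1).factorial) := by gcongr
    _ ≤ _ := h4.trans h3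

lemma two_sub_delta_nonneg : 0 ≤ 2 - delta := by
  have h1 := Real.log_two_gt_d9
  have h0 : 0 < Real.log 2 := by linarith
  have h2 := Real.one_sub_inv_le_log_of_pos h0
  have h3 : (Real.log 2)⁻¹ ≤ 2 := by
    rw [inv_le_comm₀ h0 two_pos]
    linarith
  have h4 : 0 ≤ (1 + Real.log (Real.log 2)) / Real.log 2 := div_nonneg (by linarith) h0.le
  unfold delta
  linarith

lemma two_rpow_two_sub_delta : (2 : ℝ) ^ (2 - delta) = 2 * Real.exp 1 * Real.log 2 := by
  have h0 : 0 < Real.log 2 := Real.log_pos one_lt_two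
  have h : Real.log 2 * (2 - delta) = Real.log 2 + 1 + Real.log (Real.log 2) := by
    unfold delta
    field_simp
    ring
  rw [Real.rpow_def_of_pos two_pos, h, Real.exp_add, Real.exp_add, Real.exp_log two_pos,
    Real.exp_log h0]

lemma exists_le_transProp_of_large : ∃ c : ℝ, 0 < c ∧ ∃ N : ℕ, ∀ n : ℕ, Even n → N ≤ n →
    c * ((n : ℝ) ^ (-delta) * Real.log n ^ (-(3 / 2 : ℝ))) ≤ transProp n := by
  obtain ⟨c, hc, D, hD4, H⟩ := exists_le_transProp_two_mul
  have hlog := Real.log_pos one_lt_two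
  have hD0 : 0 < D := by omega
  have hDpos : (0 : ℝ) < D := by exact_mod_cast hD0
  refine ⟨c * (Real.log 2 ^ (3 / 2 : ℝ) / (4 * D : ℝ) ^ (2 - delta)), by positivity, 4 * D,
    fun n hn hnD => ?_⟩
  obtain ⟨m, rfl⟩ := hn.two_dvd
  have hmD : 2 ≤ m / D := (Nat.le_div_iff_mul_le hD0).2 (by omega)
  set K := Nat.log 2 (m / D)
  have hK : 0 < K := Nat.log_pos one_lt_two hmD
  have hK1 : 2 ^ K ≤ m / D := Nat.pow_log_le_self 2 (by omega)
  have hK2 : m / D < 2 ^ (K + 1) := Nat.lt_pow_succ_log_self one_lt_two _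
  have hle : D * 2 ^ K ≤ m := by
    rw [mul_comm]
    exact (Nat.le_div_iff_mul_le hD0).1 hK1
  have hlt : m < 2 ^ (K + 1) * D := (Nat.div_lt_iff_lt_mul hD0).1 hK2
  refine le_trans ?_ (H K m hK hle)
  have hm0 : 0 < m := by omega
  have hmpos : (0 : ℝ) < m := by exact_mod_cast hm0
  have hKpos : (0 : ℝ) < K := by exact_mod_cast hK
  have hnpos : (0 : ℝ) < ((2 * m : ℕ) : ℝ) := by exact_mod_cast (by omega : 0 < 2 * m)
  set n : ℝ := ((2 * m : ℕ) : ℝ) with hn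
  have hKn : (2 : ℝ) ^ K ≤ n := by
    have : 2 ^ K ≤ 2 * m := hK1.trans ((Nat.div_le_self _ _).trans (by omega))
    rw [hn]
    exact_mod_cast this
  have hnK : n / (4 * D) ≤ (2 : ℝ) ^ K := by
    rw [div_le_iff₀ (by positivity)]
    have : (m : ℝ) < 2 ^ (K + 1) * D := by exact_mod_cast hlt
    rw [hn]
    push_cast
    rw [pow_succ] at this
    linarith
  have hpow : n ^ (2 - delta) / (4 * D : ℝ) ^ (2 - delta) ≤
      (2 * Real.exp 1 * Real.log 2) ^ K := by
    rw [← two_rpow_two_sub_delta, ← Real.div_rpow hnpos.le (by positivity),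
      Real.rpow_pow_comm two_pos.le]
    exact Real.rpow_le_rpow (by positivity) hnK two_sub_delta_nonneg
  have hsplit : n ^ (2 - delta) = n ^ 2 * n ^ (-delta) := by
    rw [sub_eq_add_neg, Real.rpow_add hnpos, Real.rpow_two]
  have hKlog : K * Real.log 2 ≤ Real.log n := by
    rw [← Real.log_pow]
    exact Real.log_le_log (by positivity) hKn
  have hLpos : 0 < Real.log n := lt_of_lt_of_le (by positivity) hKlog
  have hsqrt : (K : ℝ) * √K = (K : ℝ) ^ (3 / 2 : ℝ) := by
    rw [Real.sqrt_eq_rpow, ← Real.rpow_one_add' hKpos.le (by norm_num)]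
    norm_num
  have hKL : (K : ℝ) ^ (3 / 2 : ℝ) * Real.log 2 ^ (3 / 2 : ℝ) ≤ Real.log n ^ (3 / 2 : ℝ) := by
    rw [← Real.mul_rpow hKpos.le hlog.le]
    exact Real.rpow_le_rpow (by positivity) hKlog (by norm_num)
  have hmn : (m : ℝ) ^ 2 ≤ n ^ 2 := by
    gcongr
    rw [hn]
    push_cast
    linarith
  rw [mul_assoc, hsqrt, Real.rpow_neg hLpos.le]
  gcongr
  have hrp : 0 < n ^ (-delta) := Real.rpow_pos_of_pos hnpos _
  calc _ = n ^ (2 - delta) / (4 * D : ℝ) ^ (2 - delta) / n ^ 2 *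
        (Real.log 2 ^ (3 / 2 : ℝ) / Real.log n ^ (3 / 2 : ℝ)) := by
        rw [hsplit]
        field_simp
    _ ≤ (2 * Real.exp 1 * Real.log 2) ^ K / (m : ℝ) ^ 2 * (1 / (K : ℝ) ^ (3 / 2 : ℝ)) := by
        gcongr ?_ * ?_
        · gcongr
        · rw [div_le_div_iff₀ (by positivity) (by positivity)]
          linarith
    _ = _ := by rw [div_mul_div_comm, mul_one]

lemma exists_pos_le_of_pos {ι : Type*} (s : Finset ι) {g : ι → ℝ} (hg : ∀ i ∈ s, 0 < g i) :
    ∃ c : ℝ, 0 < c ∧ ∀ i ∈ s, c ≤ g i := by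
  rcases s.eq_empty_or_nonempty with rfl | hs
  · exact ⟨1, one_pos, by simp⟩
  · obtain ⟨i, hi, hmin⟩ := exists_min_image s g hs
    exact ⟨g i, hg i hi, hmin⟩

end Assembly

end TransitiveProportion

theorem transitive_proportion_lower_bound :
    ∃ c : ℝ, 0 < c ∧ ∀ n : ℕ, Even n → 2 < n →
      c * (n : ℝ) ^ (-delta) * (Real.log n) ^ (-(3/2 : ℝ)) ≤ transProp n := by
  obtain ⟨c₁, hc₁, N, H⟩ := TransitiveProportion.exists_le_transProp_of_large
  have hpos : ∀ n : ℕ, 2 < n → 0 < (n : ℝ) ^ (-delta) * Real.log n ^ (-(3 / 2 : ℝ)) := by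
    intro n hn
    have h1 : (1 : ℝ) < n := by exact_mod_cast (by omega : 1 < n)
    have h2 := Real.log_pos h1
    positivity
  obtain ⟨c₂, hc₂, H₂⟩ := TransitiveProportion.exists_pos_le_of_pos
    ((Finset.range N).filter fun n => Even n ∧ 2 < n)
    (g := fun n => transProp n / ((n : ℝ) ^ (-delta) * Real.log n ^ (-(3 / 2 : ℝ)))) (by
      intro n hn
      obtain ⟨-, h1, h2⟩ := Finset.mem_filter.1 hn
      exact div_pos (TransitiveProportion.transProp_pos h2 h1) (hpos n h2))
  refine ⟨min c₁ c₂, lt_min hc₁ hc₂, fun n hn hn2 => ?_⟩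
  rw [mul_assoc]
  rcases le_or_gt N n with h | h
  · exact (mul_le_mul_of_nonneg_right (min_le_left _ _) (hpos n hn2).le).trans (H n hn h)
  · have h3 := H₂ n (Finset.mem_filter.2 ⟨Finset.mem_range.2 h, hn, hn2⟩)
    rw [le_div_iff₀ (hpos n hn2)] at h3
    exact (mul_le_mul_of_nonneg_right (min_le_right _ _) (hpos n hn2).le).trans h3
end
end

section
/- There exist absolute constants C1, C2 > 0 such that for all integers n and k with 1 ≤ k ≤ n/2, one has C1 · (1/k) · E|𝓛(X_k)| ≤ i(n,k) ≤ C2 · (1/k) · E|𝓛(X_k)|. -/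
open scoped BigOperators

noncomputable section

/-- The set `𝓛(c) = { m₁ + 2m₂ + ⋯ + k·m_k : 0 ≤ m_j ≤ c_j }`. -/
def Lset (k : ℕ) (c : Fin k → ℕ) : Finset ℕ :=
  (Finset.Icc 0 c).image fun m => ∑ j : Fin k, ((j : ℕ) + 1) * m j

/-- Probability mass of a Poisson random variable with parameter `lam` at `n`. -/
def poissonPdf (lam : ℝ) (n : ℕ) : ℝ := Real.exp (-lam) * lam ^ n / (Nat.factorial n)

/-- Joint probability mass of the independent vector `X_k = (X_1,…,X_k)`,
`X_i ∼ Pois(1/i)`, at `c`. -/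
def pmfVec (k : ℕ) (c : Fin k → ℕ) : ℝ := ∏ i : Fin k, poissonPdf (1 / ((i : ℕ) + 1)) (c i)

/-- `E|𝓛(X_k)|`. -/
def EL (k : ℕ) : ℝ := ∑' c : Fin k → ℕ, ((Lset k c).card : ℝ) * pmfVec k c

/-- `π` has an invariant set of size `k`. -/
def hasInvariantSet (n k : ℕ) (π : Equiv.Perm (Fin n)) : Prop :=
  ∃ s : Finset (Fin n), s.card = k ∧ ∀ x ∈ s, π x ∈ s

/-- `i(n,k)`: the proportion of permutations of `{1,…,n}` having an invariant set of size `k`. -/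
def iProp (n k : ℕ) : ℝ :=
  (Nat.card {π : Equiv.Perm (Fin n) // hasInvariantSet n k π} : ℝ) /
    (Nat.card (Equiv.Perm (Fin n)) : ℝ)

open scoped ENNReal NNReal

/-- The weight `∏ x, 1 / (x ^ c_x * c_x!)` of a multiset in which `x` occurs `c_x` times: the
proportion of permutations of `M.sum` points whose multiset of cycle lengths is `M`. -/
def cycleWeight (M : Multiset ℕ) : ℝ≥0 :=
  ∏ x ∈ M.toFinset, ((x : ℝ≥0)⁻¹ ^ M.count x * ((M.count x).factorial : ℝ≥0)⁻¹)

/-- The set of sums of sub-multisets of `M`. -/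
def subsums (M : Multiset ℕ) : Finset ℕ := (M.powerset.map Multiset.sum).toFinset

lemma mem_subsums {M : Multiset ℕ} {s : ℕ} : s ∈ subsums M ↔ ∃ D ≤ M, D.sum = s := by
  simp [subsums]

lemma le_sum_of_mem_subsums {M : Multiset ℕ} {s : ℕ} (h : s ∈ subsums M) : s ≤ M.sum := by
  obtain ⟨D, hD, rfl⟩ := mem_subsums.1 h
  obtain ⟨E, rfl⟩ := Multiset.le_iff_exists_add.1 hD
  simp

lemma subsums_mono {M N : Multiset ℕ} (h : M ≤ N) : subsums M ⊆ subsums N := by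
  intro s
  simp only [mem_subsums]
  rintro ⟨D, hD, rfl⟩
  exact ⟨D, hD.trans h, rfl⟩

lemma card_subsums_cons_le (j : ℕ) (M : Multiset ℕ) :
    (subsums (j ::ₘ M)).card ≤ 2 * (subsums M).card := by
  have h : subsums (j ::ₘ M) ⊆ subsums M ∪ (subsums M).image (j + ·) := by
    intro s
    simp only [subsums, Multiset.powerset_cons, Multiset.map_add, Multiset.map_map,
      Multiset.toFinset_add, Finset.mem_union, Multiset.mem_toFinset, Multiset.mem_map,
      Finset.mem_image, Function.comp, Multiset.sum_cons]
    rintro (h | ⟨D, hD, rfl⟩)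
    · exact Or.inl h
    · exact Or.inr ⟨_, ⟨D, hD, rfl⟩, rfl⟩
  calc (subsums (j ::ₘ M)).card ≤ (subsums M ∪ (subsums M).image (j + ·)).card :=
        Finset.card_le_card h
    _ ≤ (subsums M).card + ((subsums M).image (j + ·)).card :=
      Finset.card_union_le _ _
    _ ≤ (subsums M).card + (subsums M).card := Nat.add_le_add_left Finset.card_image_le _
    _ = _ := by ring

lemma card_subsums_add_replicate_le (j c : ℕ) (M : Multiset ℕ) :
    (subsums (M + Multiset.replicate c j)).card ≤ 2 ^ c * (subsums M).card := by
  induction c with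
  | zero => simp
  | succ c ih =>
    rw [Multiset.replicate_succ, Multiset.add_cons]
    refine (card_subsums_cons_le _ _).trans ?_
    rw [pow_succ]
    linarith

lemma cycleWeight_eq_prod {M : Multiset ℕ} {S : Finset ℕ} (h : M.toFinset ⊆ S) :
    cycleWeight M =
      ∏ x ∈ S, ((x : ℝ≥0)⁻¹ ^ M.count x * ((M.count x).factorial : ℝ≥0)⁻¹) := by
  refine Finset.prod_subset h fun x _ hx => ?_
  rw [Multiset.mem_toFinset] at hx
  simp [Multiset.count_eq_zero_of_notMem hx]

@[simp] lemma cycleWeight_zero : cycleWeight 0 = 1 := by simp [cycleWeight]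

lemma cycleWeight_replicate (c j : ℕ) :
    cycleWeight (Multiset.replicate c j) = (j : ℝ≥0)⁻¹ ^ c * (c.factorial : ℝ≥0)⁻¹ := by
  rw [cycleWeight_eq_prod (S := {j})]
  · simp
  · intro x
    simp only [Multiset.mem_toFinset, Finset.mem_singleton]
    exact Multiset.eq_of_mem_replicate

lemma cycleWeight_add_of_disjoint {A B : Multiset ℕ} (h : Disjoint A B) :
    cycleWeight (A + B) = cycleWeight A * cycleWeight B := by
  rw [cycleWeight_eq_prod (M := A + B) (S := A.toFinset ∪ B.toFinset) (by simp),
    cycleWeight_eq_prod (M := A) (S := A.toFinset ∪ B.toFinset) Finset.subset_union_left,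
    cycleWeight_eq_prod (M := B) (S := A.toFinset ∪ B.toFinset) Finset.subset_union_right,
    ← Finset.prod_mul_distrib]
  refine Finset.prod_congr rfl fun x _ => ?_
  by_cases hx : x ∈ A
  · have : x ∉ B := Multiset.disjoint_left.1 h hx
    simp [Multiset.count_eq_zero_of_notMem this]
  · simp [Multiset.count_eq_zero_of_notMem hx]

lemma cycleWeight_add_le (A B : Multiset ℕ) :
    cycleWeight (A + B) ≤ cycleWeight A * cycleWeight B := by
  rw [cycleWeight_eq_prod (M := A + B) (S := A.toFinset ∪ B.toFinset) (by simp),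
    cycleWeight_eq_prod (M := A) (S := A.toFinset ∪ B.toFinset) Finset.subset_union_left,
    cycleWeight_eq_prod (M := B) (S := A.toFinset ∪ B.toFinset) Finset.subset_union_right,
    ← Finset.prod_mul_distrib]
  refine Finset.prod_le_prod' fun x _ => ?_
  rw [Multiset.count_add, pow_add, mul_mul_mul_comm]
  gcongr
  rw [← mul_inv]
  have h := Nat.factorial_mul_factorial_dvd_factorial_add (A.count x) (B.count x)
  have h' := Nat.le_of_dvd (Nat.factorial_pos _) h
  have h0 : 0 < (A.count x).factorial * (B.count x).factorial := by positivity
  gcongr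
  exact_mod_cast h'

lemma cycleWeight_cons (j : ℕ) (M : Multiset ℕ) :
    cycleWeight (j ::ₘ M) * (M.count j + 1) = (j : ℝ≥0)⁻¹ * cycleWeight M := by
  have hj : j ∈ insert j M.toFinset := by simp
  rw [cycleWeight_eq_prod (M := j ::ₘ M) (S := insert j M.toFinset) (by simp),
    cycleWeight_eq_prod (M := M) (S := insert j M.toFinset) (by simp),
    ← Finset.mul_prod_erase _ _ hj, ← Finset.mul_prod_erase _ _ hj]
  have h : ∀ x ∈ (insert j M.toFinset).erase j,
      ((x : ℝ≥0)⁻¹ ^ (j ::ₘ M).count x * (((j ::ₘ M).count x).factorial : ℝ≥0)⁻¹) =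
        ((x : ℝ≥0)⁻¹ ^ M.count x * ((M.count x).factorial : ℝ≥0)⁻¹) := by
    intro x hx
    rw [Multiset.count_cons_of_ne (Finset.ne_of_mem_erase hx)]
  rw [Finset.prod_congr rfl h, Multiset.count_cons_self, Nat.factorial_succ, pow_succ]
  push_cast
  rw [mul_inv]
  have : (M.count j : ℝ≥0) + 1 ≠ 0 := by positivity
  field_simp

lemma cycleWeight_cons_le (j : ℕ) (M : Multiset ℕ) :
    cycleWeight (j ::ₘ M) ≤ (j : ℝ≥0)⁻¹ * cycleWeight M := by
  rw [← cycleWeight_cons]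
  exact le_mul_of_one_le_right zero_le (by simp)

lemma cycleWeight_eq_zero {M : Multiset ℕ} (h : 0 ∈ M) : cycleWeight M = 0 := by
  refine Finset.prod_eq_zero (i := 0) (by simpa using h) ?_
  have : M.count 0 ≠ 0 := by simpa [Multiset.count_eq_zero] using h
  simp [this]

/-- Marking one element of a multiset, counted according to its size. -/
lemma tsum_sum_mul_cycleWeight (f : Multiset ℕ → ℝ≥0∞) :
    ∑' M : Multiset ℕ, (M.sum : ℝ≥0∞) * (cycleWeight M * f M) =
      ∑' j : ℕ, ∑' M : Multiset ℕ, if j = 0 then 0 else cycleWeight M * f (j ::ₘ M) := by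
  have hsum : ∀ M : Multiset ℕ, (M.sum : ℝ≥0∞) = ∑' j : ℕ, (M.count j * j : ℝ≥0∞) := by
    intro M
    rw [tsum_eq_sum (s := M.toFinset), Finset.sum_multiset_count M]
    · simp
    · intro j hj
      rw [Multiset.mem_toFinset] at hj
      simp [Multiset.count_eq_zero_of_notMem hj]
  simp_rw [hsum, ← ENNReal.tsum_mul_right]
  rw [ENNReal.tsum_comm]
  refine tsum_congr fun j => ?_
  have hsupp : Function.support
      (fun M : Multiset ℕ => (M.count j * j : ℝ≥0∞) * (cycleWeight M * f M)) ⊆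
        Set.range (Multiset.cons j) := by
    intro M hM
    by_contra hj
    have : j ∉ M := fun h => hj (by
      obtain ⟨t, rfl⟩ := Multiset.exists_cons_of_mem h
      exact ⟨t, rfl⟩)
    simp [Multiset.count_eq_zero_of_notMem this] at hM
  have hinj : Function.Injective (Multiset.cons j) := fun _ _ h => (Multiset.cons_inj_right j).1 h
  rw [← hinj.tsum_eq hsupp]
  refine tsum_congr fun M => ?_
  split_ifs with hj
  · simp [hj]
  · have h : (j : ℝ≥0) * (cycleWeight (j ::ₘ M) * (M.count j + 1)) = cycleWeight M := by
      rw [cycleWeight_cons, mul_inv_cancel_left₀ (by exact_mod_cast hj)]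
    rw [← h, Multiset.count_cons_self]
    push_cast
    ring

/-- The proportion of permutations of `n` points all of whose cycles have length at least `m`. -/
def longCycleProp (n m : ℕ) : ℝ≥0∞ :=
  ∑' M : Multiset ℕ, if M.sum = n ∧ ∀ x ∈ M, m ≤ x then (cycleWeight M : ℝ≥0∞) else 0

lemma longCycleProp_zero {m : ℕ} (hm : 0 < m) : longCycleProp 0 m = 1 := by
  rw [longCycleProp, tsum_eq_single 0]
  · simp
  · intro M hM
    rw [if_neg]
    rintro ⟨hs, hx⟩
    obtain ⟨x, hxM⟩ := Multiset.exists_mem_of_ne_zero hM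
    have := Multiset.le_sum_of_mem hxM
    have := hx x hxM
    omega

lemma mul_longCycleProp {m : ℕ} (hm : 0 < m) (n : ℕ) :
    (n : ℝ≥0∞) * longCycleProp n m = ∑ t ∈ Finset.range (n + 1 - m), longCycleProp t m := by
  have h := tsum_sum_mul_cycleWeight fun M => if M.sum = n ∧ ∀ x ∈ M, m ≤ x then 1 else 0
  have h1 : (n : ℝ≥0∞) * longCycleProp n m = ∑' M : Multiset ℕ, (M.sum : ℝ≥0∞) *
      (cycleWeight M * if M.sum = n ∧ ∀ x ∈ M, m ≤ x then 1 else 0) := by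
    rw [longCycleProp, ← ENNReal.tsum_mul_left]
    refine tsum_congr fun M => ?_
    split_ifs with hM
    · rw [hM.1, mul_one]
    · simp
  have h2 : ∀ j : ℕ, (∑' M : Multiset ℕ, if j = 0 then 0 else
      (cycleWeight M : ℝ≥0∞) * if (j ::ₘ M).sum = n ∧ ∀ x ∈ j ::ₘ M, m ≤ x then 1 else 0) =
        if j ∈ Finset.Icc m n then longCycleProp (n - j) m else 0 := by
    intro j
    split_ifs with hj0 hj hj
    · simp only [Finset.mem_Icc] at hj
      omega
    · simp
    · rw [longCycleProp]
      refine tsum_congr fun M => ?_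
      rw [Finset.mem_Icc] at hj
      have : ((j ::ₘ M).sum = n ∧ ∀ x ∈ j ::ₘ M, m ≤ x) ↔ (M.sum = n - j ∧ ∀ x ∈ M, m ≤ x) := by
        simp only [Multiset.sum_cons, Multiset.mem_cons, forall_eq_or_imp]
        constructor
        · rintro ⟨h1, h2, h3⟩
          exact ⟨by omega, h3⟩
        · rintro ⟨h1, h3⟩
          exact ⟨by omega, hj.1, h3⟩
      simp only [this, mul_ite, mul_one, mul_zero]
    · rw [ENNReal.tsum_eq_zero]
      intro M
      rw [if_neg, mul_zero]
      rintro ⟨h1, h2⟩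
      refine hj (Finset.mem_Icc.2 ⟨h2 j (by simp), ?_⟩)
      rw [Multiset.sum_cons] at h1
      omega
  rw [h1, h, tsum_congr h2, tsum_eq_sum (s := Finset.Icc m n)]
  · rw [Finset.sum_congr rfl fun j hj => if_pos hj]
    refine Finset.sum_nbij' (n - ·) (n - ·) ?_ ?_ ?_ ?_ ?_ <;>
      simp only [Finset.mem_Icc, Finset.mem_range] <;> intros <;> first | omega | trivial
  · intro j hj
    rw [if_neg hj]

lemma longCycleProp_eq_zero {m n : ℕ} (hn : 0 < n) (hnm : n < m) : longCycleProp n m = 0 := by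
  have h := mul_longCycleProp (by omega : 0 < m) n
  rw [Nat.sub_eq_zero_of_le (by omega : n + 1 ≤ m)] at h
  simpa [hn.ne'] using h

lemma sum_longCycleProp {m n : ℕ} (hm : 0 < m) (hn : m ≤ n) :
    ∑ t ∈ Finset.range (n + 1 - m), longCycleProp t m =
      1 + ∑ t ∈ Finset.Ico m (n + 1 - m), longCycleProp t m := by
  have h : Finset.Ico m (n + 1 - m) ⊆ (Finset.range (n + 1 - m)).erase 0 := by
    intro t
    simp only [Finset.mem_Ico, Finset.mem_erase, Finset.mem_range]
    omega
  have h0 : 0 ∈ Finset.range (n + 1 - m) := by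
    simp only [Finset.mem_range]
    omega
  rw [← Finset.add_sum_erase _ _ h0, longCycleProp_zero hm, Finset.sum_subset h]
  intro t ht ht'
  simp only [Finset.mem_Ico, Finset.mem_erase, Finset.mem_range] at ht ht'
  exact longCycleProp_eq_zero (by omega) (by omega)

lemma mul_longCycleProp_le_one {m : ℕ} (hm : 0 < m) :
    ∀ n : ℕ, 0 < n → (m : ℝ≥0∞) * longCycleProp n m ≤ 1 := by
  intro n
  induction n using Nat.strong_induction_on with
  | _ n ih =>
    intro hn
    rcases lt_or_ge n m with hnm | hnm
    · simp [longCycleProp_eq_zero hn hnm]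
    have hn0 : (n : ℝ≥0∞) ≠ 0 := by exact_mod_cast hn.ne'
    refine (ENNReal.mul_le_mul_iff_right hn0 (ENNReal.natCast_ne_top n)).1 ?_
    calc (n : ℝ≥0∞) * (m * longCycleProp n m) = m * (n * longCycleProp n m) := by ring
      _ = m + ∑ t ∈ Finset.Ico m (n + 1 - m), m * longCycleProp t m := by
        rw [mul_longCycleProp hm, sum_longCycleProp hm hnm, mul_add, mul_one, Finset.mul_sum]
      _ ≤ m + ∑ t ∈ Finset.Ico m (n + 1 - m), 1 := by
        gcongr with t ht
        rw [Finset.mem_Ico] at ht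
        exact ih t (by omega) (by omega)
      _ ≤ n * 1 := by
        rw [Finset.sum_const, Nat.card_Ico]
        simp only [nsmul_eq_mul, mul_one]
        norm_cast
        omega

lemma one_le_mul_longCycleProp {m : ℕ} (hm : 0 < m) :
    ∀ n : ℕ, m ≤ n → 1 ≤ 2 * m * longCycleProp n m := by
  intro n
  induction n using Nat.strong_induction_on with
  | _ n ih =>
    intro hn
    have hn0 : (n : ℝ≥0∞) ≠ 0 := by
      have : n ≠ 0 := by omega
      exact_mod_cast this
    refine (ENNReal.mul_le_mul_iff_right hn0 (ENNReal.natCast_ne_top n)).1 ?_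
    calc (n : ℝ≥0∞) * 1 ≤ 2 * m + ∑ t ∈ Finset.Ico m (n + 1 - m), 1 := by
          rw [Finset.sum_const, Nat.card_Ico]
          simp only [nsmul_eq_mul, mul_one]
          norm_cast
          omega
      _ ≤ 2 * m + ∑ t ∈ Finset.Ico m (n + 1 - m), 2 * m * longCycleProp t m := by
        gcongr with t ht
        rw [Finset.mem_Ico] at ht
        exact ih t (by omega) (by omega)
      _ = 2 * m * (n * longCycleProp n m) := by
        rw [mul_longCycleProp hm, sum_longCycleProp hm hn, mul_add, mul_one, Finset.mul_sum]
      _ = n * (2 * m * longCycleProp n m) := by ring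

lemma Multiset.exists_le_map_eq_of_le_map {α β : Type*} {f : α → β} {S : Multiset α} :
    ∀ {D : Multiset β}, D ≤ S.map f → ∃ T ≤ S, T.map f = D := by
  classical
  induction S using Multiset.induction_on with
  | empty =>
    intro D hD
    exact ⟨0, le_rfl, by simpa using (le_antisymm hD (Multiset.zero_le D)).symm⟩
  | cons a S ih =>
    intro D hD
    rw [Multiset.map_cons] at hD
    by_cases ha : f a ∈ D
    · obtain ⟨D', rfl⟩ := Multiset.exists_cons_of_mem ha
      obtain ⟨T, hT, rfl⟩ := ih ((Multiset.cons_le_cons_iff _).1 hD)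
      exact ⟨a ::ₘ T, Multiset.cons_le_cons a hT, by simp⟩
    · obtain ⟨T, hT, rfl⟩ := ih ((Multiset.le_cons_of_notMem ha).1 hD)
      exact ⟨T, hT.trans (Multiset.le_cons_self _ _), rfl⟩

section Perm

variable {α : Type*} [Fintype α] [DecidableEq α]

lemma eq_filter_add_replicate_one {M : Multiset ℕ} (h : 0 ∉ M) :
    M = M.filter (2 ≤ ·) + Multiset.replicate (M.count 1) 1 := by
  ext x
  rw [Multiset.count_add, Multiset.count_filter, Multiset.count_replicate]
  rcases Nat.lt_or_ge x 2 with hx | hx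
  · interval_cases x
    · simp [Multiset.count_eq_zero_of_notMem h]
    · simp
  · rw [if_pos hx, if_neg (by omega), add_zero]

lemma card_partition_eq {M : Multiset ℕ} (hM : M.sum = Fintype.card α) :
    ((Finset.univ.filter fun σ : Equiv.Perm α => σ.partition.parts = M).card : ℝ≥0) =
      (Fintype.card α).factorial * cycleWeight M := by
  by_cases h0 : 0 ∈ M
  · rw [cycleWeight_eq_zero h0, mul_zero, Nat.cast_eq_zero, Finset.card_eq_zero,
      Finset.filter_eq_empty_iff]
    rintro σ - rfl
    exact absurd (σ.partition.parts_pos h0) (lt_irrefl 0)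
  set M₂ := M.filter (2 ≤ ·) with hM₂
  have hMeq : M = M₂ + Multiset.replicate (M.count 1) 1 := eq_filter_add_replicate_one h0
  have hsum : M₂.sum + M.count 1 = Fintype.card α := by
    rw [← hM, congrArg Multiset.sum hMeq]
    simp
  have hiff : ∀ σ : Equiv.Perm α, σ.partition.parts = M ↔ σ.cycleType = M₂ := by
    intro σ
    constructor
    · intro h
      rw [hM₂, ← h, Equiv.Perm.filter_parts_partition_eq_cycleType]
    · intro h
      rw [Equiv.Perm.parts_partition, ← Equiv.Perm.sum_cycleType, h, hMeq]
      congr 2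
      omega
  have h2 : ∀ a ∈ M₂, 2 ≤ a := fun a ha => (Multiset.mem_filter.1 ha).2
  have hcard := Equiv.Perm.card_of_cycleType_mul_eq α M₂
  rw [if_pos ⟨by omega, h2⟩, show Fintype.card α - M₂.sum = M.count 1 by omega] at hcard
  have hdisj : Disjoint M₂ (Multiset.replicate (M.count 1) 1) := by
    rw [Multiset.disjoint_left]
    intro a ha ha'
    have := h2 a ha
    rw [Multiset.eq_of_mem_replicate ha'] at this
    omega
  have hw : cycleWeight M = cycleWeight M₂ * ((M.count 1).factorial : ℝ≥0)⁻¹ := by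
    conv_lhs => rw [hMeq]
    rw [cycleWeight_add_of_disjoint hdisj, cycleWeight_replicate]
    simp
  have hw₂ : cycleWeight M₂ * (M₂.prod * ∏ x ∈ M₂.toFinset, (M₂.count x).factorial : ℕ) = 1 := by
    rw [Finset.prod_multiset_count, ← Finset.prod_mul_distrib, Nat.cast_prod, cycleWeight,
      ← Finset.prod_mul_distrib]
    refine Finset.prod_eq_one fun x hx => ?_
    have hx0 : (x : ℝ≥0) ≠ 0 := by
      have := h2 x (Multiset.mem_toFinset.1 hx)
      have : x ≠ 0 := by omega
      exact_mod_cast this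
    have hf : ((M₂.count x).factorial : ℝ≥0) ≠ 0 := by positivity
    push_cast
    rw [inv_pow]
    field_simp
  simp_rw [hiff]
  rw [hw, ← hcard]
  have hf : ((M.count 1).factorial : ℝ≥0) ≠ 0 := by positivity
  generalize (Finset.univ.filter fun σ : Equiv.Perm α => σ.cycleType = M₂).card = N at *
  calc (N : ℝ≥0) = N * (cycleWeight M₂ *
        (M₂.prod * ∏ x ∈ M₂.toFinset, (M₂.count x).factorial : ℕ)) := by rw [hw₂, mul_one]
    _ = _ := by
      push_cast
      field_simp

lemma exists_le_partition_of_invariant {σ : Equiv.Perm α} {s : Finset α}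
    (hs : ∀ x ∈ s, σ x ∈ s) : ∃ D ≤ σ.partition.parts, D.sum = s.card := by
  have hiff : ∀ x, σ x ∈ s ↔ x ∈ s := by
    intro x
    refine ⟨fun hx => ?_, hs x⟩
    have himg : s.image σ = s := Finset.eq_of_subset_of_card_le
      (Finset.image_subset_iff.2 hs) (Finset.card_image_of_injective _ σ.injective).ge
    rw [← himg, Finset.mem_image] at hx
    obtain ⟨y, hy, hxy⟩ := hx
    rwa [← σ.injective hxy]
  set τ : Equiv.Perm α := Equiv.Perm.ofSubtype (σ.subtypePerm (p := (· ∈ s)) hiff) with hτ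
  set ρ : Equiv.Perm α := Equiv.Perm.ofSubtype
    (σ.subtypePerm (p := (· ∉ s)) fun x => not_congr (hiff x)) with hρ
  have hτs : τ.support ⊆ s := by
    intro x hx
    by_contra h
    exact Equiv.Perm.mem_support.1 hx (Equiv.Perm.ofSubtype_apply_of_not_mem _ h)
  have hρs : ρ.support ⊆ sᶜ := by
    intro x hx
    rw [Finset.mem_compl]
    intro h
    exact Equiv.Perm.mem_support.1 hx (Equiv.Perm.ofSubtype_apply_of_not_mem _ (not_not.2 h))
  have hdisj : τ.Disjoint ρ := by
    rw [Equiv.Perm.disjoint_iff_disjoint_support]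
    exact (disjoint_compl_right (a := s)).mono hτs hρs
  have hmul : σ = τ * ρ := by
    ext x
    rw [Equiv.Perm.mul_apply]
    by_cases hx : x ∈ s
    · rw [show ρ x = x from Equiv.Perm.ofSubtype_apply_of_not_mem _ (not_not.2 hx),
        hτ, Equiv.Perm.ofSubtype_subtypePerm_of_mem _ hx]
    · rw [hρ, Equiv.Perm.ofSubtype_subtypePerm_of_mem (p := (· ∉ s)) _ hx,
        show τ (σ x) = σ x from
          Equiv.Perm.ofSubtype_apply_of_not_mem _ (by rwa [hiff])]
  have h1 := Finset.card_le_card hτs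
  have h2 := Finset.card_le_card hρs
  have h3 : σ.support.card = τ.support.card + ρ.support.card := by
    rw [hmul, hdisj.card_support_mul]
  rw [Finset.card_compl] at h2
  have h4 := s.card_le_univ
  refine ⟨τ.cycleType + Multiset.replicate (s.card - τ.support.card) 1, ?_, ?_⟩
  · rw [Equiv.Perm.parts_partition, h3]
    refine add_le_add ?_ (Multiset.replicate_le_replicate _ |>.2 (by omega))
    rw [hmul, hdisj.cycleType_mul]
    exact Multiset.le_add_right _ _
  · rw [Multiset.sum_add, Equiv.Perm.sum_cycleType, Multiset.sum_replicate, smul_eq_mul]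
    omega

lemma exists_invariant_of_le_partition {σ : Equiv.Perm α} {D : Multiset ℕ}
    (hD : D ≤ σ.partition.parts) : ∃ s : Finset α, s.card = D.sum ∧ ∀ x ∈ s, σ x ∈ s := by
  have h0 : 0 ∉ D := fun h =>
    absurd (σ.partition.parts_pos (Multiset.mem_of_le hD h)) (lt_irrefl 0)
  have hcyc : D.filter (2 ≤ ·) ≤ σ.cycleType := by
    rw [← Equiv.Perm.filter_parts_partition_eq_cycleType]
    exact Multiset.filter_le_filter _ hD
  have hone : D.count 1 ≤ (σ.support)ᶜ.card := by
    have h := Multiset.count_le_of_le 1 hD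
    have h1 : 1 ∉ σ.cycleType := fun h1 => by
      have := Equiv.Perm.two_le_of_mem_cycleType h1
      omega
    rw [Equiv.Perm.parts_partition, Multiset.count_add, Multiset.count_replicate_self,
      Multiset.count_eq_zero_of_notMem h1] at h
    rw [Finset.card_compl]
    omega
  rw [Equiv.Perm.cycleType_def] at hcyc
  obtain ⟨T, hT, hTD⟩ := Multiset.exists_le_map_eq_of_le_map hcyc
  obtain ⟨F, hF, hFc⟩ := Finset.exists_subset_card_eq hone
  have hTn : T.Nodup := Multiset.nodup_of_le hT σ.cycleFactorsFinset.nodup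
  set S : Finset (Equiv.Perm α) := ⟨T, hTn⟩ with hS
  have hSσ : S ⊆ σ.cycleFactorsFinset := fun c hc => Multiset.mem_of_le hT hc
  have hsub : S.biUnion Equiv.Perm.support ⊆ σ.support := by
    refine Finset.biUnion_subset.2 fun c hc => ?_
    exact Equiv.Perm.mem_cycleFactorsFinset_support_le (hSσ hc)
  refine ⟨S.biUnion Equiv.Perm.support ∪ F, ?_, ?_⟩
  · rw [Finset.card_union_of_disjoint, Finset.card_biUnion, hFc]
    · conv_rhs => rw [eq_filter_add_replicate_one h0]
      rw [Multiset.sum_add, Multiset.sum_replicate, ← hTD, smul_eq_mul, mul_one]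
      rfl
    · intro c hc d hd hcd
      exact (σ.cycleFactorsFinset_pairwise_disjoint (hSσ hc) (hSσ hd) hcd).disjoint_support
    · exact (disjoint_compl_right (a := σ.support)).mono hsub hF
  · intro x hx
    rw [Finset.mem_union] at hx ⊢
    rcases hx with hx | hx
    · left
      rw [Finset.mem_biUnion] at hx ⊢
      obtain ⟨c, hc, hxc⟩ := hx
      exact ⟨c, hc, (Equiv.Perm.mem_cycleFactorsFinset_support (hSσ hc) x).2 hxc⟩
    · right
      have := hF hx
      rw [Finset.mem_compl, Equiv.Perm.notMem_support] at this
      rwa [this]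

end Perm

lemma hasInvariantSet_iff {n k : ℕ} {σ : Equiv.Perm (Fin n)} :
    hasInvariantSet n k σ ↔ k ∈ subsums σ.partition.parts := by
  rw [mem_subsums]
  constructor
  · rintro ⟨s, rfl, hs⟩
    exact exists_le_partition_of_invariant hs
  · rintro ⟨D, hD, rfl⟩
    exact exists_invariant_of_le_partition hD

/-- The proportion of permutations with an invariant `k`-set, as a sum over cycle types. -/
lemma ofReal_iProp (n k : ℕ) :
    ENNReal.ofReal (iProp n k) =
      ∑' M : Multiset ℕ, if M.sum = n ∧ k ∈ subsums M then (cycleWeight M : ℝ≥0∞) else 0 := by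
  classical
  set P : Finset (Equiv.Perm (Fin n)) :=
    Finset.univ.filter fun σ => k ∈ subsums σ.partition.parts with hP
  have hnum : Nat.card {π : Equiv.Perm (Fin n) // hasInvariantSet n k π} = P.card := by
    rw [Nat.card_eq_fintype_card, Fintype.card_subtype]
    exact congrArg Finset.card (Finset.filter_congr fun σ _ => hasInvariantSet_iff)
  have hden : Nat.card (Equiv.Perm (Fin n)) = n.factorial := by
    rw [Nat.card_eq_fintype_card, Fintype.card_perm, Fintype.card_fin]
  have hn0 : (n.factorial : ℝ≥0) ≠ 0 := by positivity
  have key : (P.card : ℝ≥0) / n.factorial =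
      ∑ M ∈ P.image fun σ => σ.partition.parts, cycleWeight M := by
    rw [div_eq_iff hn0, Finset.card_eq_sum_card_image fun σ => σ.partition.parts, Nat.cast_sum,
      Finset.sum_mul]
    refine Finset.sum_congr rfl fun M hM => ?_
    obtain ⟨σ, hσ, rfl⟩ := Finset.mem_image.1 hM
    have h := card_partition_eq (α := Fin n) σ.partition.parts_sum
    rw [mul_comm, show n.factorial = (Fintype.card (Fin n)).factorial by rw [Fintype.card_fin], ← h,
      Finset.filter_filter]
    congr 2
    refine Finset.filter_congr fun τ _ => ?_
    refine and_iff_right_of_imp fun h => ?_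
    rw [h]
    exact (Finset.mem_filter.1 hσ).2
  have hval : iProp n k = (((P.card : ℝ≥0) / n.factorial : ℝ≥0) : ℝ) := by
    rw [iProp, hnum, hden]
    push_cast
    rfl
  rw [hval, ENNReal.ofReal_coe_nnreal, key, ENNReal.ofNNReal_finsetSum,
    tsum_eq_sum (s := P.image fun σ => σ.partition.parts)]
  · refine Finset.sum_congr rfl fun M hM => ?_
    obtain ⟨σ, hσ, rfl⟩ := Finset.mem_image.1 hM
    rw [if_pos ⟨by simpa using σ.partition.parts_sum, (Finset.mem_filter.1 hσ).2⟩]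
  · intro M hM
    split_ifs with h
    · by_contra hw
      have hc := card_partition_eq (α := Fin n) (M := M) (by simpa using h.1)
      have : (Finset.univ.filter fun σ : Equiv.Perm (Fin n) => σ.partition.parts = M).card ≠ 0 := by
        intro h0
        rw [h0, Fintype.card_fin] at hc
        simp_all
      obtain ⟨σ, hσ⟩ := Finset.card_ne_zero.1 this
      have hσM := (Finset.mem_filter.1 hσ).2
      refine hM (Finset.mem_image.2 ⟨σ, ?_, hσM⟩)
      simp [hP, hσM, h.2]
    · rfl

lemma ENNReal.tsum_le_tsum_of_injOn {α β : Type*} {f : α → ℝ≥0∞} {g : β → ℝ≥0∞} (φ : α → β)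
    (hinj : Set.InjOn φ (Function.support f)) (h : ∀ a, f a ≠ 0 → f a ≤ g (φ a)) :
    ∑' a, f a ≤ ∑' b, g b := by
  rw [← tsum_subtype_support]
  calc ∑' a : Function.support f, f a ≤ ∑' a : Function.support f, g (φ a) :=
        ENNReal.tsum_le_tsum fun a => h a a.2
    _ ≤ ∑' b, g b := ENNReal.tsum_comp_le_tsum_of_injective
        (f := fun a : Function.support f => φ a) (hinj.injective) g

lemma ENNReal.tsum_le_tsum_of_cover {α β : Type*} {f : α → ℝ≥0∞} {g : β → ℝ≥0∞} (φ : β → α)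
    (h : ∀ a, f a ≠ 0 → ∃ b, φ b = a ∧ f a ≤ g b) : ∑' a, f a ≤ ∑' b, g b := by
  classical
  rcases isEmpty_or_nonempty β with hβ | hβ
  · have : ∀ a, f a = 0 := fun a => by
      by_contra ha
      exact hβ.elim (h a ha).choose
    simp [this]
  choose! ψ hψ using h
  refine ENNReal.tsum_le_tsum_of_injOn ψ ?_ fun a ha => (hψ a ha).2
  intro a ha b hb hab
  rw [← (hψ a ha).1, hab, (hψ b hb).1]

/-- The sum of `g` over all multisets with elements at most `k`, weighted by `cycleWeight`. -/
def smallCycleSum (k : ℕ) (g : Multiset ℕ → ℝ≥0∞) : ℝ≥0∞ :=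
  ∑' M : Multiset ℕ, if ∀ x ∈ M, x ≤ k then cycleWeight M * g M else 0

/-- The weighted number of subset sums of multisets with elements at most `k`. -/
def subsumMass (k : ℕ) : ℝ≥0∞ := smallCycleSum k fun M => (subsums M).card

lemma smallCycleSum_mono (k : ℕ) {g h : Multiset ℕ → ℝ≥0∞}
    (hgh : ∀ M, (∀ x ∈ M, x ≤ k) → g M ≤ h M) : smallCycleSum k g ≤ smallCycleSum k h := by
  refine ENNReal.tsum_le_tsum fun M => ?_
  split_ifs with hM
  · gcongr
    exact hgh M hM
  · rfl

lemma smallCycleSum_add (k : ℕ) (g h : Multiset ℕ → ℝ≥0∞) :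
    smallCycleSum k (fun M => g M + h M) = smallCycleSum k g + smallCycleSum k h := by
  rw [smallCycleSum, smallCycleSum, smallCycleSum, ← ENNReal.tsum_add]
  refine tsum_congr fun M => ?_
  split_ifs <;> ring

lemma smallCycleSum_const_mul (k : ℕ) (a : ℝ≥0∞) (g : Multiset ℕ → ℝ≥0∞) :
    smallCycleSum k (fun M => a * g M) = a * smallCycleSum k g := by
  rw [smallCycleSum, smallCycleSum, ← ENNReal.tsum_mul_left]
  refine tsum_congr fun M => ?_
  split_ifs <;> ring

lemma smallCycleSum_sum_mul (k : ℕ) (g : Multiset ℕ → ℝ≥0∞) :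
    smallCycleSum k (fun M => M.sum * g M) =
      ∑ j ∈ Finset.Icc 1 k, smallCycleSum k fun M => g (j ::ₘ M) := by
  have h := tsum_sum_mul_cycleWeight fun M => if ∀ x ∈ M, x ≤ k then g M else 0
  calc smallCycleSum k (fun M => M.sum * g M) = ∑' M : Multiset ℕ, (M.sum : ℝ≥0∞) *
        (cycleWeight M * if ∀ x ∈ M, x ≤ k then g M else 0) := by
        refine tsum_congr fun M => ?_
        split_ifs <;> ring
    _ = ∑' j : ℕ, if j ∈ Finset.Icc 1 k then smallCycleSum k (fun M => g (j ::ₘ M)) else 0 := by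
      rw [h]
      refine tsum_congr fun j => ?_
      simp only [Multiset.mem_cons, forall_eq_or_imp, Finset.mem_Icc]
      split_ifs with h0 h1 h1
      · omega
      · simp
      · refine tsum_congr fun M => ?_
        simp [h1.2]
      · rw [ENNReal.tsum_eq_zero]
        intro M
        rw [if_neg (by omega), mul_zero]
    _ = _ := by
      rw [tsum_eq_sum (s := Finset.Icc 1 k) fun j hj => if_neg hj]
      exact Finset.sum_congr rfl fun j hj => if_pos hj

lemma card_subsums_cons_le_cast (j : ℕ) (M : Multiset ℕ) :
    ((subsums (j ::ₘ M)).card : ℝ≥0∞) ≤ 2 * (subsums M).card := by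
  exact_mod_cast card_subsums_cons_le j M

lemma smallCycleSum_sum_mul_card_subsums_le (k : ℕ) :
    smallCycleSum k (fun M => M.sum * (subsums M).card) ≤ 2 * k * subsumMass k := by
  rw [smallCycleSum_sum_mul k fun M => ((subsums M).card : ℝ≥0∞)]
  calc ∑ j ∈ Finset.Icc 1 k, smallCycleSum k (fun M => ((subsums (j ::ₘ M)).card : ℝ≥0∞))
      ≤ ∑ j ∈ Finset.Icc 1 k, 2 * subsumMass k := by
        refine Finset.sum_le_sum fun j _ => ?_
        rw [subsumMass, ← smallCycleSum_const_mul]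
        exact smallCycleSum_mono k fun M _ => card_subsums_cons_le_cast j M
    _ = _ := by
      rw [Finset.sum_const, Nat.card_Icc, nsmul_eq_mul, Nat.add_sub_cancel]
      ring

lemma smallCycleSum_sum_sq_mul_card_subsums_le (k : ℕ) :
    smallCycleSum k (fun M => (M.sum : ℝ≥0∞) ^ 2 * (subsums M).card) ≤
      6 * k ^ 2 * subsumMass k := by
  have h : (fun M : Multiset ℕ => (M.sum : ℝ≥0∞) ^ 2 * (subsums M).card) =
      fun M : Multiset ℕ => (M.sum : ℝ≥0∞) * (M.sum * (subsums M).card) := by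
    ext M
    ring
  rw [h, smallCycleSum_sum_mul k fun M => ((M.sum : ℝ≥0∞) * (subsums M).card)]
  calc ∑ j ∈ Finset.Icc 1 k,
        smallCycleSum k (fun M => ((j ::ₘ M).sum : ℝ≥0∞) * (subsums (j ::ₘ M)).card)
      ≤ ∑ j ∈ Finset.Icc 1 k, 6 * k * subsumMass k := by
        refine Finset.sum_le_sum fun j hj => ?_
        calc smallCycleSum k (fun M => ((j ::ₘ M).sum : ℝ≥0∞) * (subsums (j ::ₘ M)).card)
            ≤ smallCycleSum k (fun M => 2 * k * (subsums M).card +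
                2 * (M.sum * (subsums M).card)) := by
              refine smallCycleSum_mono k fun M _ => ?_
              rw [Multiset.sum_cons]
              calc ((j + M.sum : ℕ) : ℝ≥0∞) * (subsums (j ::ₘ M)).card
                  ≤ (k + M.sum) * (2 * (subsums M).card) := by
                    push_cast
                    gcongr
                    · exact (Finset.mem_Icc.1 hj).2
                    · exact card_subsums_cons_le_cast j M
                _ = _ := by ring
          _ = 2 * k * subsumMass k +
                2 * smallCycleSum k (fun M => M.sum * (subsums M).card) := by
              rw [smallCycleSum_add, smallCycleSum_const_mul, smallCycleSum_const_mul, subsumMass]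
          _ ≤ 2 * k * subsumMass k + 2 * (2 * k * subsumMass k) := by
              gcongr
              exact smallCycleSum_sum_mul_card_subsums_le k
          _ = _ := by ring
    _ = _ := by
      rw [Finset.sum_const, Nat.card_Icc, nsmul_eq_mul, Nat.add_sub_cancel]
      ring

lemma subsumMass_zero : subsumMass 0 = 1 := by
  rw [subsumMass, smallCycleSum, tsum_eq_single 0]
  · simp [subsums]
  · intro M hM
    obtain ⟨x, hx⟩ := Multiset.exists_mem_of_ne_zero hM
    split_ifs with h
    · have : 0 ∈ M := by rwa [← Nat.le_zero.1 (h x hx)]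
      simp [cycleWeight_eq_zero this]
    · rfl

lemma add_two_mul_subsumMass_le (m : ℕ) :
    ((m : ℝ≥0∞) + 2) * subsumMass m ≤ (m + 1) * subsumMass (m + 1) := by
  set F : Multiset ℕ → ℝ≥0∞ := fun M => cycleWeight M * (subsums M).card with hF
  have hsplit : subsumMass (m + 1) ≥ subsumMass m +
      ∑' M : Multiset ℕ, if (∀ x ∈ M, x ≤ m + 1) ∧ m + 1 ∈ M then F M else 0 := by
    rw [subsumMass, subsumMass, smallCycleSum, smallCycleSum, ← ENNReal.tsum_add]
    refine ENNReal.tsum_le_tsum fun M => ?_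
    by_cases h1 : ∀ x ∈ M, x ≤ m
    · rw [if_pos h1, if_neg, add_zero, if_pos fun x hx => (h1 x hx).trans (Nat.le_succ m)]
      rintro ⟨-, h⟩
      have := h1 _ h
      omega
    · rw [if_neg h1, zero_add]
      split_ifs with h2 h3 h3
      · rfl
      · exact absurd h2.1 h3
      · exact zero_le
      · rfl
  have hcons : subsumMass m ≤ (m + 1) *
      ∑' M : Multiset ℕ, if (∀ x ∈ M, x ≤ m + 1) ∧ m + 1 ∈ M then F M else 0 := by
    rw [← ENNReal.tsum_mul_left]
    refine ENNReal.tsum_le_tsum_of_injOn (Multiset.cons (m + 1))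
      (fun _ _ _ _ h => (Multiset.cons_inj_right _).1 h) fun M hM => ?_
    have hMm : ∀ x ∈ M, x ≤ m := by
      by_contra h
      exact hM (if_neg h)
    have hnot : m + 1 ∉ M := fun h => by
      have := hMm _ h
      omega
    rw [if_pos hMm, if_pos]
    · have hw := cycleWeight_cons (m + 1) M
      rw [Multiset.count_eq_zero_of_notMem hnot, Nat.cast_zero, zero_add, mul_one] at hw
      have hw' : ((m : ℝ≥0) + 1) * cycleWeight ((m + 1) ::ₘ M) = cycleWeight M := by
        rw [hw]
        push_cast
        rw [mul_inv_cancel_left₀ (by positivity)]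
      rw [hF, ← hw']
      push_cast
      rw [mul_assoc]
      gcongr
      exact subsums_mono (Multiset.le_cons_self _ _)
    · simp only [Multiset.mem_cons, true_or, and_true, forall_eq_or_imp, le_refl, true_and]
      exact fun x hx => (hMm x hx).trans (Nat.le_succ m)
  calc ((m : ℝ≥0∞) + 2) * subsumMass m = (m + 1) * subsumMass m + subsumMass m := by ring
    _ ≤ (m + 1) * subsumMass m + (m + 1) *
        ∑' M : Multiset ℕ, (if (∀ x ∈ M, x ≤ m + 1) ∧ m + 1 ∈ M then F M else 0) := by gcongr
    _ = (m + 1) * (subsumMass m +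
        ∑' M : Multiset ℕ, if (∀ x ∈ M, x ≤ m + 1) ∧ m + 1 ∈ M then F M else 0) := by ring
    _ ≤ _ := by gcongr

/-- `subsumMass m / (m + 1)` is nondecreasing. -/
lemma add_one_mul_subsumMass_le {m k : ℕ} (h : m ≤ k) :
    ((k : ℝ≥0∞) + 1) * subsumMass m ≤ (m + 1) * subsumMass k := by
  induction k, h using Nat.le_induction with
  | base => rfl
  | succ k hk ih =>
    have hk0 : (k : ℝ≥0∞) + 1 ≠ 0 := by positivity
    have hk1 : (k : ℝ≥0∞) + 1 ≠ ⊤ := by exact_mod_cast ENNReal.natCast_ne_top (k + 1)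
    refine (ENNReal.mul_le_mul_iff_right hk0 hk1).1 ?_
    calc ((k : ℝ≥0∞) + 1) * (((k + 1 : ℕ) + 1) * subsumMass m)
        = (k + 2) * ((k + 1) * subsumMass m) := by
          push_cast
          ring
      _ ≤ (k + 2) * ((m + 1) * subsumMass k) := by gcongr
      _ = (m + 1) * ((k + 2) * subsumMass k) := by ring
      _ ≤ (m + 1) * ((k + 1) * subsumMass (k + 1)) := mul_le_mul_right (add_two_mul_subsumMass_le k) _
      _ = _ := by ring

lemma tsum_cycleWeight_replicate_mul_two_pow (m : ℕ) :
    ∑' c : ℕ, ((cycleWeight (Multiset.replicate c (m + 1)) : ℝ≥0∞) * 2 ^ c) =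
      ENNReal.ofReal (Real.exp (2 / (m + 1))) := by
  have h : ∀ c : ℕ, ((cycleWeight (Multiset.replicate c (m + 1)) : ℝ≥0∞) * 2 ^ c) =
      ENNReal.ofReal ((2 / (m + 1)) ^ c / c.factorial) := by
    intro c
    have : (2 / ((m : ℝ) + 1)) ^ c / c.factorial =
        ((cycleWeight (Multiset.replicate c (m + 1)) * 2 ^ c : ℝ≥0) : ℝ) := by
      rw [cycleWeight_replicate]
      push_cast
      rw [div_pow, inv_pow]
      ring
    rw [this, ENNReal.ofReal_coe_nnreal]
    push_cast
    rfl
  simp_rw [h]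
  rw [← ENNReal.ofReal_tsum_of_nonneg (fun c => by positivity) (Real.summable_pow_div_factorial _),
    Real.exp_eq_exp_ℝ, NormedSpace.exp_eq_tsum_div]

lemma subsumMass_succ_le (m : ℕ) :
    subsumMass (m + 1) ≤ ENNReal.ofReal (Real.exp (2 / (m + 1))) * subsumMass m := by
  rw [← tsum_cycleWeight_replicate_mul_two_pow, ← ENNReal.tsum_mul_right, subsumMass, subsumMass,
    smallCycleSum, smallCycleSum]
  simp_rw [← ENNReal.tsum_mul_left]
  rw [← ENNReal.tsum_prod]
  refine ENNReal.tsum_le_tsum_of_cover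
    (fun p : ℕ × Multiset ℕ => p.2 + Multiset.replicate p.1 (m + 1)) fun M hM => ?_
  have hMm : ∀ x ∈ M, x ≤ m + 1 := by
    by_contra h
    exact hM (if_neg h)
  have hA : ∀ x ∈ M.filter (· ≤ m), x ≤ m := fun x hx => (Multiset.mem_filter.1 hx).2
  have hdisj : Disjoint (M.filter (· ≤ m)) (Multiset.replicate (M.count (m + 1)) (m + 1)) := by
    rw [Multiset.disjoint_left]
    intro x hx hx'
    have := hA x hx
    rw [Multiset.eq_of_mem_replicate hx'] at this
    omega
  have hsum : M.filter (· ≤ m) + Multiset.replicate (M.count (m + 1)) (m + 1) = M := by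
    ext x
    rw [Multiset.count_add, Multiset.count_filter, Multiset.count_replicate]
    rcases lt_trichotomy x (m + 1) with hx | rfl | hx
    · rw [if_pos (by omega), if_neg (by omega), add_zero]
    · simp
    · rw [if_neg (by omega), if_neg (by omega),
        Multiset.count_eq_zero_of_notMem fun h => by
          have := hMm x h
          omega]
  refine ⟨(M.count (m + 1), M.filter (· ≤ m)), hsum, ?_⟩
  simp only [if_pos hMm, if_pos hA]
  conv_lhs => rw [← hsum, cycleWeight_add_of_disjoint hdisj]
  have hL : ((subsums (M.filter (· ≤ m) +
      Multiset.replicate (M.count (m + 1)) (m + 1))).card : ℝ≥0∞) ≤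
        2 ^ M.count (m + 1) * (subsums (M.filter (· ≤ m))).card := by
    exact_mod_cast card_subsums_add_replicate_le _ _ _
  rw [ENNReal.coe_mul]
  refine (mul_le_mul_right hL _).trans (le_of_eq ?_)
  ring

lemma subsumMass_le_of_le {r k : ℕ} (h : r ≤ k) :
    subsumMass k ≤ ENNReal.ofReal (Real.exp (2 / (r + 1) * (k - r))) * subsumMass r := by
  induction k, h using Nat.le_induction with
  | base => simp
  | succ k hk ih =>
    calc subsumMass (k + 1) ≤ ENNReal.ofReal (Real.exp (2 / (k + 1))) * subsumMass k :=
          subsumMass_succ_le k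
      _ ≤ ENNReal.ofReal (Real.exp (2 / (r + 1))) *
          (ENNReal.ofReal (Real.exp (2 / (r + 1) * (k - r))) * subsumMass r) := by
        gcongr
      _ = _ := by
        rw [← mul_assoc, ← ENNReal.ofReal_mul (Real.exp_nonneg _), ← Real.exp_add]
        congr 3
        push_cast
        ring

lemma subsumMass_ne_top (k : ℕ) : subsumMass k ≠ ⊤ := by
  refine ne_top_of_le_ne_top ?_ (subsumMass_le_of_le (Nat.zero_le k))
  rw [subsumMass_zero, mul_one]
  exact ENNReal.ofReal_ne_top

/-- The multiset containing `j + 1` with multiplicity `c j`. -/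
def multisetOfCounts (k : ℕ) (c : Fin k → ℕ) : Multiset ℕ :=
  ∑ j : Fin k, Multiset.replicate (c j) ((j : ℕ) + 1)

lemma count_multisetOfCounts {k : ℕ} (c : Fin k → ℕ) (x : ℕ) :
    (multisetOfCounts k c).count x = ∑ j : Fin k, if (j : ℕ) + 1 = x then c j else 0 := by
  simp [multisetOfCounts, Multiset.count_sum', Multiset.count_replicate]

lemma count_succ_multisetOfCounts {k : ℕ} (c : Fin k → ℕ) (j : Fin k) :
    (multisetOfCounts k c).count ((j : ℕ) + 1) = c j := by
  rw [count_multisetOfCounts, Finset.sum_eq_single j]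
  · simp
  · intro i _ hij
    rw [if_neg]
    exact fun h => hij (Fin.ext (by omega))
  · simp

lemma mem_multisetOfCounts {k : ℕ} {c : Fin k → ℕ} {x : ℕ} (hx : x ∈ multisetOfCounts k c) :
    ∃ j : Fin k, (j : ℕ) + 1 = x := by
  rw [multisetOfCounts, Multiset.mem_sum] at hx
  obtain ⟨j, -, hj⟩ := hx
  exact ⟨j, (Multiset.eq_of_mem_replicate hj).symm⟩

lemma multisetOfCounts_injective (k : ℕ) : Function.Injective (multisetOfCounts k) := by
  intro c d h
  ext j
  rw [← count_succ_multisetOfCounts c j, h, count_succ_multisetOfCounts]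

lemma multisetOfCounts_count {k : ℕ} {M : Multiset ℕ} (hM : ∀ x ∈ M, 1 ≤ x ∧ x ≤ k) :
    multisetOfCounts k (fun j => M.count ((j : ℕ) + 1)) = M := by
  ext x
  by_cases hx : 1 ≤ x ∧ x ≤ k
  · have := count_succ_multisetOfCounts (fun j : Fin k => M.count ((j : ℕ) + 1))
      ⟨x - 1, by omega⟩
    simpa only [Nat.sub_add_cancel hx.1] using this
  · rw [Multiset.count_eq_zero_of_notMem fun h => hx (hM x h), Multiset.count_eq_zero_of_notMem]
    intro h
    obtain ⟨j, rfl⟩ := mem_multisetOfCounts h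
    exact hx ⟨by omega, j.2⟩

lemma Lset_eq_subsums (k : ℕ) (c : Fin k → ℕ) : Lset k c = subsums (multisetOfCounts k c) := by
  have hsum : ∀ m : Fin k → ℕ,
      (multisetOfCounts k m).sum = ∑ j : Fin k, ((j : ℕ) + 1) * m j := by
    intro m
    rw [multisetOfCounts, Multiset.sum_sum]
    refine Finset.sum_congr rfl fun j _ => ?_
    rw [Multiset.sum_replicate, smul_eq_mul, mul_comm]
  ext s
  simp only [Lset, Finset.mem_image, Finset.mem_Icc, mem_subsums]
  constructor
  · rintro ⟨m, ⟨-, hm⟩, rfl⟩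
    refine ⟨multisetOfCounts k m, ?_, hsum m⟩
    exact Finset.sum_le_sum fun j _ => (Multiset.replicate_le_replicate _).2 (hm j)
  · rintro ⟨D, hD, rfl⟩
    refine ⟨fun j => D.count ((j : ℕ) + 1), ⟨fun _ => Nat.zero_le _, fun j => ?_⟩, ?_⟩
    · rw [← count_succ_multisetOfCounts c j]
      exact Multiset.count_le_of_le _ hD
    · rw [← hsum, multisetOfCounts_count]
      intro x hx
      obtain ⟨j, rfl⟩ := mem_multisetOfCounts (Multiset.mem_of_le hD hx)
      exact ⟨by omega, j.2⟩

lemma pmfVec_eq (k : ℕ) (c : Fin k → ℕ) :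
    pmfVec k c = Real.exp (-harmonic k) * cycleWeight (multisetOfCounts k c) := by
  have hsub : (multisetOfCounts k c).toFinset ⊆
      Finset.univ.image fun j : Fin k => (j : ℕ) + 1 := by
    intro x hx
    obtain ⟨j, rfl⟩ := mem_multisetOfCounts (Multiset.mem_toFinset.1 hx)
    exact Finset.mem_image_of_mem _ (Finset.mem_univ j)
  rw [cycleWeight_eq_prod hsub, Finset.prod_image fun i _ j _ h => Fin.ext (by simpa using h),
    harmonic, ← Fin.sum_univ_eq_sum_range fun i : ℕ => ((i + 1 : ℕ) : ℚ)⁻¹, pmfVec]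
  push_cast
  rw [← Finset.sum_neg_distrib, Real.exp_sum, ← Finset.prod_mul_distrib]
  refine Finset.prod_congr rfl fun j _ => ?_
  rw [count_succ_multisetOfCounts, poissonPdf, one_div]
  ring

lemma EL_eq (k : ℕ) : EL k = Real.exp (-harmonic k) * (subsumMass k).toReal := by
  have hsupp : Function.support (fun M : Multiset ℕ => if ∀ x ∈ M, x ≤ k then
      (cycleWeight M : ℝ≥0∞) * (subsums M).card else 0) ⊆ Set.range (multisetOfCounts k) := by
    intro M hM
    rw [Function.mem_support] at hM
    have hle : ∀ x ∈ M, x ≤ k := by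
      by_contra h
      exact hM (if_neg h)
    refine ⟨_, multisetOfCounts_count fun x hx => ⟨?_, hle x hx⟩⟩
    by_contra h
    have : 0 ∈ M := by rwa [← Nat.lt_one_iff.1 (not_le.1 h)]
    simp [cycleWeight_eq_zero this] at hM
  have hle : ∀ (c : Fin k → ℕ), ∀ x ∈ multisetOfCounts k c, x ≤ k := by
    intro c x hx
    obtain ⟨j, rfl⟩ := mem_multisetOfCounts hx
    exact j.2
  rw [subsumMass, smallCycleSum, ← (multisetOfCounts_injective k).tsum_eq hsupp,
    ENNReal.tsum_toReal_eq, ← tsum_mul_left, EL]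
  · refine tsum_congr fun c => ?_
    rw [if_pos (hle c), pmfVec_eq, Lset_eq_subsums, ENNReal.toReal_mul, ENNReal.coe_toReal,
      ENNReal.toReal_natCast]
    ring
  · intro c
    rw [if_pos (hle c)]
    exact ENNReal.mul_ne_top ENNReal.coe_ne_top (ENNReal.natCast_ne_top _)

lemma subsumMass_toReal_eq (k : ℕ) : (subsumMass k).toReal = Real.exp (harmonic k) * EL k := by
  rw [EL_eq, ← mul_assoc, ← Real.exp_add, add_neg_cancel, Real.exp_zero, one_mul]

lemma EL_nonneg (k : ℕ) : 0 ≤ EL k := by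
  rw [EL_eq]
  positivity

lemma mul_EL_le (k : ℕ) : k * EL k ≤ (subsumMass k).toReal := by
  rw [subsumMass_toReal_eq]
  refine mul_le_mul_of_nonneg_right ?_ (EL_nonneg k)
  calc (k : ℝ) ≤ (k + 1 : ℕ) := by
        push_cast
        linarith
    _ = Real.exp (Real.log (k + 1 : ℕ)) := (Real.exp_log (by positivity)).symm
    _ ≤ _ := Real.exp_le_exp.2 (log_add_one_le_harmonic k)

lemma subsumMass_toReal_le {k : ℕ} (hk : 0 < k) :
    (subsumMass k).toReal ≤ Real.exp 1 * k * EL k := by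
  rw [subsumMass_toReal_eq]
  refine mul_le_mul_of_nonneg_right ?_ (EL_nonneg k)
  calc Real.exp (harmonic k) ≤ Real.exp (1 + Real.log k) :=
        Real.exp_le_exp.2 (harmonic_le_one_add_log k)
    _ = Real.exp 1 * k := by rw [Real.exp_add, Real.exp_log (by exact_mod_cast hk)]

lemma Nat.add_sq_le_two_mul_add (x y : ℕ) : (x + y) ^ 2 ≤ 2 * x ^ 2 + 2 * y ^ 2 := by
  zify
  nlinarith [sq_nonneg ((x : ℤ) - y)]

lemma Multiset.exists_mem_forall_le {M : Multiset ℕ} (hM : M ≠ 0) : ∃ d ∈ M, ∀ x ∈ M, x ≤ d := by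
  obtain ⟨y, hy⟩ := Multiset.exists_mem_of_ne_zero hM
  obtain ⟨d, hd, h⟩ := M.toFinset.exists_max_image id ⟨y, Multiset.mem_toFinset.2 hy⟩
  exact ⟨d, Multiset.mem_toFinset.1 hd, fun x hx => h x (Multiset.mem_toFinset.2 hx)⟩

/-- The weighted count of pairs of a multiset `A` and a number `j ≤ k` bounding the elements of `A`
such that `a - j` is a subset sum of `A`, where `j` has the further weight `1 / j ^ 2`. -/
def markedMass (k a : ℕ) : ℝ≥0∞ :=
  ∑' j : ℕ, ∑' A : Multiset ℕ,
    if (1 ≤ j ∧ j ≤ k) ∧ (∀ x ∈ A, x ≤ j) ∧ ∃ s ∈ subsums A, s + j = a then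
      cycleWeight A * ((j : ℝ≥0∞)⁻¹ * (j : ℝ≥0∞)⁻¹) else 0

/-- `M` splits into parts of sums `a` and `b`, where the largest element of the first part is at
most `k` and at most the largest element of the second part. -/
def SplitsBelow (k a b : ℕ) (M : Multiset ℕ) : Prop :=
  ∃ D D' : Multiset ℕ, D + D' = M ∧ D.sum = a ∧ D'.sum = b ∧
    ∃ d ∈ D, d ≤ k ∧ (∀ x ∈ D, x ≤ d) ∧ ∃ d' ∈ D', d ≤ d'

open Classical in
lemma tsum_splitsBelow_le (k a b : ℕ) :
    ∑' M : Multiset ℕ, (if SplitsBelow k a b M then (cycleWeight M : ℝ≥0∞) else 0) ≤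
      markedMass k a := by
  set g : ℕ × Multiset ℕ × Multiset ℕ → ℝ≥0∞ := fun p =>
    if ((1 ≤ p.1 ∧ p.1 ≤ k) ∧ (∀ x ∈ p.2.1, x ≤ p.1) ∧ ∃ s ∈ subsums p.2.1, s + p.1 = a) ∧
        p.2.1.sum + p.1 < a + b then
      cycleWeight p.2.1 * (p.1 : ℝ≥0∞)⁻¹ *
        (if p.2.2.sum = a + b - (p.2.1.sum + p.1) ∧ ∀ x ∈ p.2.2, p.1 ≤ x then
          (cycleWeight p.2.2 : ℝ≥0∞) else 0)
    else 0 with hg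
  calc _ ≤ ∑' p, g p := by
        refine ENNReal.tsum_le_tsum_of_cover
          (fun p : ℕ × Multiset ℕ × Multiset ℕ => p.2.1 + p.1 ::ₘ p.2.2) fun M hM => ?_
        by_cases hS : SplitsBelow k a b M
        swap
        · exact absurd (if_neg hS) hM
        rw [if_pos hS] at hM
        have h0 : 0 ∉ M := fun h => by simp [cycleWeight_eq_zero h] at hM
        have hS' := hS
        obtain ⟨D, D', hDM, hDa, hDb, d, hdD, hdk, hdmax, d', hd'D, hdd⟩ := hS'
        obtain ⟨D₁, rfl⟩ := Multiset.exists_cons_of_mem hdD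
        have hd1 : 1 ≤ d := by
          by_contra h
          refine h0 ?_
          rw [← hDM, ← Nat.lt_one_iff.1 (not_le.1 h)]
          simp
        have hD' : D'.filter (· < d) + D'.filter (d ≤ ·) = D' := by
          have := Multiset.filter_add_not (· < d) D'
          simpa only [not_lt] using this
        have hB : d' ∈ D'.filter (d ≤ ·) := Multiset.mem_filter.2 ⟨hd'D, hdd⟩
        have hBsum := Multiset.le_sum_of_mem hB
        have hsum := congrArg Multiset.sum hD'
        rw [Multiset.sum_add, hDb] at hsum
        rw [Multiset.sum_cons] at hDa
        have hM' : D₁ + D'.filter (· < d) + d ::ₘ D'.filter (d ≤ ·) = M := by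
          rw [← hDM]
          conv_rhs => rw [← hD']
          simp only [← Multiset.singleton_add]
          abel
        refine ⟨(d, D₁ + D'.filter (· < d), D'.filter (d ≤ ·)), hM', ?_⟩
        simp only [hg]
        rw [if_pos hS, if_pos, if_pos]
        · rw [← hM', mul_assoc]
          refine (ENNReal.coe_le_coe.2 (cycleWeight_add_le _ _)).trans ?_
          rw [ENNReal.coe_mul]
          gcongr
          refine (ENNReal.coe_le_coe.2 (cycleWeight_cons_le _ _)).trans ?_
          rw [ENNReal.coe_mul, ENNReal.coe_inv (by positivity), ENNReal.coe_natCast]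
        · refine ⟨?_, fun x hx => (Multiset.mem_filter.1 hx).2⟩
          rw [Multiset.sum_add]
          omega
        · refine ⟨⟨⟨hd1, hdk⟩, fun x hx => ?_, D₁.sum, ?_, by omega⟩, ?_⟩
          · rcases Multiset.mem_add.1 hx with hx | hx
            · exact hdmax x (Multiset.mem_cons_of_mem hx)
            · exact (Multiset.mem_filter.1 hx).2.le
          · exact mem_subsums.2 ⟨D₁, Multiset.le_add_right _ _, rfl⟩
          · rw [Multiset.sum_add]
            omega
    _ = ∑' j : ℕ, ∑' A : Multiset ℕ, ∑' B : Multiset ℕ, g (j, A, B) := by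
        rw [ENNReal.tsum_prod']
        exact tsum_congr fun j => ENNReal.tsum_prod'
    _ ≤ markedMass k a := by
        refine ENNReal.tsum_le_tsum fun j => ENNReal.tsum_le_tsum fun A => ?_
        simp only [hg]
        split_ifs with h1 h2 h2
        · rw [ENNReal.tsum_mul_left, ← mul_assoc]
          gcongr
          have hj := mul_longCycleProp_le_one (m := j) (by omega) (a + b - (A.sum + j)) (by omega)
          rw [longCycleProp] at hj
          rwa [ENNReal.le_inv_iff_mul_le, mul_comm]
        · exact absurd h1.1 h2
        · simp
        · simp

lemma exists_add_eq_iff_mem_image {A : Multiset ℕ} {a j : ℕ} (h : ∃ s ∈ subsums A, s + j = a) :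
    j ∈ (subsums A).image (a - ·) := by
  obtain ⟨s, hs, rfl⟩ := h
  exact Finset.mem_image.2 ⟨s, hs, by omega⟩

lemma sq_mul_markedMass_le {k a : ℕ} (hka : k ≤ a) :
    (k : ℝ≥0∞) ^ 2 * markedMass k a ≤ 2 * subsumMass k +
      2 * smallCycleSum k fun A =>
        (A.sum : ℝ≥0∞) ^ 2 * (A.sup : ℝ≥0∞)⁻¹ ^ 2 * (subsums A).card := by
  rw [subsumMass, ← smallCycleSum_const_mul, ← smallCycleSum_const_mul, ← smallCycleSum_add,
    markedMass, ENNReal.tsum_comm, ← ENNReal.tsum_mul_left, smallCycleSum]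
  refine ENNReal.tsum_le_tsum fun A => ?_
  set S := (subsums A).image (a - ·) with hS
  set v : ℝ≥0∞ := 2 + 2 * ((A.sum : ℝ≥0∞) ^ 2 * (A.sup : ℝ≥0∞)⁻¹ ^ 2) with hv
  by_cases hA : ∀ x ∈ A, x ≤ k
  · rw [if_pos hA, ← ENNReal.tsum_mul_left]
    calc _ ≤ ∑' j : ℕ, if j ∈ S then cycleWeight A * v else 0 := by
          refine ENNReal.tsum_le_tsum fun j => ?_
          split_ifs with h1 h2 h2
          · obtain ⟨⟨hj1, hjk⟩, hAj, s, hs, hsj⟩ := h1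
            have hsA := le_sum_of_mem_subsums hs
            have hj0 : (j : ℝ≥0∞) ≠ 0 := by
              have : j ≠ 0 := by omega
              exact_mod_cast this
            have hjj : (j : ℝ≥0∞) * (j : ℝ≥0∞)⁻¹ = 1 :=
              ENNReal.mul_inv_cancel hj0 (ENNReal.natCast_ne_top j)
            have hk2 : (k : ℝ≥0∞) ^ 2 ≤ 2 * j ^ 2 + 2 * A.sum ^ 2 := by
              have : k ^ 2 ≤ 2 * j ^ 2 + 2 * A.sum ^ 2 :=
                (Nat.pow_le_pow_left (by omega : k ≤ j + A.sum) 2).trans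
                  (Nat.add_sq_le_two_mul_add _ _)
              exact_mod_cast this
            have hsup : (j : ℝ≥0∞)⁻¹ ≤ (A.sup : ℝ≥0∞)⁻¹ := by
              rw [ENNReal.inv_le_inv]
              exact_mod_cast Multiset.sup_le.2 hAj
            calc (k : ℝ≥0∞) ^ 2 * (cycleWeight A * ((j : ℝ≥0∞)⁻¹ * (j : ℝ≥0∞)⁻¹))
                = cycleWeight A * (k ^ 2 * (j : ℝ≥0∞)⁻¹ ^ 2) := by ring
              _ ≤ cycleWeight A * ((2 * j ^ 2 + 2 * A.sum ^ 2) * (j : ℝ≥0∞)⁻¹ ^ 2) := by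
                gcongr
              _ = cycleWeight A * (2 * (j * (j : ℝ≥0∞)⁻¹) ^ 2 +
                  2 * (A.sum ^ 2 * (j : ℝ≥0∞)⁻¹ ^ 2)) := by ring
              _ ≤ cycleWeight A * v := by
                rw [hjj, one_pow, mul_one, hv]
                gcongr
          · exact absurd (exists_add_eq_iff_mem_image h1.2.2) h2
          · simp
          · simp
      _ = S.card * (cycleWeight A * v) := by
          rw [tsum_eq_sum (s := S) fun j hj => if_neg hj,
            Finset.sum_congr rfl fun j hj => if_pos hj, Finset.sum_const, nsmul_eq_mul]
      _ ≤ (subsums A).card * (cycleWeight A * v) := by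
          gcongr ?_ * _
          exact_mod_cast Finset.card_image_le
      _ = _ := by
          rw [hv]
          ring
  · rw [if_neg hA, ENNReal.tsum_eq_zero.2, mul_zero]
    intro j
    rw [if_neg]
    rintro ⟨⟨-, hjk⟩, hAj, -⟩
    exact hA fun x hx => (hAj x hx).trans hjk

lemma smallCycleSum_add_sum_sq_le (m : ℕ) :
    smallCycleSum m (fun A => ((m + A.sum : ℕ) : ℝ≥0∞) ^ 2 * (subsums A).card) ≤
      14 * m ^ 2 * subsumMass m := by
  calc smallCycleSum m (fun A => ((m + A.sum : ℕ) : ℝ≥0∞) ^ 2 * (subsums A).card)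
      ≤ smallCycleSum m (fun A => 2 * m ^ 2 * (subsums A).card +
          2 * ((A.sum : ℝ≥0∞) ^ 2 * (subsums A).card)) := by
        refine smallCycleSum_mono m fun A _ => ?_
        have := Nat.add_sq_le_two_mul_add m A.sum
        calc ((m + A.sum : ℕ) : ℝ≥0∞) ^ 2 * (subsums A).card
            ≤ (2 * m ^ 2 + 2 * A.sum ^ 2) * (subsums A).card := by
              gcongr
              exact_mod_cast this
          _ = _ := by ring
    _ = 2 * m ^ 2 * subsumMass m +
          2 * smallCycleSum m (fun A => (A.sum : ℝ≥0∞) ^ 2 * (subsums A).card) := by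
        rw [smallCycleSum_add, smallCycleSum_const_mul, smallCycleSum_const_mul, subsumMass]
    _ ≤ 2 * m ^ 2 * subsumMass m + 2 * (6 * m ^ 2 * subsumMass m) := by
        gcongr
        exact smallCycleSum_sum_sq_mul_card_subsums_le m
    _ = _ := by ring

lemma smallCycleSum_sum_sq_div_sup_sq_le {k : ℕ} (hk : 0 < k) :
    (smallCycleSum k fun A =>
      (A.sum : ℝ≥0∞) ^ 2 * (A.sup : ℝ≥0∞)⁻¹ ^ 2 * (subsums A).card) ≤ 56 * subsumMass k := by
  set h : ℕ → Multiset ℕ → ℝ≥0∞ := fun m A =>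
    2 * (m : ℝ≥0∞)⁻¹ ^ 3 * (((m + A.sum : ℕ) : ℝ≥0∞) ^ 2 * (subsums A).card) with hh
  set g : ℕ → Multiset ℕ → ℝ≥0∞ := fun m A =>
    if m ∈ Finset.Icc 1 k then (if ∀ x ∈ A, x ≤ m then cycleWeight A * h m A else 0) else 0
    with hg
  have hcover : (smallCycleSum k fun A =>
      (A.sum : ℝ≥0∞) ^ 2 * (A.sup : ℝ≥0∞)⁻¹ ^ 2 * (subsums A).card) ≤
        ∑' p : ℕ × Multiset ℕ, g p.1 p.2 := by
    refine ENNReal.tsum_le_tsum_of_cover (fun p : ℕ × Multiset ℕ => p.1 ::ₘ p.2) fun M hM => ?_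
    have hMk : ∀ x ∈ M, x ≤ k := by
      by_contra h
      exact hM (if_neg h)
    rw [if_pos hMk] at hM
    have hM0 : M ≠ 0 := by
      rintro rfl
      simp at hM
    obtain ⟨m, hm, hmax⟩ := Multiset.exists_mem_forall_le hM0
    have hsup : M.sup = m := le_antisymm (Multiset.sup_le.2 hmax) (Multiset.le_sup hm)
    obtain ⟨A, rfl⟩ := Multiset.exists_cons_of_mem hm
    have hm0 : m ≠ 0 := by
      rintro rfl
      simp [cycleWeight_eq_zero hm] at hM
    refine ⟨(m, A), rfl, ?_⟩
    simp only [hg]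
    rw [if_pos hMk, if_pos (Finset.mem_Icc.2 ⟨by omega, hMk m hm⟩),
      if_pos fun x hx => hmax x (Multiset.mem_cons_of_mem hx), hsup, Multiset.sum_cons]
    have hw : (cycleWeight (m ::ₘ A) : ℝ≥0∞) ≤ (m : ℝ≥0∞)⁻¹ * cycleWeight A := by
      refine (ENNReal.coe_le_coe.2 (cycleWeight_cons_le _ _)).trans ?_
      rw [ENNReal.coe_mul, ENNReal.coe_inv (by positivity), ENNReal.coe_natCast]
    calc _ ≤ ((m : ℝ≥0∞)⁻¹ * cycleWeight A) * (((m + A.sum : ℕ) : ℝ≥0∞) ^ 2 *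
          (m : ℝ≥0∞)⁻¹ ^ 2 * (2 * (subsums A).card)) := by
          gcongr
          exact card_subsums_cons_le_cast m A
      _ = _ := by
          rw [hh]
          ring
  have hbound : ∀ m ∈ Finset.Icc 1 k, (k : ℝ≥0∞) * smallCycleSum m (h m) ≤ 56 * subsumMass k := by
    intro m hm
    rw [Finset.mem_Icc] at hm
    have hm0 : (m : ℝ≥0∞) ≠ 0 := by
      have : m ≠ 0 := by omega
      exact_mod_cast this
    have hmm : (m : ℝ≥0∞)⁻¹ * m = 1 := ENNReal.inv_mul_cancel hm0 (ENNReal.natCast_ne_top m)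
    calc (k : ℝ≥0∞) * smallCycleSum m (h m)
        ≤ k * (2 * (m : ℝ≥0∞)⁻¹ ^ 3 * (14 * m ^ 2 * subsumMass m)) := by
          rw [hh, smallCycleSum_const_mul]
          gcongr
          exact smallCycleSum_add_sum_sq_le m
      _ = 28 * ((m : ℝ≥0∞)⁻¹ * m) ^ 2 * ((m : ℝ≥0∞)⁻¹ * (k * subsumMass m)) := by ring
      _ ≤ 28 * ((m : ℝ≥0∞)⁻¹ * m) ^ 2 * ((m : ℝ≥0∞)⁻¹ * (2 * m * subsumMass k)) := by
          gcongr _ * (_ * ?_)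
          calc (k : ℝ≥0∞) * subsumMass m ≤ (k + 1) * subsumMass m := by
                gcongr
                exact le_self_add
            _ ≤ (m + 1) * subsumMass k := add_one_mul_subsumMass_le hm.2
            _ ≤ 2 * m * subsumMass k := by
                gcongr
                have : m + 1 ≤ 2 * m := by omega
                exact_mod_cast this
      _ = 56 * ((m : ℝ≥0∞)⁻¹ * m) ^ 3 * subsumMass k := by ring
      _ = _ := by rw [hmm, one_pow, mul_one]
  have hk0 : (k : ℝ≥0∞) ≠ 0 := by exact_mod_cast hk.ne'
  refine (ENNReal.mul_le_mul_iff_right hk0 (ENNReal.natCast_ne_top k)).1 ?_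
  calc _ ≤ (k : ℝ≥0∞) * ∑' p : ℕ × Multiset ℕ, g p.1 p.2 := by gcongr
    _ = k * ∑ m ∈ Finset.Icc 1 k, smallCycleSum m (h m) := by
        rw [ENNReal.tsum_prod, tsum_eq_sum (s := Finset.Icc 1 k)]
        · congr 1
          refine Finset.sum_congr rfl fun m hm => ?_
          simp only [hg, if_pos hm, smallCycleSum]
        · intro m hm
          simp only [hg, if_neg hm, tsum_zero]
    _ ≤ ∑ m ∈ Finset.Icc 1 k, 56 * subsumMass k := by
        rw [Finset.mul_sum]
        exact Finset.sum_le_sum hbound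
    _ = _ := by rw [Finset.sum_const, Nat.card_Icc, nsmul_eq_mul, Nat.add_sub_cancel]

lemma sq_mul_markedMass_le_subsumMass {k a : ℕ} (hk : 0 < k) (hka : k ≤ a) :
    (k : ℝ≥0∞) ^ 2 * markedMass k a ≤ 114 * subsumMass k := by
  calc _ ≤ 2 * subsumMass k + 2 * (56 * subsumMass k) := by
        refine (sq_mul_markedMass_le hka).trans ?_
        gcongr
        exact smallCycleSum_sum_sq_div_sup_sq_le hk
    _ = _ := by ring

lemma sq_mul_ofReal_iProp_le {n k : ℕ} (hk : 0 < k) (hn : 2 * k ≤ n) :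
    (k : ℝ≥0∞) ^ 2 * ENNReal.ofReal (iProp n k) ≤ 228 * subsumMass k := by
  classical
  have hsplit : ENNReal.ofReal (iProp n k) ≤ markedMass k k + markedMass k (n - k) := by
    rw [ofReal_iProp]
    refine le_trans ?_ (add_le_add (tsum_splitsBelow_le k k (n - k))
      (tsum_splitsBelow_le k (n - k) k))
    rw [← ENNReal.tsum_add]
    refine ENNReal.tsum_le_tsum fun M => ?_
    by_cases h : M.sum = n ∧ k ∈ subsums M
    swap
    · rw [if_neg h]
      exact zero_le
    rw [if_pos h]
    obtain ⟨hMn, hMk⟩ := h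
    obtain ⟨D, hDM, hD⟩ := mem_subsums.1 hMk
    obtain ⟨D', rfl⟩ := Multiset.le_iff_exists_add.1 hDM
    rw [Multiset.sum_add] at hMn
    have hD' : D'.sum = n - k := by omega
    have hD0 : D ≠ 0 := by
      rintro rfl
      simp at hD
      omega
    have hD'0 : D' ≠ 0 := by
      rintro rfl
      simp at hD'
      omega
    obtain ⟨d, hd, hdmax⟩ := Multiset.exists_mem_forall_le hD0
    obtain ⟨d', hd', hd'max⟩ := Multiset.exists_mem_forall_le hD'0
    have hdk : d ≤ k := hD ▸ Multiset.le_sum_of_mem hd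
    rcases le_total d d' with hdd | hdd
    · rw [if_pos (c := SplitsBelow k k (n - k) (D + D'))
        ⟨D, D', rfl, hD, hD', d, hd, hdk, hdmax, d', hd', hdd⟩]
      exact le_self_add
    · rw [if_pos (c := SplitsBelow k (n - k) k (D + D'))
        ⟨D', D, add_comm _ _, hD', hD, d', hd', hdd.trans hdk, hd'max, d, hd, hdd⟩]
      exact le_add_self
  calc _ ≤ (k : ℝ≥0∞) ^ 2 * (markedMass k k + markedMass k (n - k)) := by gcongr
    _ = (k : ℝ≥0∞) ^ 2 * markedMass k k + (k : ℝ≥0∞) ^ 2 * markedMass k (n - k) := mul_add _ _ _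
    _ ≤ 114 * subsumMass k + 114 * subsumMass k :=
        add_le_add (sq_mul_markedMass_le_subsumMass hk le_rfl)
          (sq_mul_markedMass_le_subsumMass hk (by omega))
    _ = _ := by ring

lemma sum_count_Ioc (M : Multiset ℕ) (r k : ℕ) :
    ∑ j ∈ Finset.Ioc r k, M.count j = (M.filter fun x => r < x ∧ x ≤ k).card := by
  rw [← Multiset.sum_count_eq_card (s := Finset.Ioc r k) fun x hx =>
    Finset.mem_Ioc.2 (Multiset.mem_filter.1 hx).2]
  refine Finset.sum_congr rfl fun j hj => ?_
  exact (Multiset.count_filter_of_pos (p := fun x => r < x ∧ x ≤ k) (Finset.mem_Ioc.1 hj)).symm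

/-- A decomposition of a multiset with sum `n` into a part `A` with small elements and small sum, a
single element `j` such that `k - j` is a subset sum of `A`, and a part `B` with large elements. -/
structure IsSmallLargeSplit (n k j : ℕ) (A B : Multiset ℕ) : Prop where
  le_div : ∀ x ∈ A, x ≤ k / 8
  two_mul_sum_le : 2 * A.sum ≤ k
  exists_add_eq : ∃ s ∈ subsums A, s + j = k
  sum_eq : B.sum = n - (A.sum + j)
  min_le : ∀ x ∈ B, min (n - (A.sum + j)) (k + 1) ≤ x

namespace IsSmallLargeSplit

variable {n k j : ℕ} {A B : Multiset ℕ}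

lemma le_two_mul_and_le (h : IsSmallLargeSplit n k j A B) : k ≤ 2 * j ∧ j ≤ k := by
  obtain ⟨s, hs, hsj⟩ := h.exists_add_eq
  have := le_sum_of_mem_subsums hs
  have := h.two_mul_sum_le
  omega

lemma div_lt (h : IsSmallLargeSplit n k j A B) (hk : 0 < k) (hn : 2 * k ≤ n) :
    ∀ x ∈ j ::ₘ B, k / 8 < x := by
  have hj := h.le_two_mul_and_le
  have hA := h.two_mul_sum_le
  intro x hx
  rcases Multiset.mem_cons.1 hx with rfl | hx
  · omega
  · have := h.min_le x hx
    omega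

lemma filter_eq (h : IsSmallLargeSplit n k j A B) (hk : 0 < k) (hn : 2 * k ≤ n) :
    (A + j ::ₘ B).filter (· ≤ k / 8) = A := by
  rw [Multiset.filter_add, Multiset.filter_eq_self.2 h.le_div,
    Multiset.filter_eq_nil.2 fun x hx => not_le.2 (h.div_lt hk hn x hx), add_zero]

lemma disjoint (h : IsSmallLargeSplit n k j A B) (hk : 0 < k) (hn : 2 * k ≤ n) :
    Disjoint A (j ::ₘ B) := by
  rw [Multiset.disjoint_left]
  intro x hA hB
  exact absurd (h.le_div x hA) (not_le.2 (h.div_lt hk hn x hB))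

lemma sum_add_cons (h : IsSmallLargeSplit n k j A B) (hn : 2 * k ≤ n) :
    (A + j ::ₘ B).sum = n := by
  have hj := h.le_two_mul_and_le
  have hA := h.two_mul_sum_le
  rw [Multiset.sum_add, Multiset.sum_cons, h.sum_eq]
  omega

lemma mem_subsums_add_cons (h : IsSmallLargeSplit n k j A B) : k ∈ subsums (A + j ::ₘ B) := by
  obtain ⟨s, hs, hsj⟩ := h.exists_add_eq
  obtain ⟨D, hD, rfl⟩ := mem_subsums.1 hs
  refine mem_subsums.2 ⟨D + {j}, add_le_add hD ?_, by simpa using hsj⟩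
  exact Multiset.singleton_le.2 (Multiset.mem_cons_self _ _)

lemma card_filter_le_two (h : IsSmallLargeSplit n k j A B) (hn : 2 * k ≤ n) (hk : 0 < k) :
    ((A + j ::ₘ B).filter fun x => k / 8 < x ∧ x ≤ k).card ≤ 2 := by
  have hj := h.le_two_mul_and_le
  have hA := h.two_mul_sum_le
  rw [Multiset.filter_add, Multiset.filter_eq_nil.2 fun x hx hx' =>
    absurd (h.le_div x hx) (not_le.2 hx'.1), zero_add]
  have hB : (B.filter fun x => k / 8 < x ∧ x ≤ k).card ≤ 1 := by
    rcases le_or_gt (k + 1) (n - (A.sum + j)) with hs | hs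
    · rw [Multiset.filter_eq_nil.2 fun x hx hx' => ?_, Multiset.card_zero]
      · exact zero_le_one
      · have := h.min_le x hx
        omega
    · refine (Multiset.card_le_card (Multiset.filter_le _ _)).trans ?_
      have := Multiset.card_nsmul_le_sum (a := n - (A.sum + j)) (s := B) fun x hx => by
        have := h.min_le x hx
        omega
      rw [h.sum_eq, smul_eq_mul] at this
      exact Nat.le_of_mul_le_mul_right (by simpa using this) (by omega : 0 < n - (A.sum + j))
  rw [← Multiset.singleton_add, Multiset.filter_add, Multiset.card_add]
  have := Multiset.card_le_card (Multiset.filter_le (fun x => k / 8 < x ∧ x ≤ k) {j})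
  rw [Multiset.card_singleton] at this
  omega

lemma mul_cycleWeight_le (h : IsSmallLargeSplit n k j A B) (hk : 0 < k) (hn : 2 * k ≤ n) :
    (cycleWeight A : ℝ≥0∞) * ((j : ℝ≥0∞)⁻¹ * cycleWeight B) ≤
      (A + j ::ₘ B).count j * cycleWeight (A + j ::ₘ B) := by
  have hj : j ≠ 0 := by
    have := h.le_two_mul_and_le
    omega
  have hw := cycleWeight_cons j B
  rw [cycleWeight_add_of_disjoint (h.disjoint hk hn)]
  calc (cycleWeight A : ℝ≥0∞) * ((j : ℝ≥0∞)⁻¹ * cycleWeight B)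
      = ((cycleWeight A * ((j : ℝ≥0)⁻¹ * cycleWeight B) : ℝ≥0) : ℝ≥0∞) := by
        push_cast [ENNReal.coe_inv (Nat.cast_ne_zero.2 hj : (j : ℝ≥0) ≠ 0)]
        rfl
    _ = ((B.count j + 1 : ℕ) : ℝ≥0∞) * (cycleWeight A * cycleWeight (j ::ₘ B) : ℝ≥0) := by
        rw [← hw]
        push_cast
        ring
    _ ≤ _ := by
        gcongr
        simp

end IsSmallLargeSplit

open Classical in
lemma tsum_isSmallLargeSplit_le {n k : ℕ} (hk : 0 < k) (hn : 2 * k ≤ n) :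
    ∑' j : ℕ, ∑' A : Multiset ℕ, ∑' B : Multiset ℕ, (if IsSmallLargeSplit n k j A B then
      (cycleWeight A : ℝ≥0∞) * ((j : ℝ≥0∞)⁻¹ * cycleWeight B) else 0) ≤
        2 * ENNReal.ofReal (iProp n k) := by
  set P : Multiset ℕ → Prop := fun M => (M.sum = n ∧ k ∈ subsums M) ∧
    (M.filter fun x => k / 8 < x ∧ x ≤ k).card ≤ 2 with hP
  calc _ ≤ ∑' j : ℕ, ∑' M : Multiset ℕ, if j ∈ Finset.Ioc (k / 8) k ∧ P M then
        (M.count j : ℝ≥0∞) * cycleWeight M else 0 := by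
        refine ENNReal.tsum_le_tsum fun j => ?_
        rw [← ENNReal.tsum_prod (f := fun A B => if IsSmallLargeSplit n k j A B then
          (cycleWeight A : ℝ≥0∞) * ((j : ℝ≥0∞)⁻¹ * cycleWeight B) else 0)]
        have hsupp : ∀ p : Multiset ℕ × Multiset ℕ, (if IsSmallLargeSplit n k j p.1 p.2 then
            (cycleWeight p.1 : ℝ≥0∞) * ((j : ℝ≥0∞)⁻¹ * cycleWeight p.2) else 0) ≠ 0 →
              IsSmallLargeSplit n k j p.1 p.2 := fun p hp => by
          by_contra h
          exact hp (if_neg h)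
        refine ENNReal.tsum_le_tsum_of_injOn (fun p => p.1 + j ::ₘ p.2) ?_ ?_
        · rintro ⟨A, B⟩ h ⟨A', B'⟩ h' heq
          replace h := hsupp _ h
          replace h' := hsupp _ h'
          dsimp only at h h' heq
          have hA : A = A' := by
            rw [← h.filter_eq hk hn, heq, h'.filter_eq hk hn]
          subst hA
          rw [add_right_inj, Multiset.cons_inj_right] at heq
          rw [heq]
        · rintro ⟨A, B⟩ h
          replace h := hsupp _ h
          dsimp only at h ⊢
          rw [if_pos h, if_pos]
          · exact h.mul_cycleWeight_le hk hn
          · refine ⟨Finset.mem_Ioc.2 ⟨h.div_lt hk hn j (Multiset.mem_cons_self _ _), h.le_two_mul_and_le.2⟩,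
              ⟨h.sum_add_cons hn, h.mem_subsums_add_cons⟩, h.card_filter_le_two hn hk⟩
    _ ≤ ∑' M : Multiset ℕ, 2 * if M.sum = n ∧ k ∈ subsums M then
        (cycleWeight M : ℝ≥0∞) else 0 := by
        rw [ENNReal.tsum_comm]
        refine ENNReal.tsum_le_tsum fun M => ?_
        by_cases hM : P M
        · rw [if_pos hM.1, tsum_eq_sum (s := Finset.Ioc (k / 8) k) fun j hj =>
            if_neg fun h => hj h.1, Finset.sum_congr rfl fun j hj => if_pos ⟨hj, hM⟩,
            ← Finset.sum_mul, ← Nat.cast_sum, sum_count_Ioc]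
          gcongr
          exact_mod_cast hM.2
        · simp [hM]
    _ = _ := by rw [ENNReal.tsum_mul_left, ofReal_iProp]

open Classical in
lemma smallCycleSum_card_subsums_of_two_mul_sum_le {n k : ℕ} (hk : 0 < k) (hn : 2 * k ≤ n) :
    smallCycleSum (k / 8) (fun A => if 2 * A.sum ≤ k then ((subsums A).card : ℝ≥0∞) else 0) ≤
      8 * k ^ 2 * ENNReal.ofReal (iProp n k) := by
  calc _ ≤ 4 * k ^ 2 * ∑' j : ℕ, ∑' A : Multiset ℕ, ∑' B : Multiset ℕ,
        (if IsSmallLargeSplit n k j A B then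
          (cycleWeight A : ℝ≥0∞) * ((j : ℝ≥0∞)⁻¹ * cycleWeight B) else 0) := by
        rw [ENNReal.tsum_comm, ← ENNReal.tsum_mul_left, smallCycleSum]
        refine ENNReal.tsum_le_tsum fun A => ?_
        split_ifs with hA hAk
        · rw [← Finset.card_image_of_injOn (f := fun s => k - s) (s := subsums A), mul_comm,
            ← nsmul_eq_mul, ← Finset.sum_const, ← ENNReal.tsum_mul_left]
          · refine le_trans (Finset.sum_le_sum fun j hj => ?_) (ENNReal.sum_le_tsum _)
            obtain ⟨s, hs, rfl⟩ := Finset.mem_image.1 hj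
            have hsA := le_sum_of_mem_subsums hs
            set j := k - s with hj
            set m := n - (A.sum + j) with hm
            have hsplit : ∀ B : Multiset ℕ, (if IsSmallLargeSplit n k j A B then
                (cycleWeight A : ℝ≥0∞) * ((j : ℝ≥0∞)⁻¹ * cycleWeight B) else 0) =
                  cycleWeight A * (j : ℝ≥0∞)⁻¹ * if B.sum = m ∧ ∀ x ∈ B, min m (k + 1) ≤ x then
                    (cycleWeight B : ℝ≥0∞) else 0 := fun B => by
              have : IsSmallLargeSplit n k j A B ↔ B.sum = m ∧ ∀ x ∈ B, min m (k + 1) ≤ x :=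
                ⟨fun h => ⟨h.sum_eq, h.min_le⟩,
                  fun h => ⟨hA, hAk, ⟨s, hs, by omega⟩, h.1, h.2⟩⟩
              simp only [this]
              split_ifs <;> ring
            rw [tsum_congr hsplit, ENNReal.tsum_mul_left]
            change _ ≤ _ * (_ * longCycleProp m (min m (k + 1)))
            have h1 := one_le_mul_longCycleProp (m := min m (k + 1)) (by omega) m (min_le_left _ _)
            have h2 : (1 : ℝ≥0∞) ≤ k * (j : ℝ≥0∞)⁻¹ := by
              have hj0 : (j : ℝ≥0∞) ≠ 0 := by
                have : j ≠ 0 := by omega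
                exact_mod_cast this
              rw [← ENNReal.mul_inv_cancel hj0 (ENNReal.natCast_ne_top j)]
              gcongr
              omega
            calc (cycleWeight A : ℝ≥0∞) = cycleWeight A * (1 * 1) := by ring
              _ ≤ cycleWeight A * ((k * (j : ℝ≥0∞)⁻¹) *
                  (2 * (2 * k : ℕ) * longCycleProp m (min m (k + 1)))) := by
                  gcongr
                  refine h1.trans ?_
                  gcongr
                  omega
              _ = _ := by
                  push_cast
                  ring
          · intro s hs t ht hst
            have := le_sum_of_mem_subsums hs
            have := le_sum_of_mem_subsums ht
            dsimp only at hst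
            omega
        · simp
        · simp
    _ ≤ 4 * k ^ 2 * (2 * ENNReal.ofReal (iProp n k)) := by
        gcongr
        exact tsum_isSmallLargeSplit_le hk hn
    _ = _ := by ring

lemma subsumMass_div_le {n k : ℕ} (hk : 0 < k) (hn : 2 * k ≤ n) :
    subsumMass (k / 8) ≤ 16 * k ^ 2 * ENNReal.ofReal (iProp n k) := by
  set r := k / 8 with hr
  have hk0 : (k : ℝ≥0∞) ≠ 0 := by exact_mod_cast hk.ne'
  have hkt := ENNReal.natCast_ne_top k
  have htail : k * subsumMass r ≤ k * (8 * k ^ 2 * ENNReal.ofReal (iProp n k)) +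
      4 * r * subsumMass r := by
    calc (k : ℝ≥0∞) * subsumMass r ≤ smallCycleSum r (fun A =>
          k * (if 2 * A.sum ≤ k then ((subsums A).card : ℝ≥0∞) else 0) +
            2 * (A.sum * (subsums A).card)) := by
          rw [subsumMass, ← smallCycleSum_const_mul]
          refine smallCycleSum_mono r fun A _ => ?_
          split_ifs with h
          · exact le_self_add
          · rw [mul_zero, zero_add, ← mul_assoc]
            gcongr
            exact_mod_cast (not_le.1 h).le
      _ = k * smallCycleSum r (fun A => if 2 * A.sum ≤ k then ((subsums A).card : ℝ≥0∞) else 0) +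
          2 * smallCycleSum r (fun A => A.sum * (subsums A).card) := by
          rw [smallCycleSum_add, smallCycleSum_const_mul, smallCycleSum_const_mul]
      _ ≤ k * (8 * k ^ 2 * ENNReal.ofReal (iProp n k)) + 2 * (2 * r * subsumMass r) := by
          gcongr
          · exact smallCycleSum_card_subsums_of_two_mul_sum_le hk hn
          · exact smallCycleSum_sum_mul_card_subsums_le r
      _ = _ := by ring
  have hdouble : (k : ℝ≥0∞) * subsumMass r + k * subsumMass r ≤
      k * (16 * k ^ 2 * ENNReal.ofReal (iProp n k)) + k * subsumMass r := by
    calc (k : ℝ≥0∞) * subsumMass r + k * subsumMass r = 2 * (k * subsumMass r) := by ring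
      _ ≤ 2 * (k * (8 * k ^ 2 * ENNReal.ofReal (iProp n k)) + 4 * r * subsumMass r) := by gcongr
      _ = k * (16 * k ^ 2 * ENNReal.ofReal (iProp n k)) + (8 * r : ℕ) * subsumMass r := by
          push_cast
          ring
      _ ≤ _ := by
          gcongr
          omega
  have h := (ENNReal.add_le_add_iff_right (ENNReal.mul_ne_top hkt (subsumMass_ne_top r))).1 hdouble
  exact (ENNReal.mul_le_mul_iff_right hk0 hkt).1 h

lemma subsumMass_le_ofReal_iProp {n k : ℕ} (hk : 0 < k) (hn : 2 * k ≤ n) :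
    subsumMass k ≤
      ENNReal.ofReal (Real.exp 16) * (16 * k ^ 2 * ENNReal.ofReal (iProp n k)) := by
  refine (subsumMass_le_of_le (Nat.div_le_self k 8)).trans ?_
  gcongr
  · have h : (k : ℝ) ≤ 8 * ((k / 8 : ℕ) + 1) := by
      have : k ≤ 8 * (k / 8 + 1) := by omega
      exact_mod_cast this
    rw [div_mul_eq_mul_div, div_le_iff₀ (by positivity)]
    have : (0 : ℝ) ≤ (k / 8 : ℕ) := by positivity
    linarith
  · exact subsumMass_div_le hk hn

lemma iProp_nonneg (n k : ℕ) : 0 ≤ iProp n k := by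
  unfold iProp
  positivity

theorem i_n_k_asymp_EL :
    ∃ C1 C2 : ℝ, 0 < C1 ∧ 0 < C2 ∧
      ∀ n k : ℕ, 1 ≤ k → 2 * k ≤ n →
        C1 * (1 / (k : ℝ)) * EL k ≤ iProp n k ∧
        iProp n k ≤ C2 * (1 / (k : ℝ)) * EL k := by
  refine ⟨1 / (16 * Real.exp 16), 228 * Real.exp 1, by positivity, by positivity,
    fun n k hk hn => ?_⟩
  have hk0 : (0 : ℝ) < k := by exact_mod_cast hk
  have hi := iProp_nonneg n k
  have hlow := ENNReal.toReal_mono (by finiteness) (subsumMass_le_ofReal_iProp hk hn)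
  have hupp := ENNReal.toReal_mono (ENNReal.mul_ne_top (by finiteness) (subsumMass_ne_top k))
    (sq_mul_ofReal_iProp_le hk hn)
  simp only [ENNReal.toReal_mul, ENNReal.toReal_pow, ENNReal.toReal_natCast,
    ENNReal.toReal_ofNat, ENNReal.toReal_ofReal hi,
    ENNReal.toReal_ofReal (Real.exp_pos 16).le] at hlow hupp
  constructor
  · have h : (k : ℝ) * EL k ≤ k * (16 * Real.exp 16 * k * iProp n k) := by
      refine (mul_EL_le k).trans (hlow.trans_eq ?_)
      ring
    have h' := le_of_mul_le_mul_left h hk0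
    rw [div_mul_div_comm, div_mul_eq_mul_div, div_le_iff₀ (by positivity)]
    linarith
  · have h : (k : ℝ) * (k * iProp n k) ≤ k * (228 * Real.exp 1 * EL k) := by
      calc (k : ℝ) * (k * iProp n k) = k ^ 2 * iProp n k := by ring
        _ ≤ 228 * (subsumMass k).toReal := hupp
        _ ≤ 228 * (Real.exp 1 * k * EL k) := by
          gcongr
          exact subsumMass_toReal_le hk
        _ = _ := by ring
    have h' := le_of_mul_le_mul_left h hk0
    rw [mul_one_div, div_mul_eq_mul_div, le_div_iff₀ hk0]
    linarith
end
end
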